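/- Let ℓ ≥ 0 and k ≥ 1 be integers with ℓ + k > 1, and let p_1, …, p_k be (not necessarily distinct) primes. Then for every non-negative function ψ : ℕ → ℝ, one has μ(W_{ℓ,p_1,…,p_k}(ψ)) = 1 if and only if Σ_{n∈ℕ} μ(E_n^{ℓ,p_1,…,p_k}(ψ)) = ∞. -/

import Mathlib

open MeasureTheory Filter
open scoped ENNReal

noncomputable section

/-- The set `E_n^{ℓ,p_1,…,p_k}(ψ) ⊆ (ℝ/ℤ)^ℓ × ℤ_{p_1} × ⋯ × ℤ_{p_k}`: points all of
whose coordinates admit a rational approximation `a/n` with `|a| ≤ n`, `gcd(a,n) = 1`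
within distance `ψ(n)` (quotient distance on the circle coordinates, `p_i`-adic
distance on the `p_i`-adic coordinates). -/
def prodE (ℓ k : ℕ) (P : Fin k → ℕ) [∀ i, Fact (P i).Prime] (ψ : ℕ → ℝ) (n : ℕ) :
    Set ((Fin ℓ → UnitAddCircle) × ((i : Fin k) → ℤ_[P i])) :=
  {x | (∀ i : Fin ℓ, ∃ a : ℤ, |a| ≤ (n : ℤ) ∧ Int.gcd a n = 1 ∧
          ‖x.1 i - (((a : ℝ) / (n : ℝ) : ℝ) : UnitAddCircle)‖ ≤ ψ n) ∧
       (∀ i : Fin k, ∃ a : ℤ, |a| ≤ (n : ℤ) ∧ Int.gcd a n = 1 ∧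
          ‖(x.2 i : ℚ_[P i]) - (a : ℚ_[P i]) / (n : ℚ_[P i])‖ ≤ ψ n)}

/-- `W_{ℓ,p_1,…,p_k}(ψ)`: points lying in infinitely many of the sets
`E_n^{ℓ,p_1,…,p_k}(ψ)`. -/
def prodW (ℓ k : ℕ) (P : Fin k → ℕ) [∀ i, Fact (P i).Prime] (ψ : ℕ → ℝ) :
    Set ((Fin ℓ → UnitAddCircle) × ((i : Fin k) → ℤ_[P i])) :=
  {x | {n : ℕ | x ∈ prodE ℓ k P ψ n}.Infinite}

/-- The product measure on `(ℝ/ℤ)^ℓ × ℤ_{p_1} × ⋯ × ℤ_{p_k}` built from Lebesgue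
measure on the circle factors and given measures on the `p_i`-adic factors. -/
def prodMeasure (ℓ k : ℕ) (P : Fin k → ℕ) [∀ i, Fact (P i).Prime]
    [∀ i, MeasurableSpace ℤ_[P i]] (μs : (i : Fin k) → Measure ℤ_[P i]) :
    Measure ((Fin ℓ → UnitAddCircle) × ((i : Fin k) → ℤ_[P i])) :=
  (Measure.pi fun _ : Fin ℓ => (volume : Measure UnitAddCircle)).prod (Measure.pi μs)

open Topology in
theorem tendsto_setIntegral_div_of_isPiSystem {X : Type*} [mX : MeasurableSpace X] (μ : Measure X)
    [IsProbabilityMeasure μ] {C : Set (Set X)} (hC : IsPiSystem C)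
    (hgen : mX = MeasurableSpace.generateFrom C) {F : ℕ → X → ℝ} {s : ℕ → ℝ} {K : ℝ}
    (hF0 : ∀ n x, 0 ≤ F n x) (hFint : ∀ n, Integrable (F n) μ)
    (hF2 : ∀ n, Integrable (fun x => F n x ^ 2) μ)
    (hs : ∀ n, ∫ x, F n x ∂μ = s n) (hspos : ∀ᶠ n in atTop, 0 < s n)
    (hK : ∀ᶠ n in atTop, ∫ x, F n x ^ 2 ∂μ ≤ K * s n ^ 2)
    (hbasic : ∀ A ∈ C, Tendsto (fun n => (∫ x in A, F n x ∂μ) / s n) atTop (𝓝 (μ.real A)))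
    (A : Set X) (hA : MeasurableSet A) :
    Tendsto (fun n => (∫ x in A, F n x ∂μ) / s n) atTop (𝓝 (μ.real A)) := by
  have key : ∀ B : Set X, MeasurableSet B → ∀ η : ℝ, 0 < η →
      ∀ᶠ n in atTop, (∫ x in B, F n x ∂μ) / s n ≤ η * K + μ.real B / η := by
    intro B hB η hη
    filter_upwards [hspos, hK] with n hn hKn
    have h1 : ∫ x in B, F n x ∂μ ≤ ∫ x in B, (η / s n * F n x ^ 2 + s n / η) ∂μ := by
      apply integral_mono (hFint n).integrableOn
      · exact ((hF2 n).const_mul _).integrableOn.add (integrable_const _)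
      · intro x
        have h2 : 0 ≤ (η * F n x - s n) ^ 2 + η * F n x * s n :=
          add_nonneg (sq_nonneg _) (mul_nonneg (mul_nonneg hη.le (hF0 n x)) hn.le)
        have : η / s n * F n x ^ 2 + s n / η - F n x
            = ((η * F n x - s n) ^ 2 + η * F n x * s n) / (η * s n) := by
          field_simp; ring
        have h3 : 0 ≤ η / s n * F n x ^ 2 + s n / η - F n x := by
          rw [this]; positivity
        simpa using h3
    have h4 : ∫ x in B, (η / s n * F n x ^ 2 + s n / η) ∂μ
        ≤ η / s n * (K * s n ^ 2) + μ.real B * (s n / η) := by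
      rw [integral_add ((hF2 n).const_mul _).integrableOn (integrable_const _),
        integral_const_mul, integral_const]
      simp only [measureReal_restrict_apply_univ, smul_eq_mul]
      gcongr
      refine le_trans (setIntegral_le_integral (hF2 n) ?_) hKn
      exact Eventually.of_forall fun x => sq_nonneg _
    calc (∫ x in B, F n x ∂μ) / s n
        ≤ (η / s n * (K * s n ^ 2) + μ.real B * (s n / η)) / s n := by
          gcongr; exact h1.trans h4
      _ = η * K + μ.real B / η := by field_simp
  have hunion : ∀ f : ℕ → Set X, Pairwise (Function.onFun Disjoint f) →
      (∀ i, MeasurableSet (f i)) →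
      (∀ i, Tendsto (fun n => (∫ x in f i, F n x ∂μ) / s n) atTop (𝓝 (μ.real (f i)))) →
      Tendsto (fun n => (∫ x in ⋃ i, f i, F n x ∂μ) / s n) atTop (𝓝 (μ.real (⋃ i, f i))) := by
    intro f hd hm ih
    have hfin : ∀ k : ℕ, Tendsto (fun n => (∫ x in ⋃ i ∈ Finset.range k, f i, F n x ∂μ) / s n)
        atTop (𝓝 (μ.real (⋃ i ∈ Finset.range k, f i))) := by
      intro k
      have e1 : ∀ n, (∫ x in ⋃ i ∈ Finset.range k, f i, F n x ∂μ)
          = ∑ i ∈ Finset.range k, ∫ x in f i, F n x ∂μ := fun n =>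
        integral_biUnion_finset _ (fun i _ => hm i) (fun i _ j _ hij => hd hij)
          (fun i _ => (hFint n).integrableOn)
      have e2 : μ.real (⋃ i ∈ Finset.range k, f i) = ∑ i ∈ Finset.range k, μ.real (f i) :=
        measureReal_biUnion_finset (fun i _ j _ hij => hd hij) (fun i _ => hm i)
      simp_rw [e1, e2, Finset.sum_div]
      exact tendsto_finsetSum _ fun i _ => ih i
    have htail : Tendsto (fun k : ℕ => μ.real (⋃ i, f i) - μ.real (⋃ i ∈ Finset.range k, f i))
        atTop (𝓝 0) := by
      have h1 : HasSum (fun i => μ.real (f i)) (μ.real (⋃ i, f i)) := by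
        have := measure_iUnion hd hm (μ := μ)
        have hne : ∑' i, μ (f i) ≠ ∞ := by rw [← this]; exact measure_ne_top _ _
        have h2 := ENNReal.hasSum_toReal hne
        rw [← ENNReal.tsum_toReal_eq fun i => measure_ne_top _ _, ← this] at h2
        exact h2
      have h2 := h1.tendsto_sum_nat
      have e2 : ∀ k, μ.real (⋃ i ∈ Finset.range k, f i) = ∑ i ∈ Finset.range k, μ.real (f i) :=
        fun k => measureReal_biUnion_finset (fun i _ j _ hij => hd hij) (fun i _ => hm i)
      simp_rw [e2]
      simpa using h2.const_sub (μ.real (⋃ i, f i))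
    have hK0 : 0 ≤ K := by
      obtain ⟨n, h1, h2⟩ := (hspos.and hK).exists
      have h3 : 0 ≤ K * s n ^ 2 := le_trans (integral_nonneg fun x => sq_nonneg _) h2
      by_contra hneg
      push Not at hneg
      nlinarith [mul_neg_of_neg_of_pos hneg (pow_pos h1 2)]
    rw [Metric.tendsto_atTop']
    intro ε hε
    obtain ⟨η, hη, hηK⟩ : ∃ η : ℝ, 0 < η ∧ η * K < ε / 4 := by
      refine ⟨ε / 4 / (K + 1), by positivity, ?_⟩
      rw [div_mul_eq_mul_div, div_lt_iff₀ (by positivity)]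
      nlinarith
    obtain ⟨k, hk⟩ := (htail.eventually_lt_const (u := min (ε / 4) (η * (ε / 4)))
      (lt_min (by positivity) (by positivity))).exists
    set A := ⋃ i, f i with hAdef
    set Ak := ⋃ i ∈ Finset.range k, f i with hAk
    have hsub : Ak ⊆ A := Set.iUnion₂_subset fun i _ => Set.subset_iUnion f i
    have hAm : MeasurableSet A := MeasurableSet.iUnion hm
    have hAkm : MeasurableSet Ak := Finset.measurableSet_biUnion _ fun i _ => hm i
    have hdiff : μ.real (A \ Ak) = μ.real A - μ.real Ak := measureReal_sdiff hsub hAkm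
    have e1 := key (A \ Ak) (hAm.diff hAkm) η hη
    have e2 := (hfin k).eventually (Metric.ball_mem_nhds _ (show (0:ℝ) < ε / 4 by positivity))
    obtain ⟨N, hN⟩ := eventually_atTop.1 (e1.and (e2.and hspos))
    refine ⟨N, fun n hn => ?_⟩
    obtain ⟨h1, h2, h3⟩ := hN n hn.le
    have hsplit : (∫ x in A, F n x ∂μ) = (∫ x in Ak, F n x ∂μ) + ∫ x in A \ Ak, F n x ∂μ := by
      rw [← setIntegral_union Set.disjoint_sdiff_right (hAm.diff hAkm) (hFint n).integrableOn
        (hFint n).integrableOn, Set.union_sdiff_cancel hsub]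
    have h0 : 0 ≤ (∫ x in A \ Ak, F n x ∂μ) / s n :=
      div_nonneg (integral_nonneg fun x => hF0 n x) h3.le
    rw [← hdiff] at hk
    have hk1 := hk.trans_le (min_le_left _ _)
    have hk2 : μ.real (A \ Ak) / η < ε / 4 := by
      rw [div_lt_iff₀ hη, mul_comm]; exact hk.trans_le (min_le_right _ _)
    rw [Real.dist_eq, abs_lt]
    rw [Real.dist_eq, ← hAk, abs_lt] at h2
    rw [hsplit, add_div]
    have h5 : 0 ≤ μ.real (A \ Ak) := measureReal_nonneg
    constructor <;> linarith [h2.1, h2.2]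
  induction A, hA using MeasurableSpace.induction_on_inter hgen hC with
  | empty => simp
  | basic t ht => exact hbasic t ht
  | compl t ht ih =>
    have : (fun n => 1 - (∫ x in t, F n x ∂μ) / s n) =ᶠ[atTop]
        fun n => (∫ x in tᶜ, F n x ∂μ) / s n := by
      filter_upwards [hspos] with n hn
      have := integral_add_compl ht (hFint n)
      rw [hs] at this
      field_simp
      linarith
    refine Tendsto.congr' this ?_
    rw [probReal_compl_eq_one_sub ht]
    exact ih.const_sub 1
  | iUnion f hd hm ih => exact hunion f hd hm ih

open Topology Asymptotics in
theorem ae_frequently_ne_zero_of_second_moment {X : Type*} [mX : MeasurableSpace X]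
    (μ : Measure X) [IsProbabilityMeasure μ] {C : Set (Set X)} (hC : IsPiSystem C)
    (hgen : mX = MeasurableSpace.generateFrom C) {G : ℕ → X → ℝ} {m : ℕ → ℝ} {K : ℝ}
    (hG0 : ∀ n x, 0 ≤ G n x) (hGm : ∀ n, Measurable (G n)) (hGb : ∀ n, ∃ B, ∀ x, G n x ≤ B)
    (hm : ∀ n, ∫ x, G n x ∂μ = m n)
    (hdiv : Tendsto (fun N => ∑ n ∈ Finset.range N, m n) atTop atTop)
    (hbasic : ∀ A ∈ C, (fun n => (∫ x in A, G n x ∂μ) - μ.real A * m n) =o[atTop] m)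
    (hK : ∀ N, ∫ x, (∑ n ∈ Finset.range N, G n x) ^ 2 ∂μ
      ≤ K * ((∑ n ∈ Finset.range N, m n) ^ 2 + ∑ n ∈ Finset.range N, m n)) :
    ∀ᵐ x ∂μ, {n | G n x ≠ 0}.Infinite := by
  have hm0 : ∀ n, 0 ≤ m n := fun n => by rw [← hm]; exact integral_nonneg (hG0 n)
  have hbdd : ∀ N, ∃ B, ∀ x, |∑ n ∈ Finset.range N, G n x| ≤ B := by
    intro N
    choose B hB using hGb
    refine ⟨∑ n ∈ Finset.range N, B n, fun x => ?_⟩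
    rw [abs_of_nonneg (Finset.sum_nonneg fun n _ => hG0 n x)]
    exact Finset.sum_le_sum fun n _ => hB n x
  have hFm : ∀ N, Measurable fun x => ∑ n ∈ Finset.range N, G n x :=
    fun N => Finset.measurable_fun_sum _ fun n _ => hGm n
  have hGint : ∀ n, Integrable (G n) μ := by
    intro n
    obtain ⟨B, hB⟩ := hGb n
    refine Integrable.of_bound (hGm n).aestronglyMeasurable B (Eventually.of_forall fun x => ?_)
    rw [Real.norm_eq_abs, abs_of_nonneg (hG0 n x)]; exact hB x
  have hFint : ∀ N, Integrable (fun x => ∑ n ∈ Finset.range N, G n x) μ :=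
    fun N => integrable_finsetSum _ fun n _ => hGint n
  have hF2 : ∀ N, Integrable (fun x => (∑ n ∈ Finset.range N, G n x) ^ 2) μ := by
    intro N
    obtain ⟨B, hB⟩ := hbdd N
    refine Integrable.of_bound ((hFm N).pow_const 2).aestronglyMeasurable (B ^ 2)
      (Eventually.of_forall fun x => ?_)
    rw [norm_pow, Real.norm_eq_abs]
    exact pow_le_pow_left₀ (abs_nonneg _) (hB x) 2
  have hset : ∀ A : Set X, ∀ N, ∫ x in A, (∑ n ∈ Finset.range N, G n x) ∂μ
      = ∑ n ∈ Finset.range N, ∫ x in A, G n x ∂μ :=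
    fun A N => integral_finsetSum _ fun n _ => (hGint n).integrableOn
  have hK0 : 0 ≤ K := by
    obtain ⟨N, hN⟩ := (hdiv.eventually (eventually_gt_atTop 0)).exists
    have h3 := le_trans (integral_nonneg fun x => sq_nonneg _) (hK N)
    by_contra hneg
    push Not at hneg
    have : 0 < (∑ n ∈ Finset.range N, m n) ^ 2 + ∑ n ∈ Finset.range N, m n := by positivity
    nlinarith [mul_neg_of_neg_of_pos hneg this]
  have hlim := tendsto_setIntegral_div_of_isPiSystem μ hC hgen
    (F := fun N x => ∑ n ∈ Finset.range N, G n x) (s := fun N => ∑ n ∈ Finset.range N, m n)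
    (K := 2 * K) (fun N x => Finset.sum_nonneg fun n _ => hG0 n x) hFint hF2
    (fun N => by rw [integral_finsetSum _ fun n _ => hGint n]; simp_rw [hm])
    (hdiv.eventually (eventually_gt_atTop 0))
    (by
      filter_upwards [hdiv.eventually (eventually_ge_atTop 1)] with N hN
      refine (hK N).trans ?_
      have : (∑ n ∈ Finset.range N, m n) ^ 2 + ∑ n ∈ Finset.range N, m n
        ≤ 2 * (∑ n ∈ Finset.range N, m n) ^ 2 := by nlinarith
      nlinarith [mul_le_mul_of_nonneg_left this hK0])
    (by
      intro A hA
      have h1 := (hbasic A hA).sum_range hm0 hdiv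
      have h2 := h1.tendsto_div_nhds_zero.add_const (μ.real A)
      rw [zero_add] at h2
      refine h2.congr' ?_
      filter_upwards [hdiv.eventually (eventually_gt_atTop 0)] with N hN
      rw [Finset.sum_sub_distrib, ← Finset.mul_sum, hset]
      field_simp
      ring)
  have hnull : ∀ M : ℕ, μ {x | ∀ n, M ≤ n → G n x = 0} = 0 := by
    intro M
    set A := {x | ∀ n, M ≤ n → G n x = 0} with hA
    have hAm : MeasurableSet A := by
      have : A = ⋂ n, ⋂ (_ : M ≤ n), G n ⁻¹' {0} := by ext x; simp [hA]
      rw [this]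
      exact MeasurableSet.iInter fun n => MeasurableSet.iInter fun _ =>
        hGm n (measurableSet_singleton 0)
    have h1 := hlim A hAm
    have h2 : Tendsto (fun N => (∫ x in A, (∑ n ∈ Finset.range M, G n x) ∂μ)
        / ∑ n ∈ Finset.range N, m n) atTop (𝓝 0) := hdiv.const_div_atTop _
    have h3 : μ.real A = 0 := by
      refine tendsto_nhds_unique h1 (h2.congr' ?_)
      filter_upwards [eventually_ge_atTop M] with N hN
      congr 1
      refine setIntegral_congr_fun hAm fun x hx => ?_
      refine Finset.sum_subset (Finset.range_mono hN) fun n _ hn => ?_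
      exact hx n (by simpa using hn)
    exact (measureReal_eq_zero_iff).1 h3
  have hsub : {x | ¬ {n | G n x ≠ 0}.Infinite} ⊆ ⋃ M : ℕ, {x | ∀ n, M ≤ n → G n x = 0} := by
    intro x hx
    simp only [Set.mem_ofPred_eq, Set.not_infinite] at hx
    obtain ⟨B, hB⟩ := hx.bddAbove
    refine Set.mem_iUnion.2 ⟨B + 1, fun n hn => ?_⟩
    by_contra h
    have := hB h
    omega
  exact measure_mono_null hsub (measure_iUnion_null hnull)

theorem Nat.count_mul_of_periodic {p : ℕ → Prop} [DecidablePred p] {R : ℕ}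
    (hp : Function.Periodic p R) (j : ℕ) : Nat.count p (R * j) = j * Nat.count p R := by
  induction j with
  | zero => simp
  | succ j ih =>
    have : (fun k => p (R * j + k)) = p := by
      funext k
      rw [add_comm, mul_comm]
      exact hp.nat_mul j k
    rw [mul_add, mul_one, Nat.count_add, ih]
    simp only [this]
    ring

/-- The number of `s < g` which avoid a set `K q` of residues modulo every prime `q ∣ g`. -/
theorem card_filter_range_avoid_le {g : ℕ} (K : ℕ → Finset ℕ)
    (hK : ∀ q, K q ⊆ Finset.range q) :
    (((Finset.range g).filter fun s => ∀ q ∈ g.primeFactors, s % q ∉ K q).card : ℝ)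
      ≤ g * ∏ q ∈ g.primeFactors, (1 - ((K q).card : ℝ) / q) := by
  classical
  set R := ∏ q ∈ g.primeFactors, q with hR
  obtain ⟨j, hj⟩ : R ∣ g := Nat.prod_primeFactors_dvd g
  set p : ℕ → Prop := fun s => ∀ q ∈ g.primeFactors, s % q ∉ K q with hp
  have hper : Function.Periodic p R := by
    intro s
    simp only [hp, eq_iff_iff]
    refine forall₂_congr fun q hq => ?_
    obtain ⟨c, hc⟩ : q ∣ R := Finset.dvd_prod_of_mem _ hq
    rw [hc, Nat.add_mul_mod_self_left]
  have h1 : ((Finset.range g).filter p).card = j * ((Finset.range R).filter p).card := by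
    rw [← Nat.count_eq_card_filter_range, ← Nat.count_eq_card_filter_range]
    have := Nat.count_mul_of_periodic hper j
    rw [← hj] at this
    exact this
  have h2 : ((Finset.range R).filter p).card
      ≤ (g.primeFactors.pi fun q => Finset.range q \ K q).card := by
    refine Finset.card_le_card_of_injOn (fun s q _ => s % q) ?_ ?_
    · intro s hs
      simp only [Finset.coe_filter, Finset.mem_range, Set.mem_ofPred_eq] at hs
      refine Finset.mem_coe.2 (Finset.mem_pi.2 fun q hq => Finset.mem_sdiff.2 ?_)
      exact ⟨Finset.mem_range.2 (Nat.mod_lt _ (Nat.prime_of_mem_primeFactors hq).pos), hs.2 q hq⟩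
    · intro s hs s' hs' h
      simp only [Finset.coe_filter, Finset.mem_range, Set.mem_ofPred_eq] at hs hs'
      have hdvd : (R : ℤ) ∣ (s' : ℤ) - s := by
        rw [hR, Nat.cast_prod]
        refine Finset.prod_dvd_of_coprime (fun q hq r hr hqr => ?_) fun q hq => ?_
        · exact Nat.isCoprime_iff_coprime.2 ((Nat.coprime_primes
            (Nat.prime_of_mem_primeFactors hq) (Nat.prime_of_mem_primeFactors hr)).2 hqr)
        · exact (Nat.modEq_iff_dvd (n := q)).1 (congrFun (congrFun h q) hq)
      have := (Nat.modEq_iff_dvd (n := R)).2 hdvd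
      exact Nat.ModEq.eq_of_lt_of_lt this hs.1 hs'.1
  rw [h1]
  have h3 : ((g.primeFactors.pi fun q => Finset.range q \ K q).card : ℝ)
      = R * ∏ q ∈ g.primeFactors, (1 - ((K q).card : ℝ) / q) := by
    rw [Finset.card_pi, hR, Nat.cast_prod, Nat.cast_prod, ← Finset.prod_mul_distrib]
    refine Finset.prod_congr rfl fun q hq => ?_
    have hq0 : (q : ℝ) ≠ 0 := by exact_mod_cast (Nat.prime_of_mem_primeFactors hq).ne_zero
    rw [Finset.card_sdiff_of_subset (hK q), Finset.card_range,
      Nat.cast_sub (by simpa using Finset.card_le_card (hK q))]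
    field_simp
  have h4 : (((Finset.range R).filter p).card : ℝ)
      ≤ R * ∏ q ∈ g.primeFactors, (1 - ((K q).card : ℝ) / q) := by
    rw [← h3]; exact_mod_cast h2
  calc ((j * ((Finset.range R).filter p).card : ℕ) : ℝ)
      = j * (((Finset.range R).filter p).card : ℝ) := by push_cast; ring
    _ ≤ j * (R * ∏ q ∈ g.primeFactors, (1 - ((K q).card : ℝ) / q)) := by gcongr
    _ = g * ∏ q ∈ g.primeFactors, (1 - ((K q).card : ℝ) / q) := by
      have hj' : (g : ℝ) = R * j := by exact_mod_cast hj
      rw [hj']; ring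

theorem exists_mem_range_dvd_add_mul {q : ℕ} (hq : q.Prime) {u : ℕ} (hu : ¬ q ∣ u) (a : ℤ) :
    ∃ r ∈ Finset.range q, (q : ℤ) ∣ a + u * (r : ℕ) := by
  have hcop : IsCoprime (u : ℤ) q :=
    Nat.isCoprime_iff_coprime.2 ((Nat.Prime.coprime_iff_not_dvd hq).2 hu).symm
  obtain ⟨x, y, hxy⟩ := hcop
  have hq0 : (0 : ℤ) < q := by exact_mod_cast hq.pos
  refine ⟨((-a * x) % q).toNat, ?_, ?_⟩
  · have h1 := Int.emod_nonneg (-a * x) hq0.ne'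
    have h2 := Int.emod_lt_of_pos (-a * x) hq0
    rw [Finset.mem_range]; omega
  · rw [Int.toNat_of_nonneg (Int.emod_nonneg _ hq0.ne'), Int.emod_def]
    refine ⟨a * y - u * (-a * x / q), ?_⟩
    linear_combination (-a) * hxy

/-- The pairs `(a, b)` of reduced residues modulo `g * u` and `g * v` with
`a * v - b * u ≡ c` modulo `g * u * v`. -/
def residuePairs (g u v : ℕ) (c : ℤ) : Finset (ℕ × ℕ) :=
  (Finset.range (g * u) ×ˢ Finset.range (g * v)).filter fun x =>
    x.1.Coprime (g * u) ∧ x.2.Coprime (g * v) ∧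
      ((g * u * v : ℕ) : ℤ) ∣ (x.1 * v - x.2 * u : ℤ) - c

theorem mem_residuePairs {g u v : ℕ} {c : ℤ} {x : ℕ × ℕ} :
    x ∈ residuePairs g u v c ↔ (x.1 < g * u ∧ x.2 < g * v) ∧ x.1.Coprime (g * u) ∧
      x.2.Coprime (g * v) ∧ ((g * u * v : ℕ) : ℤ) ∣ (x.1 * v - x.2 * u : ℤ) - c := by
  simp [residuePairs]

theorem not_dvd_of_mem_residuePairs {g u v : ℕ} (huv : u.Coprime v) {c : ℤ} {x : ℕ × ℕ}
    (hx : x ∈ residuePairs g u v c) {q : ℕ} (hq : q.Prime) (hquv : q ∣ u * v) : ¬ (q : ℤ) ∣ c := by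
  obtain ⟨-, ha, hb, hc⟩ := mem_residuePairs.1 hx
  intro hqc
  have hqL : (q : ℤ) ∣ ((g * u * v : ℕ) : ℤ) := by
    rw [mul_assoc]; exact_mod_cast hquv.mul_left g
  have h1 : (q : ℤ) ∣ (x.1 * v - x.2 * u : ℤ) := by
    have := (hqL.trans hc).add hqc
    simpa using this
  have hqp := Nat.prime_iff_prime_int.1 hq
  rcases (Nat.Prime.dvd_mul hq).1 hquv with h | h
  · have h2 : (q : ℤ) ∣ ((x.1 * v : ℕ) : ℤ) := by
      have h3 : (q : ℤ) ∣ (x.2 * u : ℤ) := Dvd.dvd.mul_left (by exact_mod_cast h) _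
      have := h1.add h3
      push_cast; simpa using this
    rcases (Nat.Prime.dvd_mul hq).1 (Int.natCast_dvd_natCast.1 h2) with h4 | h4
    · exact Nat.not_coprime_of_dvd_of_dvd hq.one_lt h4 (h.mul_left g) ha
    · exact Nat.not_coprime_of_dvd_of_dvd hq.one_lt h h4 huv
  · have h2 : (q : ℤ) ∣ ((x.2 * u : ℕ) : ℤ) := by
      have h3 : (q : ℤ) ∣ (x.1 * v : ℤ) := Dvd.dvd.mul_left (by exact_mod_cast h) _
      have := h3.sub h1
      push_cast; simpa using this
    rcases (Nat.Prime.dvd_mul hq).1 (Int.natCast_dvd_natCast.1 h2) with h4 | h4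
    · exact Nat.not_coprime_of_dvd_of_dvd hq.one_lt h4 (h.mul_left g) hb
    · exact Nat.not_coprime_of_dvd_of_dvd hq.one_lt h4 h huv

theorem card_residuePairs_le {g u v : ℕ} (hg : g ≠ 0) (hu : u ≠ 0) (hv : v ≠ 0)
    (huv : u.Coprime v) (c : ℤ) :
    ((residuePairs g u v c).card : ℝ) ≤ (g * ∏ q ∈ g.primeFactors, (1 - 1 / (q : ℝ))) *
      ∏ q ∈ g.primeFactors.filter (fun q => ¬ q ∣ u * v),
        (if (q : ℤ) ∣ c then (1 : ℝ) else 1 - 1 / (q : ℝ)) := by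
  classical
  have hfac : ∀ q ∈ g.primeFactors, 0 ≤ 1 - 1 / (q : ℝ) := fun q hq => by
    have : (1 : ℝ) ≤ q := by exact_mod_cast (Nat.prime_of_mem_primeFactors hq).one_le
    rw [sub_nonneg]; exact div_le_one_of_le₀ this (by positivity)
  rcases (residuePairs g u v c).eq_empty_or_nonempty with he | ⟨x₀, hx₀⟩
  · rw [he, Finset.card_empty, Nat.cast_zero]
    refine mul_nonneg (mul_nonneg (by positivity) (Finset.prod_nonneg hfac))
      (Finset.prod_nonneg fun q hq => ?_)
    split_ifs
    · exact zero_le_one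
    · exact hfac q (Finset.mem_filter.1 hq).1
  obtain ⟨a₀, b₀⟩ := x₀
  obtain ⟨-, ha₀, hb₀, hc₀⟩ := mem_residuePairs.1 hx₀
  simp only at ha₀ hb₀ hc₀
  set K : ℕ → Finset ℕ := fun q => (Finset.range q).filter fun r =>
    (q : ℤ) ∣ (a₀ : ℤ) + u * (r : ℕ) ∨ (q : ℤ) ∣ (b₀ : ℤ) + v * (r : ℕ) with hK
  have hKsub : ∀ q, K q ⊆ Finset.range q := fun q => Finset.filter_subset _ _
  have hg0 : (0 : ℤ) < g := by exact_mod_cast Nat.pos_of_ne_zero hg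
  have hu0 : (u : ℤ) ≠ 0 := by exact_mod_cast hu
  have hv0 : (v : ℤ) ≠ 0 := by exact_mod_cast hv
  have hiuv : IsCoprime (u : ℤ) v := Nat.isCoprime_iff_coprime.2 huv
  have hstruct : ∀ x ∈ residuePairs g u v c, ∃ s t : ℤ,
      (x.1 : ℤ) = a₀ + u * s ∧ (x.2 : ℤ) = b₀ + v * t ∧ (g : ℤ) ∣ s - t := by
    intro x hx
    obtain ⟨-, -, -, hc⟩ := mem_residuePairs.1 hx
    have h1 : ((g * u * v : ℕ) : ℤ) ∣ ((x.1 : ℤ) - a₀) * v - ((x.2 : ℤ) - b₀) * u := by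
      have := hc.sub hc₀
      have e : (x.1 * v - x.2 * u : ℤ) - c - ((a₀ * v - b₀ * u : ℤ) - c)
        = ((x.1 : ℤ) - a₀) * v - ((x.2 : ℤ) - b₀) * u := by ring
      rwa [e] at this
    push_cast at h1
    have hdu : (u : ℤ) ∣ (x.1 : ℤ) - a₀ := by
      refine hiuv.dvd_of_dvd_mul_right (y := (x.1 : ℤ) - a₀) ?_
      have h2 : (u : ℤ) ∣ ((x.1 : ℤ) - a₀) * v - ((x.2 : ℤ) - b₀) * u :=
        (Dvd.intro_left (g : ℤ) rfl |>.mul_right (v : ℤ)).trans h1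
      have := h2.add (Dvd.intro_left ((x.2 : ℤ) - b₀) rfl : (u : ℤ) ∣ ((x.2 : ℤ) - b₀) * u)
      simpa using this
    have hdv : (v : ℤ) ∣ (x.2 : ℤ) - b₀ := by
      refine hiuv.symm.dvd_of_dvd_mul_right (y := (x.2 : ℤ) - b₀) ?_
      have h2 : (v : ℤ) ∣ ((x.1 : ℤ) - a₀) * v - ((x.2 : ℤ) - b₀) * u :=
        (Dvd.intro_left ((g : ℤ) * u) rfl).trans h1
      have := (Dvd.intro_left ((x.1 : ℤ) - a₀) rfl : (v : ℤ) ∣ ((x.1 : ℤ) - a₀) * v).sub h2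
      simpa using this
    obtain ⟨s, hs⟩ := hdu
    obtain ⟨t, ht⟩ := hdv
    refine ⟨s, t, by linarith, by linarith, ?_⟩
    rw [hs, ht] at h1
    have e : (u : ℤ) * s * v - v * t * u = (u * v) * (s - t) := by ring
    have e' : (g : ℤ) * u * v = (u * v) * g := by ring
    rw [e, e'] at h1
    exact (mul_dvd_mul_iff_left (mul_ne_zero hu0 hv0)).1 h1
  choose! S T hS hT hST using hstruct
  have hSmod : ∀ x, (((S x % (g : ℤ)).toNat : ℕ) : ℤ) = S x % g := fun x =>
    Int.toNat_of_nonneg (Int.emod_nonneg _ hg0.ne')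
  have hcard : (residuePairs g u v c).card ≤ ((Finset.range g).filter fun s =>
      ∀ q ∈ g.primeFactors, s % q ∉ K q).card := by
    refine Finset.card_le_card_of_injOn (fun x => (S x % (g : ℤ)).toNat) ?_ ?_
    · intro x hx
      have hx' := hx
      obtain ⟨-, ha, hb, -⟩ := mem_residuePairs.1 hx
      simp only [Finset.coe_filter, Finset.mem_range, Set.mem_ofPred_eq]
      refine ⟨?_, fun q hq hmem => ?_⟩
      · have := Int.emod_lt_of_pos (S x) hg0
        have := Int.emod_nonneg (S x) hg0.ne'
        omega
      · have hqp := Nat.prime_of_mem_primeFactors hq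
        have hqg := Nat.dvd_of_mem_primeFactors hq
        have hqg' : (q : ℤ) ∣ g := by exact_mod_cast hqg
        have hr : (q : ℤ) ∣ S x - (((S x % (g : ℤ)).toNat % q : ℕ) : ℤ) := by
          rw [Int.natCast_mod, hSmod]
          have h1 : (q : ℤ) ∣ S x - S x % g := hqg'.trans (Int.dvd_self_sub_emod)
          have h2 : (q : ℤ) ∣ S x % g - S x % g % q := Int.dvd_self_sub_emod
          have := h1.add h2
          simpa using this
        simp only [hK, Finset.mem_filter] at hmem
        rcases hmem.2 with h | h
        · have h3 : (q : ℤ) ∣ x.1 := by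
            rw [hS x hx']
            have := h.add (hr.mul_left (u : ℤ))
            obtain ⟨k, hk⟩ := this; exact ⟨k, by linear_combination hk⟩
          exact Nat.not_coprime_of_dvd_of_dvd hqp.one_lt (Int.natCast_dvd_natCast.1 h3)
            (hqg.mul_right u) ha
        · have h3 : (q : ℤ) ∣ x.2 := by
            rw [hT x hx']
            have h4 := h.add (hr.mul_left (v : ℤ))
            have h5 := h4.sub ((hqg'.trans (hST x hx')).mul_left (v : ℤ))
            obtain ⟨k, hk⟩ := h5; exact ⟨k, by linear_combination hk⟩
          exact Nat.not_coprime_of_dvd_of_dvd hqp.one_lt (Int.natCast_dvd_natCast.1 h3)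
            (hqg.mul_right v) hb
    · intro x hx y hy hxy
      have hx' := mem_residuePairs.1 hx
      have hy' := mem_residuePairs.1 hy
      have hxy' : (S x % (g : ℤ)).toNat = (S y % (g : ℤ)).toNat := hxy
      have h1 : S x % (g : ℤ) = S y % g := by rw [← hSmod x, ← hSmod y, hxy']
      have h2 : (g : ℤ) ∣ S y - S x := Int.ModEq.dvd h1
      have h3 : (g : ℤ) ∣ T y - T x := by
        have := (h2.add (hST x hx)).sub (hST y hy)
        obtain ⟨k, hk⟩ := this; exact ⟨k, by linear_combination hk⟩
      have e1 : x.1 = y.1 := by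
        refine Nat.ModEq.eq_of_lt_of_lt (m := g * u) ?_ hx'.1.1 hy'.1.1
        refine (Nat.modEq_iff_dvd).2 ?_
        rw [hS x hx, hS y hy]
        obtain ⟨k, hk⟩ := h2
        refine ⟨k, ?_⟩
        push_cast
        linear_combination (u : ℤ) * hk
      have e2 : x.2 = y.2 := by
        refine Nat.ModEq.eq_of_lt_of_lt (m := g * v) ?_ hx'.1.2 hy'.1.2
        refine (Nat.modEq_iff_dvd).2 ?_
        rw [hT x hx, hT y hy]
        obtain ⟨k, hk⟩ := h3
        refine ⟨k, ?_⟩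
        push_cast
        linear_combination (v : ℤ) * hk
      exact Prod.ext e1 e2
  refine (Nat.cast_le.2 hcard).trans ((card_filter_range_avoid_le K hKsub).trans ?_)
  rw [mul_assoc, Finset.prod_filter, ← Finset.prod_mul_distrib]
  refine mul_le_mul_of_nonneg_left ?_ (by positivity)
  refine Finset.prod_le_prod (fun q hq => ?_) fun q hq => ?_
  · have hq0 : (0 : ℝ) < q := by exact_mod_cast (Nat.prime_of_mem_primeFactors hq).pos
    rw [sub_nonneg]
    refine div_le_one_of_le₀ ?_ hq0.le
    have := Finset.card_le_card (hKsub q)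
    rw [Finset.card_range] at this
    exact_mod_cast this
  · have hqp := Nat.prime_of_mem_primeFactors hq
    have hqg := Nat.dvd_of_mem_primeFactors hq
    have hq0 : (0 : ℝ) < q := by exact_mod_cast hqp.pos
    have hone : (1 : ℝ) ≤ (K q).card := by
      have : 0 < (K q).card := by
        rw [Finset.card_pos]
        by_cases h : q ∣ u
        · have h' : ¬ q ∣ v := fun h' => Nat.not_coprime_of_dvd_of_dvd hqp.one_lt h h' huv
          obtain ⟨r, hr, hd⟩ := exists_mem_range_dvd_add_mul hqp h' b₀
          exact ⟨r, Finset.mem_filter.2 ⟨hr, Or.inr hd⟩⟩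
        · obtain ⟨r, hr, hd⟩ := exists_mem_range_dvd_add_mul hqp h a₀
          exact ⟨r, Finset.mem_filter.2 ⟨hr, Or.inl hd⟩⟩
      exact_mod_cast this
    have hle1 : 1 - ((K q).card : ℝ) / q ≤ 1 - 1 / q := by gcongr
    by_cases hquv : q ∣ u * v
    · rw [if_neg (not_not.2 hquv), mul_one]; exact hle1
    · rw [if_pos hquv]
      split_ifs with hqc
      · rw [mul_one]; exact hle1
      · have htwo : (2 : ℝ) ≤ (K q).card := by
          obtain ⟨r, hr, hd⟩ := exists_mem_range_dvd_add_mul hqp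
            (fun h => hquv (h.mul_right v)) (a₀ : ℤ)
          obtain ⟨r', hr', hd'⟩ := exists_mem_range_dvd_add_mul hqp
            (fun h => hquv (h.mul_left u)) (b₀ : ℤ)
          have hne : r ≠ r' := by
            rintro rfl
            apply hqc
            have h1 : (q : ℤ) ∣ ((g * u * v : ℕ) : ℤ) := by
              exact_mod_cast (hqg.mul_right u).mul_right v
            have h2 := ((hd.mul_left (v : ℤ)).sub (hd'.mul_left (u : ℤ))).sub (h1.trans hc₀)
            obtain ⟨k, hk⟩ := h2; exact ⟨k, by linear_combination hk⟩
          have : ({r, r'} : Finset ℕ) ⊆ K q := by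
            intro y hy
            rcases Finset.mem_insert.1 hy with rfl | hy
            · exact Finset.mem_filter.2 ⟨hr, Or.inl hd⟩
            · rw [Finset.mem_singleton.1 hy]
              exact Finset.mem_filter.2 ⟨hr', Or.inr hd'⟩
          have := Finset.card_le_card this
          rw [Finset.card_pair hne] at this
          exact_mod_cast this
        have hle2 : 1 - ((K q).card : ℝ) / q ≤ 1 - 2 / q := by gcongr
        refine hle2.trans ?_
        have : (1 - 1 / (q : ℝ)) * (1 - 1 / q) = 1 - 2 / q + (1 / q) ^ 2 := by ring
        rw [this]
        nlinarith [sq_nonneg (1 / (q : ℝ))]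

theorem Nat.Prime.one_sub_one_div_pos {q : ℕ} (hq : q.Prime) : (0 : ℝ) < 1 - 1 / q := by
  have : (1 : ℝ) < q := by exact_mod_cast hq.one_lt
  rw [sub_pos, div_lt_one (by linarith)]; exact this

theorem Nat.totient_eq_mul_prod_one_sub (n : ℕ) :
    (n.totient : ℝ) = n * ∏ q ∈ n.primeFactors, (1 - 1 / (q : ℝ)) := by
  have := Nat.totient_eq_mul_prod_factors n
  have h := congrArg (fun x : ℚ => (x : ℝ)) this
  simpa using h

theorem totient_mul_totient_eq {g u v : ℕ} (hg : g ≠ 0) (hu : u ≠ 0) (hv : v ≠ 0)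
    (huv : u.Coprime v) :
    ((g * u).totient : ℝ) * (g * v).totient
      = (g * u * v) * (g.totient * ∏ q ∈ (g * u * v).primeFactors, (1 - 1 / (q : ℝ))) := by
  have h1 : (g * u * v).primeFactors = (g * u).primeFactors ∪ (g * v).primeFactors := by
    rw [Nat.primeFactors_mul (mul_ne_zero hg hu) hv, Nat.primeFactors_mul hg hu,
      Nat.primeFactors_mul hg hv]
    ext q; simp only [Finset.mem_union]; tauto
  have h2 : g.primeFactors = (g * u).primeFactors ∩ (g * v).primeFactors := by
    rw [Nat.primeFactors_mul hg hu, Nat.primeFactors_mul hg hv, ← Finset.union_inter_distrib_left,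
      Finset.disjoint_iff_inter_eq_empty.1 huv.disjoint_primeFactors, Finset.union_empty]
  rw [Nat.totient_eq_mul_prod_one_sub (g * u), Nat.totient_eq_mul_prod_one_sub (g * v),
    Nat.totient_eq_mul_prod_one_sub g, h1, h2]
  have := Finset.prod_union_inter (s₁ := (g * u).primeFactors) (s₂ := (g * v).primeFactors)
    (f := fun q : ℕ => 1 - 1 / (q : ℝ))
  push_cast
  linear_combination (-(g : ℝ) ^ 2 * u * v) * this

theorem inv_one_sub_le_exp {x : ℝ} (h0 : 0 ≤ x) (h1 : x ≤ 1 / 2) :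
    (1 - x)⁻¹ ≤ Real.exp (2 * x) := by
  rw [inv_le_comm₀ (by linarith) (Real.exp_pos _), ← Real.exp_neg]
  have h3 : Real.exp (-(2 * x)) * (1 + 2 * x) ≤ 1 := by
    have := Real.add_one_le_exp (2 * x)
    have h4 := Real.exp_pos (-(2 * x))
    have h5 : Real.exp (-(2 * x)) * Real.exp (2 * x) = 1 := by rw [← Real.exp_add]; simp
    nlinarith
  have h4 := Real.exp_pos (-(2 * x))
  nlinarith

theorem prod_primes_inv_one_sub_le_exp {Q : Finset ℕ} (hQ : ∀ q ∈ Q, q.Prime) :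
    ∏ q ∈ Q, (1 - 1 / (q : ℝ))⁻¹ ≤ Real.exp (2 * ∑ q ∈ Q, 1 / (q : ℝ)) := by
  rw [Finset.mul_sum, Real.exp_sum]
  refine Finset.prod_le_prod (fun q hq => (inv_pos.2 (hQ q hq).one_sub_one_div_pos).le)
    fun q hq => inv_one_sub_le_exp (by positivity) ?_
  have : (2 : ℝ) ≤ q := by exact_mod_cast (hQ q hq).two_le
  exact one_div_le_one_div_of_le (by norm_num) this

theorem card_filter_Icc_coprime_le {l : ℕ} (hl : 0 < l) (X : ℕ) :
    (((Finset.Icc 1 X).filter fun c => c.Coprime l).card : ℝ) ≤ l.totient * (X / l + 1) := by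
  have h := Nat.Ico_filter_coprime_le 1 X hl.ne'
  have e : (Finset.Ico 1 (1 + X)).filter (fun c => l.Coprime c)
      = (Finset.Icc 1 X).filter fun c => c.Coprime l := by
    ext c; simp only [Finset.mem_filter, Finset.mem_Ico, Finset.mem_Icc, Nat.coprime_comm]; omega
  rw [e] at h
  calc _ ≤ ((l.totient * (X / l + 1) : ℕ) : ℝ) := by exact_mod_cast h
    _ ≤ _ := by
      push_cast
      gcongr
      exact Nat.cast_div_le

theorem exists_prod_primes_le : ∃ C : ℝ, 0 < C ∧ ∀ e : Finset ℕ, (∀ q ∈ e, q.Prime) →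
    ∏ q ∈ e, (1 + 1 / (((q : ℝ) - 1) * √q)) ≤ C := by
  have hnn : ∀ n : ℕ, 0 ≤ 1 / (((n : ℝ) - 1) * √n) := fun n => by
    rcases Nat.eq_zero_or_pos n with rfl | hn
    · simp
    · have : (1 : ℝ) ≤ n := by exact_mod_cast hn
      have : 0 ≤ (n : ℝ) - 1 := by linarith
      positivity
  have hs : Summable fun n : ℕ => 1 / (((n : ℝ) - 1) * √n) := by
    refine Summable.of_nonneg_of_le hnn (fun n => ?_)
      ((Real.summable_one_div_nat_rpow.2 (by norm_num : (1 : ℝ) < 3 / 2)).mul_left 2)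
    rcases Nat.eq_zero_or_pos n with rfl | hn
    · simp
    rcases Nat.eq_or_lt_of_le hn with rfl | hn
    · simp
    have h2 : (2 : ℝ) ≤ n := by exact_mod_cast hn
    have h0 : (0 : ℝ) < n := by linarith
    have e : (n : ℝ) ^ (3 / 2 : ℝ) = n * √n := by
      rw [Real.sqrt_eq_rpow, show (3 / 2 : ℝ) = 1 + 1 / 2 by norm_num, Real.rpow_add h0,
        Real.rpow_one]
    have hsq : 0 < √(n : ℝ) := Real.sqrt_pos.2 h0
    rw [e, mul_one_div, div_le_div_iff₀ (mul_pos (by linarith) hsq) (by positivity)]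
    nlinarith
  refine ⟨Real.exp (∑' n : ℕ, 1 / (((n : ℝ) - 1) * √n)), Real.exp_pos _, fun e _ => ?_⟩
  exact (Real.prod_one_add_le_exp_sum (s := e) hnn).trans
    (Real.exp_le_exp.2 (hs.sum_le_tsum e fun n _ => hnn n))

/-- Weighted count of the integers up to `D` which are coprime to `l`. -/
theorem exists_sum_prod_ite_le : ∃ C : ℝ, 0 < C ∧ ∀ (e : Finset ℕ), (∀ q ∈ e, q.Prime) →
    ∀ (l : ℕ), 0 < l → ∀ D : ℝ, (l : ℝ) ^ 2 ≤ D →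
    ∑ c ∈ (Finset.Icc 1 ⌊D⌋₊).filter (fun c => c.Coprime l),
      ∏ q ∈ e, (if q ∣ c then (1 - 1 / (q : ℝ))⁻¹ else 1) ≤ C * D * (l.totient / l) := by
  classical
  obtain ⟨C, hC, hprod⟩ := exists_prod_primes_le
  refine ⟨2 * C, by positivity, fun e he l hl D hD => ?_⟩
  have hl0 : (0 : ℝ) < l := by exact_mod_cast hl
  have hD0 : 0 < D := lt_of_lt_of_le (by positivity) hD
  have hq1 : ∀ q ∈ e, (0 : ℝ) < (q : ℝ) - 1 := fun q hq => by
    have : (1 : ℝ) < q := by exact_mod_cast (he q hq).one_lt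
    linarith
  have hexp : ∀ c : ℕ, ∏ q ∈ e, (if q ∣ c then (1 - 1 / (q : ℝ))⁻¹ else 1)
      = ∑ s ∈ e.powerset, if (∏ q ∈ s, q) ∣ c then ∏ q ∈ s, 1 / ((q : ℝ) - 1) else 0 := by
    intro c
    have : ∀ q ∈ e, (if q ∣ c then (1 - 1 / (q : ℝ))⁻¹ else 1)
        = 1 + (if q ∣ c then 1 / ((q : ℝ) - 1) else 0) := fun q hq => by
      split_ifs
      · have := hq1 q hq
        have : (q : ℝ) ≠ 0 := by linarith
        field_simp; ring
      · simp
    rw [Finset.prod_congr rfl this, Finset.prod_one_add]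
    refine Finset.sum_congr rfl fun s hs => ?_
    rw [Finset.prod_ite_zero]
    refine if_congr ⟨fun h => ?_, fun h q hq => (Finset.dvd_prod_of_mem _ hq).trans h⟩ rfl rfl
    exact Finset.prod_primes_dvd c
      (fun q hq => (he q (Finset.mem_powerset.1 hs hq)).prime) h
  simp_rw [hexp]
  rw [Finset.sum_comm]
  have hterm : ∀ s ∈ e.powerset,
      ∑ c ∈ (Finset.Icc 1 ⌊D⌋₊).filter (fun c => c.Coprime l),
        (if (∏ q ∈ s, q) ∣ c then ∏ q ∈ s, 1 / ((q : ℝ) - 1) else 0)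
      ≤ 2 * D * (l.totient / l) * ∏ q ∈ s, 1 / (((q : ℝ) - 1) * √q) := by
    intro s hs
    rw [Finset.mem_powerset] at hs
    set w := ∏ q ∈ s, q with hw
    have hw0 : 0 < w := Finset.prod_pos fun q hq => (he q (hs hq)).pos
    have hwr : (0 : ℝ) < w := by exact_mod_cast hw0
    have hH : 0 ≤ ∏ q ∈ s, 1 / ((q : ℝ) - 1) :=
      Finset.prod_nonneg fun q hq => by have := hq1 q (hs hq); positivity
    have hsplit : ∏ q ∈ s, 1 / (((q : ℝ) - 1) * √q) = (∏ q ∈ s, 1 / ((q : ℝ) - 1)) * (1 / √w) := by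
      rw [hw, Nat.cast_prod, Real.sqrt_prod _ fun q _ => Nat.cast_nonneg q, one_div,
        ← Finset.prod_inv_distrib, ← Finset.prod_mul_distrib]
      refine Finset.prod_congr rfl fun q _ => ?_
      rw [one_div, mul_inv, one_div]
    rw [← Finset.sum_filter, Finset.sum_const, nsmul_eq_mul, hsplit]
    have hcard : ((((Finset.Icc 1 ⌊D⌋₊).filter (fun c => c.Coprime l)).filter
        (fun c => w ∣ c)).card : ℝ) ≤ 2 * D * (l.totient / l) * (1 / √w) := by
      have hsqw : 0 < √(w : ℝ) := Real.sqrt_pos.2 hwr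
      by_cases hwD : (w : ℝ) ≤ D
      · have h1 : (((Finset.Icc 1 ⌊D⌋₊).filter (fun c => c.Coprime l)).filter
            (fun c => w ∣ c)).card
            ≤ ((Finset.Icc 1 (⌊D⌋₊ / w)).filter fun c => c.Coprime l).card := by
          refine Finset.card_le_card_of_injOn (fun c => c / w) ?_ ?_
          · intro c hc
            simp only [Finset.coe_filter, Finset.mem_filter, Finset.mem_Icc,
              Set.mem_ofPred_eq] at hc ⊢
            obtain ⟨⟨⟨h1, h2⟩, h3⟩, k, rfl⟩ := hc
            rw [Nat.mul_div_cancel_left _ hw0]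
            refine ⟨⟨Nat.pos_of_ne_zero ?_, ?_⟩, h3.coprime_mul_left⟩
            · rintro rfl; simp at h1
            · rw [Nat.le_div_iff_mul_le hw0, mul_comm]; exact h2
          · intro c hc c' hc' h
            simp only [Finset.coe_filter, Set.mem_ofPred_eq] at hc hc'
            exact Nat.div_left_inj hc.2 hc'.2 |>.1 h
        have h2 := card_filter_Icc_coprime_le hl (⌊D⌋₊ / w)
        have h3 : ((⌊D⌋₊ / w : ℕ) : ℝ) ≤ D / w :=
          Nat.cast_div_le.trans (by gcongr; exact Nat.floor_le hD0.le)
        have h4 : D / w / l ≤ D / l * (1 / √w) := by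
          have : √(w : ℝ) ≤ w := Real.sqrt_le_self_iff.2 (Or.inr (by exact_mod_cast hw0))
          rw [div_right_comm, div_eq_mul_one_div (D / l)]
          gcongr
        have h5 : 1 ≤ D / l * (1 / √w) := by
          rw [mul_one_div, div_div, le_div_iff₀ (by positivity), one_mul]
          have a1 : (l : ℝ) ≤ √D := Real.le_sqrt_of_sq_le hD
          have a2 : √(w : ℝ) ≤ √D := Real.sqrt_le_sqrt hwD
          calc (l : ℝ) * √w ≤ √D * √D := by gcongr
            _ = D := Real.mul_self_sqrt hD0.le
        calc _ ≤ (((Finset.Icc 1 (⌊D⌋₊ / w)).filter fun c => c.Coprime l).card : ℝ) := by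
              exact_mod_cast h1
          _ ≤ l.totient * (((⌊D⌋₊ / w : ℕ) : ℝ) / l + 1) := h2
          _ ≤ l.totient * (D / w / l + 1) := by gcongr
          _ ≤ l.totient * (D / l * (1 / √w) + D / l * (1 / √w)) := by gcongr
          _ = _ := by ring
      · have : ((Finset.Icc 1 ⌊D⌋₊).filter (fun c => c.Coprime l)).filter
            (fun c => w ∣ c) = ∅ := by
          refine Finset.filter_eq_empty_iff.2 fun c hc hwc => hwD ?_
          simp only [Finset.mem_filter, Finset.mem_Icc] at hc
          have : w ≤ ⌊D⌋₊ := (Nat.le_of_dvd hc.1.1 hwc).trans hc.1.2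
          exact (Nat.cast_le.2 this).trans (Nat.floor_le hD0.le)
        rw [this, Finset.card_empty, Nat.cast_zero]
        positivity
    calc _ ≤ (2 * D * (l.totient / l) * (1 / √w)) * ∏ q ∈ s, 1 / ((q : ℝ) - 1) := by gcongr
      _ = _ := by ring
  refine (Finset.sum_le_sum hterm).trans ?_
  rw [← Finset.mul_sum, ← Finset.prod_one_add]
  calc _ ≤ 2 * D * (l.totient / l) * C := by gcongr; exact hprod e he
    _ = _ := by ring

theorem card_residuePairs_le_totient {g u v : ℕ} (hg : g ≠ 0) (hu : u ≠ 0) (hv : v ≠ 0)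
    (huv : u.Coprime v) (c : ℤ) : ((residuePairs g u v c).card : ℝ) ≤ g.totient := by
  refine (card_residuePairs_le hg hu hv huv c).trans ?_
  rw [← Nat.totient_eq_mul_prod_one_sub]
  refine mul_le_of_le_one_right (by positivity) (Finset.prod_le_one (fun q hq => ?_) fun q hq => ?_)
  all_goals
    have hq0 := (Nat.prime_of_mem_primeFactors (Finset.mem_filter.1 hq).1).one_sub_one_div_pos
    split_ifs
  · exact zero_le_one
  · exact hq0.le
  · exact le_rfl
  · have : 0 ≤ 1 / (q : ℝ) := by positivity
    linarith

theorem sum_card_residuePairs_le_totient {g u v : ℕ} (hg : g ≠ 0) (hu : u ≠ 0) (hv : v ≠ 0)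
    (huv : u.Coprime v) (κ : ℤ) {D : ℝ} (hD : 0 ≤ D) :
    ∑ c ∈ Finset.Icc 1 ⌊D⌋₊, ((residuePairs g u v (κ * c)).card : ℝ) ≤ D * g.totient := by
  refine (Finset.sum_le_card_nsmul _ _ _ fun c _ =>
    card_residuePairs_le_totient hg hu hv huv _).trans ?_
  rw [Nat.card_Icc, nsmul_eq_mul, Nat.add_sub_cancel]
  gcongr
  exact Nat.floor_le hD

theorem exists_sum_card_residuePairs_le : ∃ C : ℝ, 0 < C ∧ ∀ {g u v : ℕ}, g ≠ 0 → u ≠ 0 → v ≠ 0 →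
    u.Coprime v → ∀ κ : ℤ, IsCoprime κ ((g * u * v : ℕ) : ℤ) → ∀ t : ℕ,
    ∑ q ∈ (u * v).primeFactors.filter (t < ·), 1 / (q : ℝ) ≤ 1 → ∀ D : ℝ, (16 : ℝ) ^ t ≤ D →
    ∑ c ∈ Finset.Icc 1 ⌊D⌋₊, ((residuePairs g u v (κ * c)).card : ℝ)
      ≤ C * D * (((g * u).totient : ℝ) * (g * v).totient / (g * u * v)) := by
  classical
  obtain ⟨C, hC, hsum⟩ := exists_sum_prod_ite_le
  refine ⟨C * Real.exp 2, by positivity, fun {g u v} hg hu hv huv κ hκ t ht D hD => ?_⟩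
  have hD0 : 0 < D := lt_of_lt_of_le (by positivity) hD
  set e := g.primeFactors.filter fun q => ¬ q ∣ u * v with he
  have hep : ∀ q ∈ e, q.Prime := fun q hq => Nat.prime_of_mem_primeFactors (Finset.mem_filter.1 hq).1
  set Q := (u * v).primeFactors with hQ
  have hQp : ∀ q ∈ Q, q.Prime := fun q hq => Nat.prime_of_mem_primeFactors hq
  set l := ∏ q ∈ Q.filter (fun q => ¬ t < q), q with hl
  have hlp : ∀ q ∈ Q.filter (fun q => ¬ t < q), q.Prime := fun q hq => hQp q (Finset.mem_filter.1 hq).1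
  have hl0 : 0 < l := Finset.prod_pos fun q hq => (hlp q hq).pos
  have hl4 : l ≤ 4 ^ t := by
    refine le_trans ?_ (primorial_le_four_pow t)
    refine Finset.prod_le_prod_of_subset_of_one_le' (fun q hq => ?_) fun q hq _ =>
      (Finset.mem_filter.1 hq).2.one_le
    rw [Finset.mem_filter, Finset.mem_range]
    have := (Finset.mem_filter.1 hq).2
    exact ⟨by omega, hlp q hq⟩
  have hlD : (l : ℝ) ^ 2 ≤ D := by
    refine le_trans ?_ hD
    have : (l : ℝ) ≤ 4 ^ t := by exact_mod_cast hl4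
    calc (l : ℝ) ^ 2 ≤ (4 ^ t) ^ 2 := by gcongr
      _ = 16 ^ t := by rw [← pow_mul, mul_comm, pow_mul]; norm_num
  have hl_tot : (l.totient : ℝ) / l = ∏ q ∈ Q.filter (fun q => ¬ t < q), (1 - 1 / (q : ℝ)) := by
    rw [Nat.totient_eq_mul_prod_one_sub, hl, Nat.primeFactors_prod hlp, ← hl]
    field_simp
  have hpos : ∀ q ∈ Q, 0 < 1 - 1 / (q : ℝ) := fun q hq => (hQp q hq).one_sub_one_div_pos
  have hl_le : (l.totient : ℝ) / l ≤ Real.exp 2 * ∏ q ∈ Q, (1 - 1 / (q : ℝ)) := by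
    have h1 := prod_primes_inv_one_sub_le_exp (Q := Q.filter (t < ·))
      fun q hq => hQp q (Finset.mem_filter.1 hq).1
    have h2 : Real.exp (2 * ∑ q ∈ Q.filter (t < ·), 1 / (q : ℝ)) ≤ Real.exp 2 :=
      Real.exp_le_exp.2 (by linarith)
    rw [hl_tot, ← Finset.prod_filter_mul_prod_filter_not Q (t < ·)]
    have h3 : 0 < ∏ q ∈ Q.filter (t < ·), (1 - 1 / (q : ℝ)) :=
      Finset.prod_pos fun q hq => hpos q (Finset.mem_filter.1 hq).1
    have h4 : 0 ≤ ∏ q ∈ Q.filter (fun q => ¬ t < q), (1 - 1 / (q : ℝ)) :=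
      Finset.prod_nonneg fun q hq => (hpos q (Finset.mem_filter.1 hq).1).le
    rw [Finset.prod_inv_distrib] at h1
    have h5 : 1 ≤ Real.exp 2 * ∏ q ∈ Q.filter (t < ·), (1 - 1 / (q : ℝ)) := by
      have := h1.trans h2
      rwa [inv_le_iff_one_le_mul₀ h3] at this
    calc _ = 1 * ∏ q ∈ Q.filter (fun q => ¬ t < q), (1 - 1 / (q : ℝ)) := by rw [one_mul]
      _ ≤ (Real.exp 2 * ∏ q ∈ Q.filter (t < ·), (1 - 1 / (q : ℝ)))
          * ∏ q ∈ Q.filter (fun q => ¬ t < q), (1 - 1 / (q : ℝ)) := by gcongr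
      _ = _ := by ring
  have hκq : ∀ q ∈ e, ∀ c : ℕ, (q : ℤ) ∣ κ * c ↔ q ∣ c := fun q hq c => by
    refine ⟨fun h => ?_, fun h => Dvd.dvd.mul_left (by exact_mod_cast h) _⟩
    have hqd : (q : ℤ) ∣ ((g * u * v : ℕ) : ℤ) := by
      exact_mod_cast ((Nat.dvd_of_mem_primeFactors (Finset.mem_filter.1 hq).1).mul_right u).mul_right v
    have := (hκ.of_isCoprime_of_dvd_right hqd).symm.dvd_of_dvd_mul_left h
    exact_mod_cast this
  have hterm : ∀ c : ℕ, ((residuePairs g u v (κ * c)).card : ℝ) ≤ if c.Coprime l then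
      g.totient * (∏ q ∈ e, (1 - 1 / (q : ℝ))) *
        ∏ q ∈ e, (if q ∣ c then (1 - 1 / (q : ℝ))⁻¹ else 1) else 0 := by
    intro c
    split_ifs with hc
    · refine (card_residuePairs_le hg hu hv huv (κ * c)).trans_eq ?_
      rw [← Nat.totient_eq_mul_prod_one_sub, mul_assoc, ← Finset.prod_mul_distrib]
      congr 1
      refine Finset.prod_congr rfl fun q hq => ?_
      have := (hep q hq).one_sub_one_div_pos.ne'
      simp only [hκq q hq c]
      split_ifs
      · rw [mul_inv_cancel₀ this]
      · rw [mul_one]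
    · rw [hl, Nat.coprime_prod_right_iff] at hc
      simp only [not_forall] at hc
      obtain ⟨q, hq, hqc⟩ := hc
      have hqp := hlp q hq
      have hqc' : q ∣ c := by
        by_contra h
        exact hqc (Nat.Coprime.symm ((Nat.Prime.coprime_iff_not_dvd hqp).2 h))
      have hqd := Nat.dvd_of_mem_primeFactors (Finset.mem_filter.1 hq).1
      have : residuePairs g u v (κ * c) = ∅ := by
        rw [Finset.eq_empty_iff_forall_notMem]
        intro x hx
        exact not_dvd_of_mem_residuePairs huv hx hqp hqd (Dvd.dvd.mul_left (by exact_mod_cast hqc') _)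
      simp [this]
  refine (Finset.sum_le_sum fun c _ => hterm c).trans ?_
  rw [← Finset.sum_filter, ← Finset.mul_sum]
  have hE : 0 ≤ ∏ q ∈ e, (1 - 1 / (q : ℝ)) :=
    Finset.prod_nonneg fun q hq => (hep q hq).one_sub_one_div_pos.le
  have hEQ : (∏ q ∈ e, (1 - 1 / (q : ℝ))) * ∏ q ∈ Q, (1 - 1 / (q : ℝ))
      = ∏ q ∈ (g * u * v).primeFactors, (1 - 1 / (q : ℝ)) := by
    rw [← Finset.prod_union]
    · congr 1
      rw [mul_assoc, Nat.primeFactors_mul hg (mul_ne_zero hu hv)]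
      ext q
      simp only [he, hQ, Finset.mem_union, Finset.mem_filter, Nat.mem_primeFactors]
      have := mul_ne_zero hu hv
      tauto
    · rw [Finset.disjoint_left]
      intro q hq hq'
      exact (Finset.mem_filter.1 hq).2 (Nat.dvd_of_mem_primeFactors hq')
  calc _ ≤ g.totient * (∏ q ∈ e, (1 - 1 / (q : ℝ))) *
        (C * D * (Real.exp 2 * ∏ q ∈ Q, (1 - 1 / (q : ℝ)))) := by
        gcongr
        exact (hsum e hep l hl0 D hlD).trans (by gcongr)
    _ = C * Real.exp 2 * D * (g.totient * ((∏ q ∈ e, (1 - 1 / (q : ℝ))) *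
        ∏ q ∈ Q, (1 - 1 / (q : ℝ)))) := by ring
    _ = _ := by
        rw [hEQ, totient_mul_totient_eq hg hu hv huv, mul_div_cancel_left₀]
        positivity

theorem sum_min_div_sq_le {A B : ℝ} (hA : 0 < A) (hB : 0 < B) (N : ℕ) :
    ∑ j ∈ Finset.Icc 1 N, (min A (B / j)) ^ 2 ≤ 4 * A * B := by
  have key : ∑ j ∈ Finset.Icc 1 N, (min A (B / j)) ^ 2 ≤ 4 * A * B - 4 * B ^ 2 * A / (N * A + B) := by
    induction N with
    | zero =>
      rw [Nat.cast_zero, zero_mul, zero_add, Finset.Icc_eq_empty (by omega), Finset.sum_empty]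
      refine le_of_eq ?_
      field_simp
      ring
    | succ N ih =>
      rw [Finset.sum_Icc_succ_top (by omega)]
      have hN : (0 : ℝ) ≤ N := Nat.cast_nonneg N
      push_cast
      set x : ℝ := (N : ℝ) + 1 with hx
      have hx0 : 0 < x := by positivity
      have h1 : 0 < N * A + B := by positivity
      have h2 : 0 < x * A + B := by positivity
      have e : 4 * B ^ 2 * A / (N * A + B) - 4 * B ^ 2 * A / (x * A + B)
          = 4 * B ^ 2 * A ^ 2 / ((N * A + B) * (x * A + B)) := by
        rw [div_sub_div _ _ h1.ne' h2.ne', hx]; congr 1; ring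
      have hNx : N * A + B ≤ x * A + B := by rw [hx]; nlinarith
      have hstep : (min A (B / x)) ^ 2 ≤ 4 * B ^ 2 * A ^ 2 / ((N * A + B) * (x * A + B)) := by
        rw [le_div_iff₀ (by positivity)]
        have hle : (N * A + B) * (x * A + B) ≤ (x * A + B) ^ 2 := by nlinarith
        rcases le_total (x * A) B with h | h
        · rw [min_eq_left (by rw [le_div_iff₀ hx0]; linarith)]
          have : (x * A + B) ^ 2 ≤ 4 * B ^ 2 := by
            have : x * A + B ≤ 2 * B := by linarith
            nlinarith
          nlinarith [sq_nonneg A]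
        · rw [min_eq_right (by rw [div_le_iff₀ hx0]; linarith), div_pow, div_mul_eq_mul_div,
            div_le_iff₀ (by positivity)]
          have : (x * A + B) ^ 2 ≤ 4 * (x * A) ^ 2 := by
            have : x * A + B ≤ 2 * (x * A) := by linarith
            nlinarith
          nlinarith [sq_nonneg B]
      linarith
  refine key.trans ?_
  have : 0 ≤ 4 * B ^ 2 * A / (N * A + B) := by positivity
  linarith

theorem filter_dvd_Icc_eq_image {w : ℕ} (hw : 0 < w) (N : ℕ) :
    (Finset.Icc 1 N).filter (w ∣ ·) = (Finset.Icc 1 (N / w)).image (w * ·) := by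
  ext c
  simp only [Finset.mem_filter, Finset.mem_Icc, Finset.mem_image]
  constructor
  · rintro ⟨⟨h1, h2⟩, k, rfl⟩
    refine ⟨k, ⟨Nat.pos_of_ne_zero ?_, ?_⟩, rfl⟩
    · rintro rfl; simp at h1
    · rw [Nat.le_div_iff_mul_le hw, mul_comm]; exact h2
  · rintro ⟨k, ⟨h1, h2⟩, rfl⟩
    rw [Nat.le_div_iff_mul_le hw, mul_comm] at h2
    exact ⟨⟨Nat.mul_pos hw h1, h2⟩, dvd_mul_right _ _⟩

theorem sum_filter_dvd_Icc {w : ℕ} (hw : 0 < w) (N : ℕ) (f : ℕ → ℝ) :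
    ∑ k ∈ (Finset.Icc 1 N).filter (w ∣ ·), f k = ∑ j ∈ Finset.Icc 1 (N / w), f (w * j) := by
  rw [filter_dvd_Icc_eq_image hw, Finset.sum_image]
  intro a _ b _ h
  exact Nat.eq_of_mul_eq_mul_left hw h

/-- The weight `exp (K t ∑ 1 / q)`, the sum being over the primes `q ≥ t` dividing `k`. -/
def primeWeight (K : ℝ) (t k : ℕ) : ℝ :=
  Real.exp (K * t * ∑ q ∈ k.primeFactors.filter (t ≤ ·), 1 / (q : ℝ))

theorem primeWeight_nonneg (K : ℝ) (t k : ℕ) : 0 ≤ primeWeight K t k := (Real.exp_pos _).le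

theorem sum_primeWeight_mul_le {K : ℝ} (hK : 0 ≤ K) {t : ℕ} (ht : 1 ≤ t) (N : ℕ) {f : ℕ → ℝ}
    {B : ℝ} (hB : 0 ≤ B)
    (hf : ∀ w, 0 < w → ∑ k ∈ (Finset.Icc 1 N).filter (w ∣ ·), f k ≤ B / w) :
    ∑ k ∈ Finset.Icc 1 N, primeWeight K t k * f k ≤ Real.exp (2 * K * Real.exp K) * B := by
  classical
  set e := (Finset.Ioo (t - 1) (N + 1)).filter Nat.Prime with he
  have hep : ∀ q ∈ e, q.Prime := fun q hq => (Finset.mem_filter.1 hq).2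
  set h : ℕ → ℝ := fun q => Real.exp (K * t / q) - 1 with hh
  have hh0 : ∀ q, 0 ≤ h q := fun q => by
    rw [hh, sub_nonneg]; exact Real.one_le_exp (by positivity)
  have hexp : ∀ k ∈ Finset.Icc 1 N, primeWeight K t k
      = ∑ s ∈ e.powerset, if (∏ q ∈ s, q) ∣ k then ∏ q ∈ s, h q else 0 := by
    intro k hk
    rw [Finset.mem_Icc] at hk
    have h1 : primeWeight K t k = ∏ q ∈ e, (1 + if q ∣ k then h q else 0) := by
      rw [primeWeight, Finset.mul_sum, Real.exp_sum]
      have : k.primeFactors.filter (t ≤ ·) = e.filter (· ∣ k) := by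
        ext q
        simp only [he, Finset.mem_filter, Nat.mem_primeFactors, Finset.mem_Ioo]
        constructor
        · rintro ⟨⟨h1, h2, h3⟩, h4⟩
          have := Nat.le_of_dvd hk.1 h2
          exact ⟨⟨⟨by omega, by omega⟩, h1⟩, h2⟩
        · rintro ⟨⟨⟨h1, h2⟩, h3⟩, h4⟩
          exact ⟨⟨h3, h4, by omega⟩, by omega⟩
      rw [this, Finset.prod_filter]
      refine Finset.prod_congr rfl fun q _ => ?_
      split_ifs
      · simp [hh, div_eq_mul_inv]
      · simp
    rw [h1, Finset.prod_one_add]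
    refine Finset.sum_congr rfl fun s hs => ?_
    rw [Finset.prod_ite_zero]
    refine if_congr ⟨fun h => ?_, fun h q hq => (Finset.dvd_prod_of_mem _ hq).trans h⟩ rfl rfl
    exact Finset.prod_primes_dvd k
      (fun q hq => (hep q (Finset.mem_powerset.1 hs hq)).prime) h
  calc ∑ k ∈ Finset.Icc 1 N, primeWeight K t k * f k
      = ∑ k ∈ Finset.Icc 1 N, ∑ s ∈ e.powerset,
          (∏ q ∈ s, h q) * (if (∏ q ∈ s, q) ∣ k then f k else 0) := by
        refine Finset.sum_congr rfl fun k hk => ?_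
        rw [hexp k hk, Finset.sum_mul]
        refine Finset.sum_congr rfl fun s _ => ?_
        split_ifs <;> simp
    _ = ∑ s ∈ e.powerset, (∏ q ∈ s, h q) *
          ∑ k ∈ (Finset.Icc 1 N).filter ((∏ q ∈ s, q) ∣ ·), f k := by
        rw [Finset.sum_comm]
        refine Finset.sum_congr rfl fun s _ => ?_
        rw [← Finset.mul_sum, Finset.sum_filter]
    _ ≤ ∑ s ∈ e.powerset, (∏ q ∈ s, h q) * (B / ((∏ q ∈ s, q : ℕ) : ℝ)) := by
        refine Finset.sum_le_sum fun s hs => mul_le_mul_of_nonneg_left (hf _ ?_)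
          (Finset.prod_nonneg fun q _ => hh0 q)
        exact Finset.prod_pos fun q hq => (hep q (Finset.mem_powerset.1 hs hq)).pos
    _ = B * ∏ q ∈ e, (1 + h q / q) := by
        rw [Finset.prod_one_add, Finset.mul_sum]
        refine Finset.sum_congr rfl fun s _ => ?_
        rw [Finset.prod_div_distrib, Nat.cast_prod]; ring
    _ ≤ B * Real.exp (∑ q ∈ e, h q / q) := by
        gcongr
        exact Real.prod_one_add_le_exp_sum _ fun q => div_nonneg (hh0 q) (Nat.cast_nonneg q)
    _ ≤ B * Real.exp (2 * K * Real.exp K) := by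
        gcongr
        have ht0 : (0 : ℝ) < t := by exact_mod_cast ht
        have hq : ∀ q ∈ e, h q / q ≤ K * t * Real.exp K * ((q : ℝ) ^ 2)⁻¹ := by
          intro q hq
          have hqt : t ≤ q := by
            have := Finset.mem_Ioo.1 (Finset.mem_filter.1 hq).1; omega
          have hqt' : (t : ℝ) ≤ q := by exact_mod_cast hqt
          have hq0 : (0 : ℝ) < q := by linarith
          have hx : K * t / q ≤ K := by
            rw [div_le_iff₀ hq0]; gcongr
          have h1 : h q ≤ K * t / q * Real.exp K := by
            have h2 := Real.add_one_le_exp (-(K * t / q))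
            have h3 : Real.exp (-(K * t / q)) * Real.exp (K * t / q) = 1 := by
              rw [← Real.exp_add]; simp
            have h4 := Real.exp_le_exp.2 hx
            have h5 := Real.exp_pos (K * t / q)
            have h6 : 0 ≤ K * t / q := by positivity
            simp only [hh]
            nlinarith
          rw [div_le_iff₀ hq0]
          refine h1.trans_eq ?_
          field_simp
        calc ∑ q ∈ e, h q / q ≤ ∑ q ∈ e, K * t * Real.exp K * ((q : ℝ) ^ 2)⁻¹ :=
              Finset.sum_le_sum hq
          _ ≤ ∑ q ∈ Finset.Ioo (t - 1) (N + 1), K * t * Real.exp K * ((q : ℝ) ^ 2)⁻¹ :=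
              Finset.sum_le_sum_of_subset_of_nonneg (Finset.filter_subset _ _)
                fun q _ _ => by positivity
          _ ≤ K * t * Real.exp K * (2 / ((t - 1 : ℕ) + 1)) := by
              rw [← Finset.mul_sum]
              gcongr
              exact sum_Ioo_inv_sq_le _ _
          _ = 2 * K * Real.exp K := by
              rw [Nat.cast_sub ht]; push_cast; rw [sub_add_cancel]; field_simp
    _ = _ := mul_comm _ _

theorem exists_sum_primeFactors_gt_le (n : ℕ) :
    ∃ t : ℕ, ∑ q ∈ n.primeFactors.filter (t < ·), 1 / (q : ℝ) ≤ 1 := by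
  refine ⟨n, ?_⟩
  rw [Finset.filter_eq_empty_iff.2 fun q hq => not_lt.2 (Nat.le_of_mem_primeFactors hq)]
  simp

open Classical in
/-- The least `t` such that `∑ 1 / q ≤ 1`, the sum being over the primes `q > t` dividing `n`. -/
def primeCutoff (n : ℕ) : ℕ := Nat.find (exists_sum_primeFactors_gt_le n)

theorem sum_primeFactors_gt_primeCutoff_le (n : ℕ) :
    ∑ q ∈ n.primeFactors.filter (primeCutoff n < ·), 1 / (q : ℝ) ≤ 1 := by
  classical
  exact Nat.find_spec (exists_sum_primeFactors_gt_le n)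

theorem one_lt_sum_primeFactors_ge_primeCutoff {n : ℕ} (hn : 1 ≤ primeCutoff n) :
    1 < ∑ q ∈ n.primeFactors.filter (primeCutoff n ≤ ·), 1 / (q : ℝ) := by
  classical
  have := Nat.find_min (exists_sum_primeFactors_gt_le n) (m := primeCutoff n - 1)
    (by change _ < primeCutoff n; omega)
  rw [not_le] at this
  have e : n.primeFactors.filter (primeCutoff n - 1 < ·)
      = n.primeFactors.filter (primeCutoff n ≤ ·) := Finset.filter_congr fun q _ => by omega
  rwa [e] at this

theorem one_le_primeWeight_mul {K : ℝ} (hK : 0 ≤ K) {u v : ℕ} (hu : u ≠ 0) (hv : v ≠ 0)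
    (ht : 1 ≤ primeCutoff (u * v)) :
    1 ≤ Real.exp (-(K * primeCutoff (u * v))) * (primeWeight K (primeCutoff (u * v)) u *
      primeWeight K (primeCutoff (u * v)) v) := by
  have h1 := one_lt_sum_primeFactors_ge_primeCutoff ht
  set t := primeCutoff (u * v)
  have h2 : ∑ q ∈ (u * v).primeFactors.filter (t ≤ ·), 1 / (q : ℝ)
      ≤ ∑ q ∈ u.primeFactors.filter (t ≤ ·), 1 / (q : ℝ)
        + ∑ q ∈ v.primeFactors.filter (t ≤ ·), 1 / (q : ℝ) := by
    rw [Nat.primeFactors_mul hu hv, Finset.filter_union, ← Finset.sum_union_inter]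
    have : 0 ≤ ∑ q ∈ u.primeFactors.filter (t ≤ ·) ∩ v.primeFactors.filter (t ≤ ·), 1 / (q : ℝ) :=
      Finset.sum_nonneg fun q _ => by positivity
    linarith
  rw [primeWeight, primeWeight, ← Real.exp_add, ← Real.exp_add]
  refine Real.one_le_exp ?_
  have : 0 ≤ K * t := by positivity
  nlinarith

theorem exists_sum_primeCutoff_le {d : ℕ} (hd : 2 ≤ d) : ∃ C : ℝ, 0 < C ∧
    ∀ (A : ℝ), 0 < A → ∀ (s : Finset (ℕ × ℕ)) (a : ℕ × ℕ → ℝ),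
    (∀ x ∈ s, x.1 ≠ 0 ∧ x.2 ≠ 0 ∧ 1 ≤ primeCutoff (x.1 * x.2) ∧ 0 ≤ a x ∧ a x ≤ A ∧
      x.2 * a x ≤ 16 ^ primeCutoff (x.1 * x.2) ∧ x.1 * A ≤ 16 ^ primeCutoff (x.1 * x.2)) →
    ∑ x ∈ s, (primeCutoff (x.1 * x.2) * a x) ^ d ≤ C := by
  classical
  set K : ℝ := 5 * d with hK
  have hK0 : 0 ≤ K := by positivity
  set E : ℝ := Real.exp (2 * K * Real.exp K) with hE
  have hE0 : 0 < E := Real.exp_pos _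
  refine ⟨8 * E ^ 2, by positivity, fun A hA s a hs => ?_⟩
  set t : ℕ × ℕ → ℕ := fun x => primeCutoff (x.1 * x.2) with ht
  obtain ⟨N, hN⟩ : ∃ N, ∀ x ∈ s, x.1 ≤ N ∧ x.2 ≤ N ∧ t x < N := by
    refine ⟨s.sup (fun x => x.1 + x.2 + t x + 1), fun x hx => ?_⟩
    have := Finset.le_sup (f := fun x : ℕ × ℕ => x.1 + x.2 + t x + 1) hx
    omega
  rw [← Finset.sum_fiberwise_of_maps_to (t := Finset.range N) (g := t)
    fun x hx => Finset.mem_range.2 (hN x hx).2.2]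
  have hfib : ∀ τ ∈ Finset.range N, ∑ x ∈ s.filter (fun x => t x = τ), ((t x : ℝ) * a x) ^ d
      ≤ 4 * E ^ 2 * (1 / 2) ^ τ := by
    intro τ _
    rcases Nat.eq_zero_or_pos τ with rfl | hτ
    · rw [Finset.filter_eq_empty_iff.2, Finset.sum_empty]
      · positivity
      · intro x hx h
        have := (hs x hx).2.2.1
        change t x = 0 at h
        change 1 ≤ t x at this
        omega
    set T : ℝ := 16 ^ τ with hT
    have hT1 : 1 ≤ T := one_le_pow₀ (by norm_num)
    have hT0 : 0 < T := by linarith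
    set Z : ℝ := Real.exp (-(K * τ)) * τ ^ d * T ^ (d - 2) with hZ
    have hZ0 : 0 ≤ Z := by positivity
    have hpt : ∀ x ∈ s.filter (fun x => t x = τ), ((t x : ℝ) * a x) ^ d
        ≤ Z * ((primeWeight K τ x.1 * 1) * (primeWeight K τ x.2 * (min A (T / x.2)) ^ 2)) := by
      intro x hx
      obtain ⟨hx, hxτ⟩ := Finset.mem_filter.1 hx
      obtain ⟨h1, h2, h3, h4, h5, h6, h7⟩ := hs x hx
      have hw := one_le_primeWeight_mul hK0 h1 h2 h3
      change primeCutoff (x.1 * x.2) = τ at hxτ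
      rw [hxτ] at hw h6
      have hx2 : (1 : ℝ) ≤ x.2 := by exact_mod_cast Nat.pos_of_ne_zero h2
      have h8 : a x ≤ T / x.2 := by
        rw [le_div_iff₀ (by linarith)]; linarith
      have h9 : a x ≤ T := h8.trans (div_le_self hT0.le hx2)
      have h10 : a x ^ d ≤ T ^ (d - 2) * (min A (T / x.2)) ^ 2 := by
        have : a x ^ d = a x ^ (d - 2) * a x ^ 2 := by rw [← pow_add]; congr 1; omega
        rw [this]
        gcongr
        exact le_min h5 h8
      simp only [ht, hxτ]
      calc ((τ : ℝ) * a x) ^ d = 1 * (τ ^ d * a x ^ d) := by rw [mul_pow, one_mul]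
        _ ≤ (Real.exp (-(K * τ)) * (primeWeight K τ x.1 * primeWeight K τ x.2)) *
            (τ ^ d * (T ^ (d - 2) * (min A (T / x.2)) ^ 2)) := by gcongr
        _ = _ := by rw [hZ]; ring
    have hsub : s.filter (fun x => t x = τ) ⊆ Finset.Icc 1 ⌊T / A⌋₊ ×ˢ Finset.Icc 1 N := by
      intro x hx
      obtain ⟨hx, hxτ⟩ := Finset.mem_filter.1 hx
      obtain ⟨h1, h2, -, -, -, -, h7⟩ := hs x hx
      change primeCutoff (x.1 * x.2) = τ at hxτ
      rw [hxτ] at h7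
      rw [Finset.mem_product, Finset.mem_Icc, Finset.mem_Icc]
      refine ⟨⟨by omega, Nat.le_floor ?_⟩, by omega, (hN x hx).2.1⟩
      rw [le_div_iff₀ hA]; exact h7
    have hU : ∑ u ∈ Finset.Icc 1 ⌊T / A⌋₊, primeWeight K τ u * 1 ≤ E * (T / A) := by
      refine sum_primeWeight_mul_le hK0 hτ _ (by positivity) fun w hw => ?_
      rw [sum_filter_dvd_Icc hw, Finset.sum_const, Nat.card_Icc, nsmul_eq_mul, mul_one,
        Nat.add_sub_cancel]
      refine Nat.cast_div_le.trans ?_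
      gcongr
      exact Nat.floor_le (by positivity)
    have hV : ∑ v ∈ Finset.Icc 1 N, primeWeight K τ v * (min A (T / v)) ^ 2 ≤ E * (4 * A * T) := by
      refine sum_primeWeight_mul_le hK0 hτ _ (by positivity) fun w hw => ?_
      rw [sum_filter_dvd_Icc hw]
      have hw0 : (0 : ℝ) < w := by exact_mod_cast hw
      have := sum_min_div_sq_le hA (B := T / w) (by positivity) (N / w)
      simp only [Nat.cast_mul, ← div_div]
      refine this.trans_eq ?_
      ring
    have hnum : (τ : ℝ) ^ d * T ^ d * Real.exp (-(K * τ)) ≤ (1 / 2) ^ τ := by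
      have hτ2 : (τ : ℝ) ≤ 2 ^ τ := by exact_mod_cast Nat.lt_two_pow_self.le
      have he : Real.exp (-(K * τ)) = (Real.exp (-5)) ^ (d * τ) := by
        rw [← Real.exp_nat_mul]; congr 1; rw [hK]; push_cast; ring
      have he5 : Real.exp (-5) ≤ 1 / 64 := by
        rw [Real.exp_neg, one_div]
        refine inv_anti₀ (by norm_num) ?_
        have h1 := Real.exp_one_gt_d9
        have h2 : Real.exp 5 = Real.exp 1 ^ 5 := by rw [← Real.exp_nat_mul]; norm_num
        rw [h2]
        calc (64 : ℝ) ≤ 2.7 ^ 5 := by norm_num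
          _ ≤ _ := by gcongr; linarith
      calc (τ : ℝ) ^ d * T ^ d * Real.exp (-(K * τ))
          ≤ (2 ^ τ) ^ d * T ^ d * (1 / 64) ^ (d * τ) := by
            rw [he]; gcongr
        _ = ((1 / 2) ^ τ) ^ d := by
            rw [hT, mul_comm d τ, pow_mul (1 / 64 : ℝ), ← mul_pow, ← mul_pow, ← mul_pow, ← mul_pow]
            norm_num
        _ ≤ ((1 / 2) ^ τ) ^ 1 :=
            pow_le_pow_of_le_one (by positivity) (pow_le_one₀ (by norm_num) (by norm_num))
              (by omega)
        _ = _ := pow_one _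
    calc ∑ x ∈ s.filter (fun x => t x = τ), ((t x : ℝ) * a x) ^ d
        ≤ ∑ x ∈ s.filter (fun x => t x = τ),
          Z * ((primeWeight K τ x.1 * 1) * (primeWeight K τ x.2 * (min A (T / x.2)) ^ 2)) :=
          Finset.sum_le_sum hpt
      _ ≤ ∑ x ∈ Finset.Icc 1 ⌊T / A⌋₊ ×ˢ Finset.Icc 1 N,
          Z * ((primeWeight K τ x.1 * 1) * (primeWeight K τ x.2 * (min A (T / x.2)) ^ 2)) := by
          refine Finset.sum_le_sum_of_subset_of_nonneg hsub fun x _ _ => ?_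
          have := primeWeight_nonneg K τ x.1
          have := primeWeight_nonneg K τ x.2
          positivity
      _ = Z * ((∑ u ∈ Finset.Icc 1 ⌊T / A⌋₊, primeWeight K τ u * 1) *
          ∑ v ∈ Finset.Icc 1 N, primeWeight K τ v * (min A (T / v)) ^ 2) := by
          rw [← Finset.mul_sum, Finset.sum_mul_sum, Finset.sum_product]
      _ ≤ Z * ((E * (T / A)) * (E * (4 * A * T))) := by
          gcongr
          exact Finset.sum_nonneg fun v _ => mul_nonneg (primeWeight_nonneg _ _ _) (sq_nonneg _)
      _ = 4 * E ^ 2 * (τ ^ d * T ^ d * Real.exp (-(K * τ))) := by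
          have : T ^ d = T ^ (d - 2) * T ^ 2 := by rw [← pow_add]; congr 1; omega
          rw [this, hZ]; field_simp
      _ ≤ _ := by gcongr
  refine (Finset.sum_le_sum hfib).trans ?_
  rw [← Finset.mul_sum]
  have := Summable.sum_le_tsum (f := fun n : ℕ => ((1 : ℝ) / 2) ^ n) (Finset.range N)
    (fun _ _ => by positivity) summable_geometric_two
  rw [tsum_geometric_two] at this
  nlinarith [sq_nonneg E]

theorem prod_Icc_two_inv_one_sub {t : ℕ} (ht : 1 ≤ t) :
    ∏ k ∈ Finset.Icc 2 t, (1 - 1 / (k : ℝ))⁻¹ = t := by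
  induction t, ht using Nat.le_induction with
  | base => simp
  | succ t ht ih =>
    have : (0 : ℝ) < t := by exact_mod_cast ht
    rw [Finset.prod_Icc_succ_top (by omega), ih]
    push_cast
    rw [one_sub_div (by positivity), add_sub_cancel_right, inv_div, mul_div_cancel₀ _ this.ne']

theorem le_mul_totient {v t : ℕ} (ht : 1 ≤ t)
    (hs : ∑ q ∈ v.primeFactors.filter (t < ·), 1 / (q : ℝ) ≤ 1) :
    (v : ℝ) ≤ Real.exp 2 * t * v.totient := by
  have hp : ∀ q ∈ v.primeFactors, q.Prime := fun q hq => Nat.prime_of_mem_primeFactors hq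
  have h1 : ∏ q ∈ v.primeFactors.filter (t < ·), (1 - 1 / (q : ℝ))⁻¹ ≤ Real.exp 2 :=
    (prod_primes_inv_one_sub_le_exp fun q hq => hp q (Finset.mem_filter.1 hq).1).trans
      (Real.exp_le_exp.2 (by linarith))
  have h2 : ∏ q ∈ v.primeFactors.filter (fun q => ¬ t < q), (1 - 1 / (q : ℝ))⁻¹ ≤ t := by
    rw [← prod_Icc_two_inv_one_sub ht]
    have hsub : v.primeFactors.filter (fun q => ¬ t < q) ⊆ Finset.Icc 2 t := fun q hq => by
      obtain ⟨h1, h2⟩ := Finset.mem_filter.1 hq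
      exact Finset.mem_Icc.2 ⟨(hp q h1).two_le, not_lt.1 h2⟩
    rw [← Finset.prod_sdiff hsub]
    refine le_mul_of_one_le_left (Finset.prod_nonneg fun q hq => ?_)
      (Finset.one_le_prod fun q hq => ?_)
    · exact (inv_pos.2 (hp q (Finset.mem_filter.1 hq).1).one_sub_one_div_pos).le
    · replace hq := (Finset.mem_sdiff.1 hq).1
      have : (2 : ℝ) ≤ q := by exact_mod_cast (Finset.mem_Icc.1 hq).1
      have h3 : 1 / (q : ℝ) ≤ 1 / 2 := one_div_le_one_div_of_le (by norm_num) this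
      have h4 : 0 ≤ 1 / (q : ℝ) := by positivity
      exact (one_le_inv₀ (by linarith)).2 (by linarith)
  have h3 : ∏ q ∈ v.primeFactors, (1 - 1 / (q : ℝ))⁻¹ ≤ Real.exp 2 * t := by
    rw [← Finset.prod_filter_mul_prod_filter_not _ (t < ·)]
    refine mul_le_mul h1 h2 (Finset.prod_nonneg fun q hq => ?_) (Real.exp_pos _).le
    exact (inv_pos.2 (hp q (Finset.mem_filter.1 hq).1).one_sub_one_div_pos).le
  have h4 : 0 < ∏ q ∈ v.primeFactors, (1 - 1 / (q : ℝ)) :=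
    Finset.prod_pos fun q hq => (hp q hq).one_sub_one_div_pos
  rw [Finset.prod_inv_distrib, inv_le_iff_one_le_mul₀ h4] at h3
  rw [Nat.totient_eq_mul_prod_one_sub]
  have hv0 : (0 : ℝ) ≤ v := Nat.cast_nonneg v
  nlinarith

/-- An upper bound for the correlation of two sums of indicator functions of balls, of radii
`ψ m` and `ψ n`, around the reduced fractions with denominators `m` and `n`. -/
def pairBound (ψ : ℕ → ℝ) (κ : ℤ) (m n : ℕ) : ℝ :=
  2 * min (ψ m) (ψ n) * (∑ c ∈ Finset.Icc 1 ⌊2 * (m.lcm n : ℝ) * max (ψ m) (ψ n)⌋₊,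
    (((residuePairs (m.gcd n) (m / m.gcd n) (n / m.gcd n) (κ * c)).card : ℝ) +
      (residuePairs (m.gcd n) (m / m.gcd n) (n / m.gcd n) (-κ * c)).card) +
    if m = n then (n.totient : ℝ) else 0)

theorem exists_pairBound_le : ∃ C : ℝ, 0 < C ∧ ∀ (ψ : ℕ → ℝ) (κ : ℤ) (m n : ℕ), m ≠ 0 → n ≠ 0 →
    0 ≤ ψ m → 0 ≤ ψ n → n.totient * ψ n ≤ 1 → IsCoprime κ ((m.lcm n : ℕ) : ℤ) →
    (m = n → pairBound ψ κ m n ≤ C * (n.totient * ψ n)) ∧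
    (m ≠ n → pairBound ψ κ m n ≤ C * ((m.totient * ψ m) * (n.totient * ψ n)) ∨
      1 ≤ primeCutoff ((m / m.gcd n) * (n / m.gcd n)) ∧
      ((n / m.gcd n : ℕ) : ℝ) * (m * ψ m) ≤ 16 ^ primeCutoff ((m / m.gcd n) * (n / m.gcd n)) ∧
      ((m / m.gcd n : ℕ) : ℝ) * (n * ψ n) ≤ 16 ^ primeCutoff ((m / m.gcd n) * (n / m.gcd n)) ∧
      pairBound ψ κ m n ≤ C * ((n.totient * ψ n) *
        (primeCutoff ((m / m.gcd n) * (n / m.gcd n)) * (m * ψ m)))) := by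
  obtain ⟨C, hC, hgood⟩ := exists_sum_card_residuePairs_le
  refine ⟨8 * C + 8 * Real.exp 2 + 2, by positivity,
    fun ψ κ m n hm hn hψm hψn hψn1 hκ => ?_⟩
  obtain ⟨g, u, v, hg, huv, rfl, rfl⟩ : ∃ g u v, 0 < g ∧ u.Coprime v ∧ m = g * u ∧ n = g * v := by
    obtain ⟨g, u, v, hg, huv, h1, h2⟩ := Nat.exists_coprime' (Nat.gcd_pos_of_pos_left n (Nat.pos_of_ne_zero hm))
    exact ⟨g, u, v, hg, huv, by rw [h1, mul_comm], by rw [h2, mul_comm]⟩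
  have hu : u ≠ 0 := right_ne_zero_of_mul hm
  have hv : v ≠ 0 := right_ne_zero_of_mul hn
  have hgcd : (g * u).gcd (g * v) = g := by rw [Nat.gcd_mul_left, huv.gcd_eq_one, mul_one]
  have hlcm : (g * u).lcm (g * v) = g * u * v := by
    rw [Nat.lcm_mul_left, huv.lcm_eq_mul, mul_assoc]
  rw [pairBound, hgcd, hlcm, Nat.mul_div_cancel_left _ hg, Nat.mul_div_cancel_left _ hg,
    Finset.sum_add_distrib]
  rw [hlcm] at hκ
  set a := ψ (g * u) with ha
  set b := ψ (g * v) with hb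
  set D := 2 * ((g * u * v : ℕ) : ℝ) * max a b with hD
  have hD0 : 0 ≤ D := by positivity
  have hL0 : (0 : ℝ) < g * u * v := by positivity
  have hmm : min a b * max a b = a * b := min_mul_max a b
  have hmin0 : 0 ≤ min a b := le_min hψm hψn
  set S₁ := ∑ c ∈ Finset.Icc 1 ⌊D⌋₊, ((residuePairs g u v (κ * c)).card : ℝ) with hS₁
  set S₂ := ∑ c ∈ Finset.Icc 1 ⌊D⌋₊, ((residuePairs g u v (-κ * c)).card : ℝ) with hS₂
  set φm : ℝ := ((g * u).totient : ℝ) with hφm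
  set φn : ℝ := ((g * v).totient : ℝ) with hφn
  have hφm0 : 0 ≤ φm := Nat.cast_nonneg _
  have hφn0 : 0 ≤ φn := Nat.cast_nonneg _
  have hgood' : ∀ t : ℕ, ∑ q ∈ (u * v).primeFactors.filter (t < ·), 1 / (q : ℝ) ≤ 1 →
      (16 : ℝ) ^ t ≤ D → 2 * min a b * (S₁ + S₂) ≤ 8 * C * ((φm * a) * (φn * b)) := by
    intro t ht htD
    have h1 := hgood hg.ne' hu hv huv κ hκ t ht D htD
    have h2 := hgood hg.ne' hu hv huv (-κ) hκ.neg_left t ht D htD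
    calc 2 * min a b * (S₁ + S₂)
        ≤ 2 * min a b * (C * D * (φm * φn / (g * u * v)) + C * D * (φm * φn / (g * u * v))) := by
          gcongr
      _ = 8 * C * (min a b * max a b) * (φm * φn) := by
          rw [hD]; push_cast; field_simp; ring
      _ = _ := by rw [hmm]; ring
  have hsmall : D < 1 → S₁ + S₂ = 0 := by
    intro h
    have : ⌊D⌋₊ = 0 := Nat.floor_eq_zero.2 h
    rw [hS₁, hS₂, this]; simp
  refine ⟨fun hmn => ?_, fun hmn => ?_⟩
  · rw [if_pos hmn]
    have huv' : u = v := Nat.eq_of_mul_eq_mul_left hg hmn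
    have hab : a = b := by rw [ha, hb, hmn]
    have hφ : φm = φn := by rw [hφm, hφn, hmn]
    have h1 : 2 * min a b * (S₁ + S₂) ≤ 8 * C * (φn * b) := by
      rcases lt_or_ge D 1 with h | h
      · rw [hsmall h, mul_zero]; positivity
      · have h0 : u * v = 1 := by
          have := huv
          rw [← huv', Nat.coprime_self] at this
          rw [← huv', this]
        refine (hgood' 0 (by simp [h0]) (by simpa using h)).trans ?_
        rw [hab, hφ]
        have : 0 ≤ φn * b := by positivity
        have : φn * b * (φn * b) ≤ φn * b := by nlinarith
        gcongr
    have h2 : 2 * min a b * φn = 2 * (φn * b) := by rw [hab, min_self]; ring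
    have h3 : 0 ≤ Real.exp 2 * (φn * b) := by positivity
    rw [mul_add, h2]
    linarith
  · rw [if_neg hmn, add_zero]
    have hcut := sum_primeFactors_gt_primeCutoff_le (u * v)
    set t := primeCutoff (u * v) with ht
    rcases le_or_gt ((16 : ℝ) ^ t) D with h | h
    · left
      refine (hgood' t hcut h).trans ?_
      have : 0 ≤ (φm * a) * (φn * b) := by positivity
      have : 0 ≤ Real.exp 2 * ((φm * a) * (φn * b)) := by positivity
      linarith
    rcases Nat.eq_zero_or_pos t with h0 | h0
    · left
      rw [h0, pow_zero] at h
      rw [hsmall h, mul_zero]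
      positivity
    right
    have hle : D ≤ 16 ^ t := h.le
    refine ⟨h0, ?_, ?_, ?_⟩
    · refine le_trans ?_ hle
      rw [hD]; push_cast
      have : a ≤ max a b := le_max_left _ _
      calc (v : ℝ) * (g * u * a) = (g * u * v) * a := by ring
        _ ≤ (g * u * v) * max a b := by gcongr
        _ ≤ 2 * (g * u * v) * max a b := by
          have : 0 ≤ (g * u * v : ℝ) * max a b := by positivity
          linarith
    · refine le_trans ?_ hle
      rw [hD]; push_cast
      have : b ≤ max a b := le_max_right _ _
      calc (u : ℝ) * (g * v * b) = (g * u * v) * b := by ring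
        _ ≤ (g * u * v) * max a b := by gcongr
        _ ≤ 2 * (g * u * v) * max a b := by
          have : 0 ≤ (g * u * v : ℝ) * max a b := by positivity
          linarith
    · have h1 := sum_card_residuePairs_le_totient hg.ne' hu hv huv κ hD0
      have h2 := sum_card_residuePairs_le_totient hg.ne' hu hv huv (-κ) hD0
      have hvt : (v : ℝ) ≤ Real.exp 2 * t * v.totient := by
        refine le_mul_totient h0 (le_trans ?_ hcut)
        refine Finset.sum_le_sum_of_subset_of_nonneg (Finset.filter_subset_filter _ ?_)
          fun q _ _ => by positivity
        exact Nat.primeFactors_mono (dvd_mul_left v u) (mul_ne_zero hu hv)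
      have hsup : (g.totient : ℝ) * v.totient ≤ φn := by
        rw [hφn]; exact_mod_cast Nat.totient_super_multiplicative g v
      calc 2 * min a b * (S₁ + S₂) ≤ 2 * min a b * (D * g.totient + D * g.totient) := by gcongr
        _ = 8 * (min a b * max a b) * (g * u) * (v * g.totient) := by
            rw [hD]; push_cast; ring
        _ ≤ 8 * (a * b) * (g * u) * (Real.exp 2 * t * v.totient * g.totient) := by
            rw [hmm]; gcongr
        _ = 8 * (a * b) * (g * u) * (Real.exp 2 * t) * (g.totient * v.totient) := by ring
        _ ≤ 8 * (a * b) * (g * u) * (Real.exp 2 * t) * φn := by gcongr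
        _ = 8 * Real.exp 2 * ((φn * b) * (t * (((g * u : ℕ) : ℝ) * a))) := by push_cast; ring
        _ ≤ _ := by gcongr; linarith

theorem div_div_gcd_mul {m n : ℕ} (hn : n ≠ 0) : n / (n / m.gcd n) * (m / m.gcd n) = m := by
  rw [Nat.div_div_self (Nat.gcd_dvd_right m n) hn, Nat.mul_div_cancel' (Nat.gcd_dvd_left m n)]

theorem exists_sum_sum_le {ι : Type*} [Fintype ι] (hι : 2 ≤ Fintype.card ι) : ∃ C : ℝ, 0 < C ∧
    ∀ (s : Finset ℕ) (ψ : ℕ → ℝ), (∀ n ∈ s, n ≠ 0 ∧ 0 < ψ n ∧ n.totient * ψ n ≤ 1) →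
    ∀ (I : ℕ → ℕ → ℝ) (J : ι → ℕ → ℕ → ℝ), (∀ m n, I m n = I n m) →
    (∀ m ∈ s, ∀ n ∈ s, I m n ≤ ∏ i, J i m n) → (∀ i, ∀ m ∈ s, ∀ n ∈ s, 0 ≤ J i m n) →
    (∀ i, ∀ m ∈ s, ∀ n ∈ s, ∃ κ : ℤ, IsCoprime κ ((m.lcm n : ℕ) : ℤ) ∧
      J i m n ≤ pairBound ψ κ m n) →
    ∑ m ∈ s, ∑ n ∈ s, I m n ≤ C * ((∑ n ∈ s, (n.totient * ψ n) ^ Fintype.card ι) ^ 2 +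
      ∑ n ∈ s, (n.totient * ψ n) ^ Fintype.card ι) := by
  classical
  set d := Fintype.card ι with hd
  obtain ⟨C, hC, hpair⟩ := exists_pairBound_le
  obtain ⟨C', hC', hbad⟩ := exists_sum_primeCutoff_le hι
  refine ⟨2 * C ^ d * (1 + C'), by positivity, fun s ψ hs I J hsymm hI hJ0 hJ => ?_⟩
  set x : ℕ → ℝ := fun n => n.totient * ψ n with hx
  set A : ℕ → ℝ := fun n => n * ψ n with hA
  set t : ℕ → ℕ → ℕ := fun m n => primeCutoff ((m / m.gcd n) * (n / m.gcd n)) with ht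
  have hx0 : ∀ n ∈ s, 0 ≤ x n := fun n hn => mul_nonneg (Nat.cast_nonneg _) (hs n hn).2.1.le
  have hA0 : ∀ n ∈ s, 0 < A n := fun n hn => by
    obtain ⟨h1, h2, -⟩ := hs n hn
    exact mul_pos (by positivity) h2
  set bad : ℕ → ℕ → Prop := fun m n => A m ≤ A n ∧ 1 ≤ t m n ∧
    ((n / m.gcd n : ℕ) : ℝ) * A m ≤ 16 ^ t m n ∧ ((m / m.gcd n : ℕ) : ℝ) * A n ≤ 16 ^ t m n
    with hbaddef
  set F : ℕ → ℕ → ℝ := fun m n => C ^ d * (x m ^ d * x n ^ d + (if m = n then x n ^ d else 0) +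
    x n ^ d * (if bad m n then (t m n * A m) ^ d else 0)) with hF
  have hprod : ∀ m ∈ s, ∀ n ∈ s, ∀ B : ℝ, (∀ i, J i m n ≤ B) → I m n ≤ B ^ d := by
    intro m hm n hn B hB
    refine (hI m hm n hn).trans ((Finset.prod_le_prod (fun i _ => hJ0 i m hm n hn)
      fun i _ => hB i).trans_eq ?_)
    rw [Finset.prod_const, Finset.card_univ]
  have hthird : ∀ m ∈ s, ∀ n ∈ s,
      0 ≤ x n ^ d * (if bad m n then ((t m n : ℝ) * A m) ^ d else 0) := by
    intro m hm n hn
    have := hA0 m hm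
    refine mul_nonneg (pow_nonneg (hx0 n hn) _) ?_
    split_ifs <;> positivity
  have hF0 : ∀ m ∈ s, ∀ n ∈ s, 0 ≤ F m n := by
    intro m hm n hn
    have h1 := hx0 m hm
    have h2 := hx0 n hn
    have h3 := hthird m hm n hn
    refine mul_nonneg (by positivity) (add_nonneg (add_nonneg (by positivity) ?_) h3)
    split_ifs <;> positivity
  have hle : ∀ m ∈ s, ∀ n ∈ s, A m ≤ A n → I m n ≤ F m n := by
    intro m hm n hn hmn
    obtain ⟨hm0, hm1, hm2⟩ := hs m hm
    obtain ⟨hn0, hn1, hn2⟩ := hs n hn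
    have h1 := hx0 m hm
    have h2 := hx0 n hn
    have h3 := hthird m hm n hn
    have h1d : 0 ≤ x m ^ d * x n ^ d := by positivity
    by_cases h : m = n
    · refine (hprod m hm n hn (C * x n) fun i => ?_).trans ?_
      · obtain ⟨κ, hκ, hJκ⟩ := hJ i m hm n hn
        exact hJκ.trans ((hpair ψ κ m n hm0 hn0 hm1.le hn1.le hn2 hκ).1 h)
      · rw [mul_pow, hF]
        simp only [if_pos h]
        gcongr
        linarith
    simp only [hF, if_neg h, add_zero]
    rcases isEmpty_or_nonempty ι with he | ⟨⟨i₀⟩⟩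
    · rw [hd, Fintype.card_eq_zero] at hι; omega
    by_cases hb : bad m n
    · rw [if_pos hb]
      have h4 : 0 ≤ (t m n : ℝ) * A m := by have := hA0 m hm; positivity
      rcases le_total (x m) (t m n * A m) with h5 | h5
      · refine (hprod m hm n hn (C * (x n * (t m n * A m))) fun i => ?_).trans ?_
        · obtain ⟨κ, hκ, hJκ⟩ := hJ i m hm n hn
          rcases (hpair ψ κ m n hm0 hn0 hm1.le hn1.le hn2 hκ).2 h with h6 | ⟨-, -, -, h6⟩
          · refine hJκ.trans (h6.trans ?_)
            change C * (x m * x n) ≤ _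
            rw [mul_comm (x m)]
            gcongr
          · exact hJκ.trans h6
        · rw [mul_pow, mul_pow]
          gcongr
          linarith
      · refine (hprod m hm n hn (C * (x m * x n)) fun i => ?_).trans ?_
        · obtain ⟨κ, hκ, hJκ⟩ := hJ i m hm n hn
          rcases (hpair ψ κ m n hm0 hn0 hm1.le hn1.le hn2 hκ).2 h with h6 | ⟨-, -, -, h6⟩
          · exact hJκ.trans h6
          · refine hJκ.trans (h6.trans ?_)
            change C * (x n * (t m n * A m)) ≤ _
            rw [mul_comm (x m)]
            gcongr
        · rw [mul_pow, mul_pow]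
          gcongr
          rw [if_pos hb] at h3
          linarith
    · rw [if_neg hb, mul_zero, add_zero]
      refine (hprod m hm n hn (C * (x m * x n)) fun i => ?_).trans_eq (by rw [mul_pow, mul_pow])
      obtain ⟨κ, hκ, hJκ⟩ := hJ i m hm n hn
      rcases (hpair ψ κ m n hm0 hn0 hm1.le hn1.le hn2 hκ).2 h with h6 | ⟨h7, h8, h9, -⟩
      · exact hJκ.trans h6
      · exact absurd ⟨hmn, h7, h8, h9⟩ hb
  have hsumF : ∑ m ∈ s, ∑ n ∈ s, F m n
      ≤ C ^ d * ((∑ n ∈ s, x n ^ d) ^ 2 + ∑ n ∈ s, x n ^ d + (∑ n ∈ s, x n ^ d) * C') := by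
    have hinner : ∀ n ∈ s, ∑ m ∈ s, (if bad m n then ((t m n : ℝ) * A m) ^ d else 0) ≤ C' := by
      intro n hn
      have hn0 := (hs n hn).1
      rw [← Finset.sum_filter]
      have hinj : Set.InjOn (fun m : ℕ => (m / m.gcd n, n / m.gcd n))
          (s.filter fun m => bad m n : Finset ℕ) := by
        intro m _ m' _ h
        simp only [Prod.mk.injEq] at h
        rw [← div_div_gcd_mul (m := m) hn0, h.1, h.2, div_div_gcd_mul hn0]
      have := hbad (A n) (hA0 n hn) ((s.filter fun m => bad m n).image
        fun m : ℕ => (m / m.gcd n, n / m.gcd n)) (fun y => A (n / y.2 * y.1)) ?_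
      · rw [Finset.sum_image hinj] at this
        simp only [div_div_gcd_mul hn0] at this
        exact this
      · intro y hy
        obtain ⟨m, hm, rfl⟩ := Finset.mem_image.1 hy
        obtain ⟨hm, hb⟩ := Finset.mem_filter.1 hm
        simp only [div_div_gcd_mul hn0]
        have hg : 0 < m.gcd n := Nat.gcd_pos_of_pos_right _ (Nat.pos_of_ne_zero hn0)
        exact ⟨(Nat.div_pos (Nat.gcd_le_left n (Nat.pos_of_ne_zero (hs m hm).1)) hg).ne',
          (Nat.div_pos (Nat.gcd_le_right m (Nat.pos_of_ne_zero hn0)) hg).ne', hb.2.1,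
          (hA0 m hm).le, hb.1, hb.2.2.1, hb.2.2.2⟩
    simp only [hF, ← Finset.mul_sum, Finset.sum_add_distrib]
    refine mul_le_mul_of_nonneg_left (add_le_add (add_le_add ?_ ?_) ?_) (by positivity)
    · rw [sq, Finset.sum_mul_sum]
      simp only [Finset.mul_sum, le_refl]
    · refine le_of_eq (Finset.sum_congr rfl fun m hm => ?_)
      rw [Finset.sum_ite_eq s m, if_pos hm]
    · rw [Finset.sum_comm, Finset.sum_mul]
      refine Finset.sum_le_sum fun n hn => ?_
      rw [← Finset.mul_sum]
      exact mul_le_mul_of_nonneg_left (hinner n hn) (pow_nonneg (hx0 n hn) _)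
  have hX : 0 ≤ ∑ n ∈ s, x n ^ d := Finset.sum_nonneg fun n hn => pow_nonneg (hx0 n hn) _
  calc ∑ m ∈ s, ∑ n ∈ s, I m n ≤ ∑ m ∈ s, ∑ n ∈ s, (F m n + F n m) := by
        refine Finset.sum_le_sum fun m hm => Finset.sum_le_sum fun n hn => ?_
        rcases le_total (A m) (A n) with h | h
        · have := hle m hm n hn h
          have := hF0 n hn m hm
          linarith
        · have := hle n hn m hm h
          have := hF0 m hm n hn
          rw [hsymm]
          linarith
    _ = 2 * ∑ m ∈ s, ∑ n ∈ s, F m n := by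
        simp only [Finset.sum_add_distrib]
        rw [Finset.sum_comm (f := fun m n => F n m)]
        ring
    _ ≤ 2 * (C ^ d * ((∑ n ∈ s, x n ^ d) ^ 2 + ∑ n ∈ s, x n ^ d + (∑ n ∈ s, x n ^ d) * C')) := by
        gcongr
    _ ≤ 2 * C ^ d * (1 + C') * ((∑ n ∈ s, x n ^ d) ^ 2 + ∑ n ∈ s, x n ^ d) := by
        have : 0 ≤ C ^ d * (C' * (∑ n ∈ s, x n ^ d) ^ 2) := by positivity
        linarith

/-- The reduced residues of `n` in `[0, n)`. -/
def reducedResidues (n : ℕ) : Finset ℕ := (Finset.range n).filter fun a => a.Coprime n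

theorem mem_reducedResidues {n a : ℕ} : a ∈ reducedResidues n ↔ a < n ∧ a.Coprime n := by
  simp [reducedResidues]

theorem card_reducedResidues (n : ℕ) : (reducedResidues n).card = n.totient := by
  simp only [reducedResidues, Nat.totient_eq_card_coprime, Nat.coprime_comm]

/-- The number of `a ∈ [0, n)` coprime to `n` with `x ∈ B n a`. -/
def ballSum {X : Type*} (B : ℕ → ℕ → Set X) (n : ℕ) (x : X) : ℝ :=
  ∑ a ∈ reducedResidues n, (B n a).indicator (fun _ => 1) x

section BallSum

variable {X : Type*} {B : ℕ → ℕ → Set X}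

theorem ballSum_nonneg (n : ℕ) (x : X) : 0 ≤ ballSum B n x :=
  Finset.sum_nonneg fun _ _ => Set.indicator_nonneg (fun _ _ => zero_le_one) _

theorem ballSum_le (n : ℕ) (x : X) : ballSum B n x ≤ n.totient := by
  rw [← card_reducedResidues, ← nsmul_one, ← Finset.sum_const]
  exact Finset.sum_le_sum fun _ _ => Set.indicator_le_self' (fun _ _ => zero_le_one) _

theorem exists_mem_of_ballSum_ne_zero {n : ℕ} {x : X} (h : ballSum B n x ≠ 0) :
    ∃ a < n, a.Coprime n ∧ x ∈ B n a := by
  obtain ⟨a, ha, h⟩ := Finset.exists_ne_zero_of_sum_ne_zero h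
  obtain ⟨h1, h2⟩ := mem_reducedResidues.1 ha
  exact ⟨a, h1, h2, Set.mem_of_indicator_ne_zero h⟩

variable [MeasurableSpace X] (μ : Measure X) [IsFiniteMeasure μ]

theorem measurable_ballSum (hB : ∀ n a, MeasurableSet (B n a)) (n : ℕ) :
    Measurable (ballSum B n) :=
  Finset.measurable_fun_sum _ fun _ _ => measurable_const.indicator (hB _ _)

theorem setIntegral_ballSum (hB : ∀ n a, MeasurableSet (B n a)) (A : Set X) (n : ℕ) :
    ∫ x in A, ballSum B n x ∂μ = ∑ a ∈ reducedResidues n, μ.real (B n a ∩ A) := by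
  unfold ballSum
  rw [integral_finsetSum _ fun a _ => (integrable_const 1).indicator (hB n a)]
  refine Finset.sum_congr rfl fun a _ => ?_
  rw [integral_indicator_const _ (hB n a), smul_eq_mul, mul_one, measureReal_restrict_apply (hB n a)]

theorem integral_ballSum (hB : ∀ n a, MeasurableSet (B n a)) (n : ℕ) :
    ∫ x, ballSum B n x ∂μ = ∑ a ∈ reducedResidues n, μ.real (B n a) := by
  simpa using setIntegral_ballSum μ hB Set.univ n

theorem integral_ballSum_mul_ballSum (hB : ∀ n a, MeasurableSet (B n a)) (m n : ℕ) :
    ∫ x, ballSum B m x * ballSum B n x ∂μ =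
      ∑ a ∈ reducedResidues m, ∑ b ∈ reducedResidues n, μ.real (B m a ∩ B n b) := by
  have : ∀ x, ballSum B m x * ballSum B n x = ∑ a ∈ reducedResidues m, ∑ b ∈ reducedResidues n,
      (B m a ∩ B n b).indicator (fun _ => (1 : ℝ)) x := by
    intro x
    simp only [ballSum, Finset.sum_mul_sum]
    refine Finset.sum_congr rfl fun a _ => Finset.sum_congr rfl fun b _ => ?_
    by_cases ha : x ∈ B m a <;> by_cases hb : x ∈ B n b <;> simp [ha, hb]
  simp only [this]
  have hprodInt : ∀ a b, Integrable ((B m a ∩ B n b).indicator fun _ => (1 : ℝ)) μ := fun a b =>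
    (integrable_const 1).indicator ((hB m a).inter (hB n b))
  rw [integral_finsetSum _ fun a _ => integrable_finsetSum _ fun b _ => hprodInt a b]
  refine Finset.sum_congr rfl fun a _ => ?_
  rw [integral_finsetSum _ fun b _ => hprodInt a b]
  refine Finset.sum_congr rfl fun b _ => ?_
  rw [integral_indicator_const _ ((hB m a).inter (hB n b)), smul_eq_mul, mul_one]

theorem integral_ballSum_mul_ballSum_le (hB : ∀ n a, MeasurableSet (B n a)) {ψ : ℕ → ℝ} {m n : ℕ}
    (hψm : 0 ≤ ψ m) (hψn : 0 ≤ ψ n)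
    (hμm : ∀ a, μ.real (B m a) ≤ 2 * ψ m) (hμn : ∀ a, μ.real (B n a) ≤ 2 * ψ n) {κ : ℤ}
    (hsep : ∀ a < m, a.Coprime m → ∀ b < n, b.Coprime n → (B m a ∩ B n b).Nonempty →
      (m = n ∧ a = b) ∨ ∃ c : ℤ, c ≠ 0 ∧ (|c| : ℝ) ≤ 2 * (m.lcm n : ℝ) * max (ψ m) (ψ n) ∧
        ((m.lcm n : ℕ) : ℤ) ∣ (a * (n / m.gcd n : ℕ) - b * (m / m.gcd n : ℕ) : ℤ) - κ * c) :
    ∫ x, ballSum B m x * ballSum B n x ∂μ ≤ pairBound ψ κ m n := by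
  classical
  set g := m.gcd n with hg
  set D := ⌊2 * (m.lcm n : ℝ) * max (ψ m) (ψ n)⌋₊ with hD
  set R : ℤ → Finset (ℕ × ℕ) := residuePairs g (m / g) (n / g) with hR
  have hmg : g * (m / g) = m := Nat.mul_div_cancel' (Nat.gcd_dvd_left m n)
  have hng : g * (n / g) = n := Nat.mul_div_cancel' (Nat.gcd_dvd_right m n)
  have hlcm : g * (m / g) * (n / g) = m.lcm n := by
    rw [hmg, Nat.lcm, Nat.mul_div_assoc _ (Nat.gcd_dvd_right m n)]
  have hpt : ∀ a ∈ reducedResidues m, ∀ b ∈ reducedResidues n, μ.real (B m a ∩ B n b) ≤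
      2 * min (ψ m) (ψ n) * (∑ c ∈ Finset.Icc 1 D, ((if (a, b) ∈ R (κ * c) then (1 : ℝ) else 0) +
        if (a, b) ∈ R (-κ * c) then 1 else 0) + if m = n ∧ a = b then 1 else 0) := by
    intro a ha b hb
    rw [mem_reducedResidues] at ha hb
    have hmin : 0 ≤ 2 * min (ψ m) (ψ n) := mul_nonneg zero_le_two (le_min hψm hψn)
    have hterm : ∀ c ∈ Finset.Icc 1 D, 0 ≤ ((if (a, b) ∈ R (κ * c) then (1 : ℝ) else 0) +
        if (a, b) ∈ R (-κ * c) then 1 else 0) := fun c _ => by positivity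
    rcases (B m a ∩ B n b).eq_empty_or_nonempty with he | hne
    · rw [he, measureReal_empty]
      refine mul_nonneg hmin (add_nonneg (Finset.sum_nonneg hterm) ?_)
      split_ifs <;> simp
    · have hle : μ.real (B m a ∩ B n b) ≤ 2 * min (ψ m) (ψ n) := by
        rw [mul_min_of_nonneg _ _ zero_le_two]
        exact le_min ((measureReal_mono Set.inter_subset_left).trans (hμm a))
          ((measureReal_mono Set.inter_subset_right).trans (hμn b))
      refine hle.trans (le_mul_of_one_le_right hmin ?_)
      rcases hsep a ha.1 ha.2 b hb.1 hb.2 hne with h | ⟨c, hc0, hcD, hdvd⟩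
      · rw [if_pos h]
        linarith [Finset.sum_nonneg hterm]
      · have h1 : c.natAbs ∈ Finset.Icc 1 D := by
          rw [Finset.mem_Icc]
          refine ⟨Int.natAbs_pos.2 hc0, Nat.le_floor ?_⟩
          rwa [Nat.cast_natAbs, Int.cast_abs]
        have h2 : (1 : ℝ) ≤ (if (a, b) ∈ R (κ * c.natAbs) then (1 : ℝ) else 0) +
            if (a, b) ∈ R (-κ * c.natAbs) then 1 else 0 := by
          have hmem : ∀ z : ℤ, z = κ * c → (a, b) ∈ R z := by
            rintro z rfl
            rw [hR, mem_residuePairs, hlcm, hmg, hng]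
            exact ⟨⟨ha.1, hb.1⟩, ha.2, hb.2, hdvd⟩
          rcases Int.natAbs_eq c with h | h
          · rw [if_pos (hmem _ (by rw [← h]))]
            have : (0 : ℝ) ≤ if (a, b) ∈ R (-κ * c.natAbs) then 1 else 0 := by positivity
            linarith
          · rw [if_pos (hmem (-κ * c.natAbs) (by rw [neg_mul, ← mul_neg, ← h]))]
            have : (0 : ℝ) ≤ if (a, b) ∈ R (κ * c.natAbs) then 1 else 0 := by positivity
            linarith
        have h3 := Finset.single_le_sum hterm h1
        have h4 : (0 : ℝ) ≤ if m = n ∧ a = b then 1 else 0 := by positivity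
        linarith
  rw [integral_ballSum_mul_ballSum μ hB]
  refine (Finset.sum_le_sum fun a ha => Finset.sum_le_sum fun b hb => hpt a ha b hb).trans ?_
  simp only [← Finset.mul_sum]
  unfold pairBound
  refine mul_le_mul_of_nonneg_left ?_ (mul_nonneg zero_le_two (le_min hψm hψn))
  simp only [Finset.sum_add_distrib]
  have hcard : ∀ z : ℤ, ∑ a ∈ reducedResidues m, ∑ b ∈ reducedResidues n,
      (if (a, b) ∈ R z then (1 : ℝ) else 0) ≤ (R z).card := by
    intro z
    rw [← Finset.sum_product' (f := fun a b => if (a, b) ∈ R z then (1 : ℝ) else 0),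
      Finset.sum_boole]
    exact_mod_cast Finset.card_le_card fun x hx => (Finset.mem_filter.1 hx).2
  have hswap : ∀ σ : ℤ, ∑ a ∈ reducedResidues m, ∑ b ∈ reducedResidues n, ∑ c ∈ Finset.Icc 1 D,
      (if (a, b) ∈ R (σ * c) then (1 : ℝ) else 0) ≤ ∑ c ∈ Finset.Icc 1 D, ((R (σ * c)).card : ℝ) := by
    intro σ
    have : ∀ a ∈ reducedResidues m, ∑ b ∈ reducedResidues n, ∑ c ∈ Finset.Icc 1 D,
        (if (a, b) ∈ R (σ * c) then (1 : ℝ) else 0) = ∑ c ∈ Finset.Icc 1 D,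
        ∑ b ∈ reducedResidues n, (if (a, b) ∈ R (σ * c) then (1 : ℝ) else 0) :=
      fun a _ => Finset.sum_comm
    rw [Finset.sum_congr rfl this, Finset.sum_comm]
    exact Finset.sum_le_sum fun c _ => hcard _
  refine add_le_add (add_le_add (hswap κ) (hswap (-κ))) ?_
  split_ifs with h
  · subst h
    simp only [true_and, Finset.sum_ite_eq, ← card_reducedResidues]
    rw [Finset.sum_congr rfl fun a ha => if_pos ha]
    simp
  · simp [h]

end BallSum

/-- A family of sets `B n a` of measure comparable to `ψ n`, to be thought of as balls around the
fractions `a / n`, which are equidistributed on the sets of `C` and well separated. -/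
structure IsBallSystem {X : Type*} [MeasurableSpace X] (μ : Measure X) (C : Set (Set X))
    (S : Set ℕ) (ψ : ℕ → ℝ) (δ : ℝ) (B : ℕ → ℕ → Set X) : Prop where
  measurableSet : ∀ n a, MeasurableSet (B n a)
  measureReal_le : ∀ n ∈ S, ∀ a, μ.real (B n a) ≤ 2 * ψ n
  le_measureReal : ∀ n ∈ S, ∀ a, δ * ψ n ≤ μ.real (B n a)
  separated : ∀ m ∈ S, ∀ n ∈ S, ∃ κ : ℤ, IsCoprime κ ((m.lcm n : ℕ) : ℤ) ∧
    ∀ a < m, a.Coprime m → ∀ b < n, b.Coprime n → (B m a ∩ B n b).Nonempty →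
      (m = n ∧ a = b) ∨ ∃ c : ℤ, c ≠ 0 ∧ (|c| : ℝ) ≤ 2 * (m.lcm n : ℝ) * max (ψ m) (ψ n) ∧
        ((m.lcm n : ℕ) : ℤ) ∣ (a * (n / m.gcd n : ℕ) - b * (m / m.gcd n : ℕ) : ℤ) - κ * c
  equidistributed : ∀ A ∈ C, Tendsto
    (fun n => (∫ x in A, ballSum B n x ∂μ) / ∫ x, ballSum B n x ∂μ) (atTop ⊓ 𝓟 S) (nhds (μ.real A))

theorem ae_infinite_of_isBallSystem {ι : Type*} [Fintype ι] (hι : 2 ≤ Fintype.card ι)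
    {X : ι → Type*} [mX : ∀ i, MeasurableSpace (X i)] (μ : ∀ i, Measure (X i))
    [∀ i, IsProbabilityMeasure (μ i)] {C : ∀ i, Set (Set (X i))} (hC : ∀ i, IsPiSystem (C i))
    (hgen : ∀ i, MeasurableSpace.generateFrom (C i) = mX i) (huniv : ∀ i, Set.univ ∈ C i)
    {S : Set ℕ} {ψ : ℕ → ℝ} (hS : ∀ n ∈ S, n ≠ 0 ∧ 0 < ψ n ∧ n.totient * ψ n ≤ 1) {δ : ℝ}
    (hδ : 0 < δ) {B : ∀ i, ℕ → ℕ → Set (X i)} (hB : ∀ i, IsBallSystem (μ i) (C i) S ψ δ (B i))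
    (hdiv : ¬ Summable (S.indicator fun n => (n.totient * ψ n) ^ Fintype.card ι)) :
    ∀ᵐ x ∂Measure.pi μ, {n | n ∈ S ∧ ∀ i, ∃ a < n, a.Coprime n ∧ x i ∈ B i n a}.Infinite := by
  classical
  set d := Fintype.card ι with hd
  set G : ℕ → (∀ i, X i) → ℝ := fun n x => if n ∈ S then ∏ i, ballSum (B i) n (x i) else 0 with hG
  set M : ι → ℕ → ℝ := fun i n => ∫ x, ballSum (B i) n x ∂μ i with hM
  set m : ℕ → ℝ := fun n => if n ∈ S then ∏ i, M i n else 0 with hm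
  have hMle : ∀ i, ∀ n ∈ S, δ * (n.totient * ψ n) ≤ M i n := by
    intro i n hn
    rw [hM]
    simp only
    rw [integral_ballSum _ (hB i).measurableSet]
    refine le_trans (le_of_eq ?_) (Finset.card_nsmul_le_sum _ _ _
      fun a _ => (hB i).le_measureReal n hn a)
    rw [card_reducedResidues, nsmul_eq_mul]
    ring
  have hx0 : ∀ n ∈ S, 0 < n.totient * ψ n := fun n hn =>
    mul_pos (by exact_mod_cast Nat.totient_pos.2 (Nat.pos_of_ne_zero (hS n hn).1)) (hS n hn).2.1
  have hMpos : ∀ i, ∀ n ∈ S, 0 < M i n := fun i n hn =>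
    (mul_pos hδ (hx0 n hn)).trans_le (hMle i n hn)
  have hm_le : ∀ n ∈ S, (n.totient * ψ n) ^ d ≤ (δ ^ d)⁻¹ * m n := by
    intro n hn
    rw [inv_mul_eq_div, le_div_iff₀ (by positivity), mul_comm, ← mul_pow, hm]
    simp only [if_pos hn]
    rw [hd, ← Finset.card_univ, ← Finset.prod_const]
    exact Finset.prod_le_prod (fun i _ => (mul_pos hδ (hx0 n hn)).le) fun i _ => hMle i n hn
  have hm0 : ∀ n, 0 ≤ m n := by
    intro n
    simp only [hm]
    split_ifs with h
    · exact Finset.prod_nonneg fun i _ => (hMpos i n h).le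
    · exact le_rfl
  have hG0 : ∀ n x, 0 ≤ G n x := by
    intro n x
    simp only [hG]
    split_ifs
    · exact Finset.prod_nonneg fun i _ => ballSum_nonneg n (x i)
    · exact le_rfl
  have hGm : ∀ n, Measurable (G n) := by
    intro n
    simp only [hG]
    split_ifs
    · exact Finset.measurable_fun_prod _ fun i _ =>
        (measurable_ballSum (hB i).measurableSet n).comp (measurable_pi_apply i)
    · exact measurable_const
  have hGb : ∀ n x, G n x ≤ n.totient ^ d := by
    intro n x
    simp only [hG]
    split_ifs
    · rw [hd, ← Finset.card_univ, ← Finset.prod_const]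
      exact Finset.prod_le_prod (fun i _ => ballSum_nonneg n (x i)) fun i _ => ballSum_le n (x i)
    · positivity
  have hset : ∀ (s : ∀ i, Set (X i)), ∀ n ∈ S, ∫ x in Set.univ.pi s, G n x ∂Measure.pi μ =
      ∏ i, ∫ x in s i, ballSum (B i) n x ∂μ i := by
    intro s n hn
    simp only [hG, if_pos hn]
    rw [Measure.restrict_pi_pi, integral_fintype_prod_eq_prod]
  obtain ⟨K, hK, hsecond⟩ := exists_sum_sum_le hι
  have hspan : ∀ i, IsCountablySpanning (C i) := fun i =>
    ⟨fun _ => Set.univ, fun _ => huniv i, Set.iUnion_const _⟩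
  have key := ae_frequently_ne_zero_of_second_moment (Measure.pi μ)
    (C := Set.univ.pi '' Set.univ.pi C) (IsPiSystem.pi hC) ?_ (G := G) (m := m)
    (K := K * (((δ ^ d)⁻¹) ^ 2 + (δ ^ d)⁻¹)) hG0 hGm (fun n => ⟨_, hGb n⟩) ?_ ?_ ?_ ?_
  · filter_upwards [key] with x hx
    refine hx.mono fun n hn => ?_
    have hnS : n ∈ S := by
      by_contra h
      exact hn (if_neg h)
    refine ⟨hnS, fun i => exists_mem_of_ballSum_ne_zero fun h0 => hn ?_⟩
    simp only [hG, if_pos hnS]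
    exact Finset.prod_eq_zero (Finset.mem_univ i) h0
  · exact (congrArg (@MeasurableSpace.pi ι X) (funext fun i => (hgen i).symm)).trans
      (generateFrom_pi_eq hspan)
  · intro n
    by_cases hn : n ∈ S
    · have := hset (fun _ => Set.univ) n hn
      simp only [Set.pi_univ, Measure.restrict_univ] at this
      rw [this]
      simp only [hm, if_pos hn, hM]
    · simp [hG, hm, hn]
  · rw [← not_summable_iff_tendsto_nat_atTop_of_nonneg hm0]
    refine fun hsum => hdiv ((hsum.mul_left (δ ^ d)⁻¹).of_nonneg_of_le ?_ ?_)
    · exact fun n => Set.indicator_nonneg (fun n hn => pow_nonneg (hx0 n hn).le _) n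
    · intro n
      by_cases hn : n ∈ S
      · rw [Set.indicator_of_mem hn]
        exact hm_le n hn
      · rw [Set.indicator_of_notMem hn]
        exact mul_nonneg (by positivity) (hm0 n)
  · rintro _ ⟨s, hs, rfl⟩
    have htend : Tendsto (fun n => ∏ i, ((∫ x in s i, ballSum (B i) n x ∂μ i) / M i n))
        (atTop ⊓ 𝓟 S) (nhds (∏ i, (μ i).real (s i))) :=
      tendsto_finsetProd _ fun i _ => (hB i).equidistributed (s i) (hs i (Set.mem_univ i))
    have hreal : (Measure.pi μ).real (Set.univ.pi s) = ∏ i, (μ i).real (s i) := by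
      simp only [measureReal_def, Measure.pi_pi, ENNReal.toReal_prod]
    rw [Asymptotics.isLittleO_iff]
    intro ε hε
    have hev := Metric.tendsto_nhds.1 htend ε hε
    rw [eventually_inf_principal] at hev
    filter_upwards [hev] with n hn
    by_cases hnS : n ∈ S
    · have hn := hn hnS
      rw [Real.dist_eq, Finset.prod_div_distrib] at hn
      have hmn : m n = ∏ i, M i n := if_pos hnS
      have hmpos : 0 < m n := by
        rw [hmn]; exact Finset.prod_pos fun i _ => hMpos i n hnS
      rw [hset s n hnS, hreal, Real.norm_eq_abs, Real.norm_eq_abs, abs_of_pos hmpos]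
      rw [← hmn] at hn
      calc |(∏ i, ∫ x in s i, ballSum (B i) n x ∂μ i) - (∏ i, (μ i).real (s i)) * m n|
          = |(∏ i, ∫ x in s i, ballSum (B i) n x ∂μ i) / m n - ∏ i, (μ i).real (s i)| * m n := by
            rw [← abs_of_pos hmpos, ← abs_mul, abs_of_pos hmpos, sub_mul, div_mul_cancel₀ _ hmpos.ne']
        _ ≤ ε * m n := by gcongr
    · simp [hG, hm, hnS]
  · intro N
    set s := (Finset.range N).filter (· ∈ S) with hs
    have hsS : ∀ n ∈ s, n ∈ S := fun n hn => (Finset.mem_filter.1 hn).2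
    have hprodInt : ∀ a b, Integrable (fun x => G a x * G b x) (Measure.pi μ) := by
      intro a b
      refine Integrable.of_bound ((hGm a).mul (hGm b)).aestronglyMeasurable
        (a.totient ^ d * b.totient ^ d) (ae_of_all _ fun x => ?_)
      rw [Real.norm_eq_abs, abs_of_nonneg (mul_nonneg (hG0 a x) (hG0 b x))]
      exact mul_le_mul (hGb a x) (hGb b x) (hG0 b x) (by positivity)
    have hsumG : ∀ x, ∑ n ∈ Finset.range N, G n x = ∑ n ∈ s, G n x := by
      intro x
      rw [hs, Finset.sum_filter]
      refine Finset.sum_congr rfl fun n _ => ?_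
      simp only [hG]
      split_ifs <;> rfl
    have hsumm : ∑ n ∈ Finset.range N, m n = ∑ n ∈ s, m n := by
      rw [hs, Finset.sum_filter]
      refine Finset.sum_congr rfl fun n _ => ?_
      simp only [hm]
      split_ifs <;> rfl
    have hexp : ∫ x, (∑ n ∈ Finset.range N, G n x) ^ 2 ∂Measure.pi μ =
        ∑ a ∈ s, ∑ b ∈ s, ∫ x, G a x * G b x ∂Measure.pi μ := by
      simp only [hsumG, sq, Finset.sum_mul_sum]
      rw [integral_finsetSum _ fun a _ => integrable_finsetSum _ fun b _ => hprodInt a b]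
      exact Finset.sum_congr rfl fun a _ => integral_finsetSum _ fun b _ => hprodInt a b
    have hbound := hsecond s ψ (fun n hn => hS n (hsS n hn))
      (fun a b => ∫ x, G a x * G b x ∂Measure.pi μ)
      (fun i a b => ∫ x, ballSum (B i) a x * ballSum (B i) b x ∂μ i)
      (fun a b => by simp only [mul_comm]) ?_ ?_ ?_
    · rw [hexp, hsumm]
      refine hbound.trans ?_
      set E := (δ ^ d)⁻¹ with hE
      have hE0 : 0 ≤ E := by positivity
      have hle : ∑ n ∈ s, ((n.totient : ℝ) * ψ n) ^ d ≤ E * ∑ n ∈ s, m n := by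
        rw [Finset.mul_sum]
        exact Finset.sum_le_sum fun n hn => hm_le n (hsS n hn)
      have hnn : 0 ≤ ∑ n ∈ s, ((n.totient : ℝ) * ψ n) ^ d :=
        Finset.sum_nonneg fun n hn => pow_nonneg (hx0 n (hsS n hn)).le _
      have hmm : 0 ≤ ∑ n ∈ s, m n := Finset.sum_nonneg fun n _ => hm0 n
      calc K * ((∑ n ∈ s, ((n.totient : ℝ) * ψ n) ^ d) ^ 2 + ∑ n ∈ s, ((n.totient : ℝ) * ψ n) ^ d)
          ≤ K * ((E * ∑ n ∈ s, m n) ^ 2 + E * ∑ n ∈ s, m n) := by gcongr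
        _ ≤ K * ((E * ∑ n ∈ s, m n) ^ 2 + E * ∑ n ∈ s, m n) +
            K * (E * (∑ n ∈ s, m n) ^ 2 + E ^ 2 * ∑ n ∈ s, m n) :=
          le_add_of_nonneg_right (by positivity)
        _ = _ := by ring
    · intro a ha b hb
      simp only [hG, if_pos (hsS a ha), if_pos (hsS b hb), ← Finset.prod_mul_distrib]
      exact (integral_fintype_prod_eq_prod
        (fun i (x : X i) => ballSum (B i) a x * ballSum (B i) b x)).le
    · exact fun i a _ b _ => integral_nonneg fun x =>
        mul_nonneg (ballSum_nonneg a x) (ballSum_nonneg b x)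
    · intro i a ha b hb
      obtain ⟨κ, hκ, hsep⟩ := (hB i).separated a (hsS a ha) b (hsS b hb)
      exact ⟨κ, hκ, integral_ballSum_mul_ballSum_le (μ i) (hB i).measurableSet
        (hS a (hsS a ha)).2.1.le (hS b (hsS b hb)).2.1.le ((hB i).measureReal_le a (hsS a ha))
        ((hB i).measureReal_le b (hsS b hb)) hsep⟩

theorem sum_divisors_moebius_filter_dvd {n : ℕ} (hn : n ≠ 0) (a : ℕ) :
    ∑ d ∈ n.divisors with d ∣ a, ArithmeticFunction.moebius d = if a.Coprime n then 1 else 0 := by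
  have h : n.divisors.filter (· ∣ a) = (a.gcd n).divisors := by
    ext d
    have : a.gcd n ≠ 0 := fun h => hn (Nat.eq_zero_of_gcd_eq_zero_right h)
    simp [Nat.dvd_gcd_iff, hn, and_comm]
  rw [h, ← ArithmeticFunction.coe_mul_zeta_apply, ArithmeticFunction.moebius_mul_coe_zeta,
    ArithmeticFunction.one_apply]

theorem card_filter_reducedResidues {n : ℕ} (hn : n ≠ 0) (p : ℕ → Prop) [DecidablePred p] :
    (((reducedResidues n).filter p).card : ℤ) = ∑ d ∈ n.divisors, ArithmeticFunction.moebius d *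
      ((Finset.range n).filter fun a => d ∣ a ∧ p a).card := by
  have h : ∀ d ∈ n.divisors, ArithmeticFunction.moebius d *
      (((Finset.range n).filter fun a => d ∣ a ∧ p a).card : ℤ) =
      ∑ a ∈ (Finset.range n).filter p, if d ∣ a then ArithmeticFunction.moebius d else 0 := by
    intro d _
    rw [← Finset.sum_filter, Finset.filter_filter, Finset.sum_const, nsmul_eq_mul, mul_comm]
    simp only [and_comm]
  rw [Finset.sum_congr rfl h, Finset.sum_comm]
  simp only [← Finset.sum_filter, sum_divisors_moebius_filter_dvd hn]
  rw [reducedResidues, Finset.filter_comm, Finset.sum_const, nsmul_one]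

theorem card_filter_range_dvd {n d : ℕ} (hd : d ∣ n) (hn : n ≠ 0) :
    ((Finset.range n).filter (d ∣ ·)).card = n / d := by
  obtain ⟨e, rfl⟩ := hd
  have hd0 : 0 < d := Nat.pos_of_ne_zero (left_ne_zero_of_mul hn)
  rw [Nat.mul_div_cancel_left _ hd0]
  have : (Finset.range (d * e)).filter (d ∣ ·) = (Finset.range e).image (d * ·) := by
    ext a
    simp only [Finset.mem_filter, Finset.mem_range, Finset.mem_image]
    constructor
    · rintro ⟨h, b, rfl⟩
      exact ⟨b, Nat.lt_of_mul_lt_mul_left h, rfl⟩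
    · rintro ⟨b, hb, rfl⟩
      exact ⟨Nat.mul_lt_mul_of_pos_left hb hd0, dvd_mul_right d b⟩
  rw [this, Finset.card_image_of_injective _ (fun a b h => Nat.eq_of_mul_eq_mul_left hd0 h), Finset.card_range]

theorem abs_card_filter_reducedResidues_sub_le {n : ℕ} (hn : n ≠ 0) (p : ℕ → Prop)
    [DecidablePred p] {θ C : ℝ} (h : ∀ d, d ∣ n →
      |(((Finset.range n).filter fun a => d ∣ a ∧ p a).card : ℝ) - θ * (n / d : ℕ)| ≤ C) :
    |(((reducedResidues n).filter p).card : ℝ) - θ * n.totient| ≤ C * n.divisors.card := by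
  have h1 : (((reducedResidues n).filter p).card : ℝ) = ∑ d ∈ n.divisors,
      (ArithmeticFunction.moebius d : ℝ) *
      ((Finset.range n).filter fun a => d ∣ a ∧ p a).card := by
    exact_mod_cast card_filter_reducedResidues hn p
  have h2 : (n.totient : ℝ) = ∑ d ∈ n.divisors,
      (ArithmeticFunction.moebius d : ℝ) * (n / d : ℕ) := by
    have := card_filter_reducedResidues hn fun _ => True
    simp only [Finset.filter_true, card_reducedResidues, and_true] at this
    have h3 : (n.totient : ℤ) = ∑ d ∈ n.divisors,
        ArithmeticFunction.moebius d * ((n / d : ℕ) : ℤ) := by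
      rw [this]
      refine Finset.sum_congr rfl fun d hd => ?_
      rw [card_filter_range_dvd (Nat.dvd_of_mem_divisors hd) hn]
    simpa only [Int.cast_natCast, Int.cast_sum, Int.cast_mul] using congrArg (Int.cast : ℤ → ℝ) h3
  rw [h1, h2, Finset.mul_sum, ← Finset.sum_sub_distrib]
  refine (Finset.abs_sum_le_sum_abs _ _).trans ?_
  rw [mul_comm, ← nsmul_eq_mul]
  refine Finset.sum_le_card_nsmul _ _ _ fun d hd => ?_
  have hμ : |(ArithmeticFunction.moebius d : ℝ)| ≤ 1 := by
    exact_mod_cast ArithmeticFunction.abs_moebius_le_one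
  rw [mul_left_comm, ← mul_sub, abs_mul]
  exact (mul_le_of_le_one_left (abs_nonneg _) hμ).trans (h d (Nat.dvd_of_mem_divisors hd))

theorem card_divisors_le_two_mul_sqrt (n : ℕ) : (n.divisors.card : ℝ) ≤ 2 * √n := by
  rcases Nat.eq_zero_or_pos n with rfl | hn
  · simp
  have hsub : n.divisors ⊆ Finset.Icc 1 n.sqrt ∪ (Finset.Icc 1 n.sqrt).image (n / ·) := by
    intro d hd
    obtain ⟨e, he⟩ := Nat.dvd_of_mem_divisors hd
    have hd0 : 0 < d := Nat.pos_of_mem_divisors hd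
    have he0 : 0 < e := by
      rcases Nat.eq_zero_or_pos e with rfl | h
      · simp at he; omega
      · exact h
    rw [Finset.mem_union, Finset.mem_image]
    rcases le_total d e with h | h
    · left
      rw [Finset.mem_Icc, Nat.le_sqrt]
      exact ⟨hd0, by rw [he]; exact Nat.mul_le_mul_left d h⟩
    · right
      refine ⟨e, ?_, by rw [he, Nat.mul_div_cancel _ he0]⟩
      rw [Finset.mem_Icc, Nat.le_sqrt]
      exact ⟨he0, by rw [he]; exact Nat.mul_le_mul_right e h⟩
  have h1 : n.divisors.card ≤ 2 * n.sqrt := by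
    refine (Finset.card_le_card hsub).trans ((Finset.card_union_le _ _).trans ?_)
    have := Finset.card_image_le (s := Finset.Icc 1 n.sqrt) (f := (n / ·))
    rw [Nat.card_Icc] at *
    omega
  calc (n.divisors.card : ℝ) ≤ (2 * n.sqrt : ℕ) := by exact_mod_cast h1
    _ = 2 * (n.sqrt : ℝ) := by push_cast; rfl
    _ ≤ 2 * √n := by gcongr; exact Real.nat_sqrt_le_real_sqrt

theorem le_mul_log_mul_totient {n : ℕ} (hn : n ≠ 0) :
    (n : ℝ) ≤ Real.exp 2 * (Nat.log 2 n + 1 : ℕ) * n.totient := by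
  refine le_mul_totient (by omega) ?_
  have h1 : n.primeFactors.card ≤ Nat.log 2 n := by
    refine Nat.le_log_of_pow_le (by norm_num) ?_
    calc 2 ^ n.primeFactors.card ≤ ∏ q ∈ n.primeFactors, q :=
          Finset.pow_card_le_prod _ _ _ fun q hq => (Nat.prime_of_mem_primeFactors hq).two_le
      _ ≤ n := Nat.le_of_dvd (Nat.pos_of_ne_zero hn) (Nat.prod_primeFactors_dvd n)
  calc ∑ q ∈ n.primeFactors.filter (Nat.log 2 n + 1 < ·), 1 / (q : ℝ)
      ≤ (n.primeFactors.filter (Nat.log 2 n + 1 < ·)).card • (1 / (Nat.log 2 n + 1 : ℝ)) := by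
        refine Finset.sum_le_card_nsmul _ _ _ fun q hq => ?_
        gcongr
        exact_mod_cast (Finset.mem_filter.1 hq).2.le
    _ ≤ (Nat.log 2 n + 1 : ℝ) * (1 / (Nat.log 2 n + 1 : ℝ)) := by
        rw [nsmul_eq_mul]
        gcongr
        exact_mod_cast (Finset.card_filter_le _ _).trans (h1.trans (Nat.le_succ _))
    _ = 1 := by field_simp

theorem tendsto_card_divisors_div_totient :
    Tendsto (fun n : ℕ => (n.divisors.card : ℝ) / n.totient) atTop (nhds 0) := by
  have h1 : Tendsto (fun n : ℕ => 2 * Real.exp 2 * ((Real.log 2)⁻¹ *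
      (Real.log n / (n : ℝ) ^ (1 / 2 : ℝ)) + 1 / (n : ℝ) ^ (1 / 2 : ℝ))) atTop (nhds 0) := by
    have ha : Tendsto (fun x : ℝ => Real.log x / x ^ (1 / 2 : ℝ)) atTop (nhds 0) :=
      (isLittleO_log_rpow_atTop (by norm_num)).tendsto_div_nhds_zero
    have hb : Tendsto (fun x : ℝ => 1 / x ^ (1 / 2 : ℝ)) atTop (nhds 0) := by
      simp only [one_div (_ ^ _)]
      exact (tendsto_rpow_atTop (by norm_num : (0 : ℝ) < 1 / 2)).inv_tendsto_atTop
    have hc := (((ha.const_mul (Real.log 2)⁻¹).add hb).const_mul (2 * Real.exp 2)).comp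
      (tendsto_natCast_atTop_atTop (R := ℝ))
    simp only [mul_zero, add_zero] at hc
    exact hc
  refine tendsto_of_tendsto_of_tendsto_of_le_of_le' tendsto_const_nhds h1
    (Eventually.of_forall fun n => by positivity) ?_
  filter_upwards [eventually_gt_atTop 0] with n hn
  have hφ : (0 : ℝ) < n.totient := by exact_mod_cast Nat.totient_pos.2 hn
  have hn' : (0 : ℝ) < n := by exact_mod_cast hn
  have hs : (0 : ℝ) < √n := Real.sqrt_pos.2 hn'
  rw [← Real.sqrt_eq_rpow, div_le_iff₀ hφ]
  have h2 := card_divisors_le_two_mul_sqrt n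
  have h3 := le_mul_log_mul_totient hn.ne'
  have h4 : ((Nat.log 2 n + 1 : ℕ) : ℝ) ≤ (Real.log 2)⁻¹ * Real.log n + 1 := by
    push_cast
    have := Real.natLog_le_logb n 2
    rw [Real.logb, div_eq_inv_mul] at this
    push_cast at this
    linarith
  calc (n.divisors.card : ℝ) ≤ 2 * √n := h2
    _ = 2 * (n / √n) := by rw [Real.div_sqrt]
    _ ≤ 2 * ((Real.exp 2 * ((Real.log 2)⁻¹ * Real.log n + 1) * n.totient) / √n) := by
        gcongr
        exact h3.trans (by gcongr)
    _ = _ := by ring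

theorem tendsto_card_filter_div_totient {l : Filter ℕ} (hl : l ≤ atTop) (p : ℕ → ℕ → Prop)
    [∀ n, DecidablePred (p n)] {θ : ℕ → ℝ} {θ₀ C : ℝ} (hθ : Tendsto θ l (nhds θ₀))
    (h : ∀ᶠ n in l, ∀ d, d ∣ n →
      |(((Finset.range n).filter fun a => d ∣ a ∧ p n a).card : ℝ) - θ n * (n / d : ℕ)| ≤ C) :
    Tendsto (fun n => (((reducedResidues n).filter (p n)).card : ℝ) / n.totient) l (nhds θ₀) := by
  have h0 : Tendsto (fun n => (((reducedResidues n).filter (p n)).card : ℝ) / n.totient - θ n) l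
      (nhds 0) := by
    refine squeeze_zero_norm' ?_
      (by simpa using (tendsto_card_divisors_div_totient.mono_left hl).const_mul C)
    filter_upwards [h, hl (eventually_gt_atTop 0)] with n hn hn0
    have hφ : (0 : ℝ) < n.totient := by exact_mod_cast Nat.totient_pos.2 hn0
    rw [Real.norm_eq_abs, div_sub' hφ.ne', abs_div, abs_of_pos hφ, ← mul_div_assoc, mul_comm _ (θ n)]
    gcongr
    exact abs_card_filter_reducedResidues_sub_le hn0.ne' (p n) hn
  simpa using h0.add hθ

theorem card_filter_range_dvd_and {n d : ℕ} (hd : d ∣ n) (hn : n ≠ 0) (p : ℕ → Prop)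
    [DecidablePred p] : ((Finset.range n).filter fun a => d ∣ a ∧ p a).card =
      ((Finset.range (n / d)).filter fun b => p (d * b)).card := by
  obtain ⟨e, rfl⟩ := hd
  have hd0 : 0 < d := Nat.pos_of_ne_zero (left_ne_zero_of_mul hn)
  rw [Nat.mul_div_cancel_left _ hd0]
  have : (Finset.range (d * e)).filter (fun a => d ∣ a ∧ p a) =
      ((Finset.range e).filter fun b => p (d * b)).image (d * ·) := by
    ext a
    simp only [Finset.mem_filter, Finset.mem_range, Finset.mem_image]
    constructor
    · rintro ⟨h, ⟨b, rfl⟩, h2⟩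
      exact ⟨b, ⟨Nat.lt_of_mul_lt_mul_left h, h2⟩, rfl⟩
    · rintro ⟨b, ⟨hb, h2⟩, rfl⟩
      exact ⟨Nat.mul_lt_mul_of_pos_left hb hd0, dvd_mul_right d b, h2⟩
  rw [this, Finset.card_image_of_injective _ (fun a b h => Nat.eq_of_mul_eq_mul_left hd0 h)]

theorem abs_card_filter_range_natCast_eq_sub_le {q : ℕ} [NeZero q] (N : ℕ) (w : ZMod q) :
    |(((Finset.range N).filter fun b : ℕ => (b : ZMod q) = w).card : ℝ) - (q : ℝ)⁻¹ * N| ≤ 1 := by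
  have hq : 0 < q := Nat.pos_of_ne_zero (NeZero.ne q)
  have h1 : ((Finset.range N).filter fun b : ℕ => (b : ZMod q) = w).card =
      N / q + if w.val % q < N % q then 1 else 0 := by
    rw [← Nat.count_modEq_card N hq w.val, Nat.count_eq_card_filter_range]
    congr 1
    refine Finset.filter_congr fun b _ => ?_
    rw [← ZMod.natCast_eq_natCast_iff, ZMod.natCast_zmod_val]
  have h2 : (N : ℝ) = q * (N / q : ℕ) + (N % q : ℕ) := by exact_mod_cast (Nat.div_add_mod N q).symm
  have hq' : (0 : ℝ) < q := by exact_mod_cast hq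
  have h3 : ((N % q : ℕ) : ℝ) ≤ q := by exact_mod_cast (Nat.mod_lt N hq).le
  have h4 : (q : ℝ)⁻¹ * N = (N / q : ℕ) + (q : ℝ)⁻¹ * (N % q : ℕ) := by
    conv_lhs => rw [h2, mul_add, inv_mul_cancel_left₀ hq'.ne']
  have h5 : (q : ℝ)⁻¹ * (N % q : ℕ) ≤ 1 := by
    rw [inv_mul_le_iff₀ hq', mul_one]; exact h3
  have h6 : 0 ≤ (q : ℝ)⁻¹ * (N % q : ℕ) := by positivity
  rw [h1, h4, abs_le]
  push_cast
  split_ifs <;> constructor <;> linarith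

theorem tendsto_card_filter_natCast_eq_mul {q : ℕ} [NeZero q] {S : Set ℕ}
    (hS : ∀ n ∈ S, n ≠ 0 ∧ n.Coprime q) (z : ZMod q) :
    Tendsto (fun n : ℕ => (((reducedResidues n).filter fun a : ℕ => (a : ZMod q) = z * n).card : ℝ) /
      n.totient) (atTop ⊓ 𝓟 S) (nhds (q : ℝ)⁻¹) := by
  refine tendsto_card_filter_div_totient inf_le_left (fun n a : ℕ => (a : ZMod q) = z * n)
    (θ := fun _ => (q : ℝ)⁻¹) (C := 1) tendsto_const_nhds ?_
  rw [eventually_inf_principal]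
  refine Eventually.of_forall fun n hnS d hd => ?_
  rw [card_filter_range_dvd_and hd (hS n hnS).1]
  have hu : (d : ZMod q) * (d : ZMod q)⁻¹ = 1 :=
    ZMod.coe_mul_inv_eq_one d ((hS n hnS).2.coprime_dvd_left hd)
  have h2 : ∀ b : ℕ, ((d * b : ℕ) : ZMod q) = z * n ↔ (b : ZMod q) = (d : ZMod q)⁻¹ * (z * n) := by
    intro b
    push_cast
    constructor
    · intro h
      rw [← h, ← mul_assoc, mul_comm _ (d : ZMod q), hu, one_mul]
    · intro h
      rw [h, ← mul_assoc, hu, one_mul]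
  simp only [h2]
  exact abs_card_filter_range_natCast_eq_sub_le (n / d) _

section Padic

variable {p : ℕ} [hp : Fact p.Prime]

/-- The coset of `p ^ s ℤ_[p]` consisting of the `x` with residue `z`. -/
def padicCoset (p : ℕ) [Fact p.Prime] (s : ℕ) (z : ZMod (p ^ s)) : Set ℤ_[p] :=
  (PadicInt.toZModPow s) ⁻¹' {z}

theorem mem_padicCoset {s : ℕ} {z : ZMod (p ^ s)} {x : ℤ_[p]} :
    x ∈ padicCoset p s z ↔ PadicInt.toZModPow s x = z := Iff.rfl

theorem toZModPow_eq_iff_norm_sub_le {s : ℕ} {x y : ℤ_[p]} :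
    PadicInt.toZModPow s x = PadicInt.toZModPow s y ↔ ‖x - y‖ ≤ (p : ℝ) ^ (-s : ℤ) := by
  rw [PadicInt.norm_le_pow_iff_mem_span_pow, ← PadicInt.ker_toZModPow, RingHom.mem_ker, map_sub,
    sub_eq_zero]

theorem isOpen_padicCoset (s : ℕ) (z : ZMod (p ^ s)) : IsOpen (padicCoset p s z) := by
  have hp0 : (0 : ℝ) < p := by exact_mod_cast hp.out.pos
  refine Metric.isOpen_iff.2 fun x hx => ⟨(p : ℝ) ^ (-s : ℤ), by positivity, fun y hy => ?_⟩
  rw [mem_padicCoset] at hx ⊢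
  rw [← hx, toZModPow_eq_iff_norm_sub_le]
  exact (mem_ball_iff_norm.1 hy).le

theorem padicCoset_nonempty (s : ℕ) (z : ZMod (p ^ s)) : (padicCoset p s z).Nonempty :=
  ⟨(z.val : ℤ_[p]), by
    have : NeZero (p ^ s) := ⟨pow_ne_zero _ hp.out.ne_zero⟩
    rw [mem_padicCoset, map_natCast, ZMod.natCast_zmod_val]⟩

/-- The collection of all balls of `ℤ_[p]`. -/
def padicCosets (p : ℕ) [Fact p.Prime] : Set (Set ℤ_[p]) :=
  Set.range fun y : Σ s, ZMod (p ^ s) => padicCoset p y.1 y.2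

theorem padicCoset_subset {s t : ℕ} (hst : s ≤ t) (x : ℤ_[p]) :
    padicCoset p t (PadicInt.toZModPow t x) ⊆ padicCoset p s (PadicInt.toZModPow s x) := by
  intro y hy
  rw [mem_padicCoset] at hy ⊢
  rw [← PadicInt.cast_toZModPow s t hst, hy, PadicInt.cast_toZModPow s t hst]

theorem isPiSystem_padicCosets : IsPiSystem (padicCosets p) := by
  rintro _ ⟨⟨s, z⟩, rfl⟩ _ ⟨⟨t, w⟩, rfl⟩ ⟨x, hx, hy⟩
  simp only [mem_padicCoset] at hx hy
  subst hx hy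
  rcases le_total s t with h | h
  · exact ⟨⟨t, _⟩, (Set.inter_eq_right.2 (padicCoset_subset h x)).symm⟩
  · exact ⟨⟨s, _⟩, (Set.inter_eq_left.2 (padicCoset_subset h x)).symm⟩

theorem univ_mem_padicCosets : Set.univ ∈ padicCosets p := by
  refine ⟨⟨0, 0⟩, Set.eq_univ_of_forall fun x => ?_⟩
  have : Subsingleton (ZMod (p ^ 0)) := by
    rw [pow_zero]; infer_instance
  exact Subsingleton.elim _ _

theorem generateFrom_padicCosets [mX : MeasurableSpace ℤ_[p]] [BorelSpace ℤ_[p]] :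
    MeasurableSpace.generateFrom (padicCosets p) = mX := by
  have hp1 : (1 : ℝ) < p := by exact_mod_cast hp.out.one_lt
  rw [BorelSpace.measurable_eq (α := ℤ_[p])]
  refine (TopologicalSpace.IsTopologicalBasis.borel_eq_generateFrom ?_).symm
  refine TopologicalSpace.isTopologicalBasis_of_isOpen_of_nhds ?_ fun x U hx hU => ?_
  · rintro _ ⟨y, rfl⟩
    exact isOpen_padicCoset _ _
  · obtain ⟨ε, hε, hU⟩ := Metric.isOpen_iff.1 hU x hx
    obtain ⟨s, hs⟩ := PadicInt.exists_pow_neg_lt p hε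
    refine ⟨_, ⟨⟨s, PadicInt.toZModPow s x⟩, rfl⟩, mem_padicCoset.2 rfl, fun y hy => hU ?_⟩
    rw [mem_ball_iff_norm]
    exact (toZModPow_eq_iff_norm_sub_le.1 hy).trans_lt hs

/-- The `p`-adic ball of radius `p ^ (-r n)` about `a / n`, when `p` does not divide `n`. -/
def padicBall (p : ℕ) [Fact p.Prime] (r : ℕ → ℕ) (n a : ℕ) : Set ℤ_[p] :=
  {x | PadicInt.toZModPow (r n) (x * (n : ℤ_[p])) = (a : ZMod (p ^ r n))}

theorem padicBall_eq {r : ℕ → ℕ} {n : ℕ} (hn : ¬ p ∣ n) (a : ℕ) :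
    padicBall p r n a = padicCoset p (r n) (a * (n : ZMod (p ^ r n))⁻¹) := by
  have hu : (n : ZMod (p ^ r n)) * (n : ZMod (p ^ r n))⁻¹ = 1 :=
    ZMod.coe_mul_inv_eq_one n (((Nat.Prime.coprime_iff_not_dvd hp.out).2 hn).symm.pow_right _)
  ext x
  rw [mem_padicCoset, padicBall, Set.mem_ofPred_eq, map_mul, map_natCast]
  constructor
  · intro h
    rw [← h, mul_assoc, hu, mul_one]
  · intro h
    rw [h, mul_assoc, mul_comm _ (n : ZMod (p ^ r n)), hu, mul_one]

theorem padicBall_inter_padicCoset {r : ℕ → ℕ} {n s : ℕ} (hn : ¬ p ∣ n) (hs : s ≤ r n) (a : ℕ)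
    (z : ZMod (p ^ s)) : padicBall p r n a ∩ padicCoset p s z =
      if (a : ZMod (p ^ s)) = z * n then padicBall p r n a else ∅ := by
  have hu : (n : ZMod (p ^ s)) * (n : ZMod (p ^ s))⁻¹ = 1 :=
    ZMod.coe_mul_inv_eq_one n (((Nat.Prime.coprime_iff_not_dvd hp.out).2 hn).symm.pow_right _)
  have h : ∀ x ∈ padicBall p r n a, PadicInt.toZModPow s x * n = a := by
    intro x hx
    rw [← map_natCast (PadicInt.toZModPow (p := p) s) n, ← map_mul,
      ← PadicInt.cast_toZModPow s (r n) hs, (hx : PadicInt.toZModPow (r n) _ = _),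
      ZMod.cast_natCast (pow_dvd_pow p hs)]
  split_ifs with ha
  · refine Set.inter_eq_left.2 fun x hx => ?_
    rw [mem_padicCoset, ← mul_one (PadicInt.toZModPow s x), ← mul_one z, ← hu, ← mul_assoc,
      ← mul_assoc, h x hx, ha]
  · refine Set.eq_empty_of_forall_notMem fun x ⟨hx, hx'⟩ => ha ?_
    rw [← h x hx, mem_padicCoset.1 hx']

theorem dvd_sub_of_mem_padicBall {r : ℕ → ℕ} {m n a b s : ℕ} {x : ℤ_[p]} (hsm : s ≤ r m)
    (hsn : s ≤ r n) (hm : x ∈ padicBall p r m a) (hn : x ∈ padicBall p r n b) :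
    ((p ^ s : ℕ) : ℤ) ∣ a * n - b * m := by
  have h : ∀ n a, s ≤ r n → x ∈ padicBall p r n a →
      PadicInt.toZModPow s x * n = (a : ZMod (p ^ s)) := by
    intro n a hs hx
    rw [← map_natCast (PadicInt.toZModPow (p := p) s) n, ← map_mul,
      ← PadicInt.cast_toZModPow s (r n) hs, (hx : PadicInt.toZModPow (r n) _ = _),
      ZMod.cast_natCast (pow_dvd_pow p hs)]
  rw [← ZMod.intCast_zmod_eq_zero_iff_dvd]
  push_cast
  rw [← h m a hsm hm, ← h n b hsn hn]
  ring

variable [MeasurableSpace ℤ_[p]] [BorelSpace ℤ_[p]] (μ : Measure ℤ_[p]) [μ.IsAddHaarMeasure]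
  [IsProbabilityMeasure μ]

theorem measurableSet_padicCoset (s : ℕ) (z : ZMod (p ^ s)) : MeasurableSet (padicCoset p s z) :=
  (isOpen_padicCoset s z).measurableSet

theorem measureReal_padicCoset (s : ℕ) (z : ZMod (p ^ s)) :
    μ.real (padicCoset p s z) = ((p : ℝ) ^ s)⁻¹ := by
  have : NeZero (p ^ s) := ⟨pow_ne_zero _ hp.out.ne_zero⟩
  have h0 : ∀ w, μ.real (padicCoset p s w) = μ.real (padicCoset p s 0) := by
    intro w
    obtain ⟨y, hy⟩ := padicCoset_nonempty s w
    rw [measureReal_def, measureReal_def, ← measure_preimage_add μ (-y) (padicCoset p s 0)]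
    congr 2
    ext x
    rw [Set.mem_preimage, mem_padicCoset, mem_padicCoset, map_add, map_neg, mem_padicCoset.1 hy,
      neg_add_eq_zero, eq_comm]
  have h1 : ∑ w : ZMod (p ^ s), μ.real (padicCoset p s w) = 1 := by
    have := sum_measureReal_preimage_singleton (μ := μ) (f := PadicInt.toZModPow (p := p) s)
      Finset.univ fun w _ => measurableSet_padicCoset s w
    rw [Finset.coe_univ, Set.preimage_univ, probReal_univ] at this
    exact this
  rw [h0]
  simp only [h0, Finset.sum_const, Finset.card_univ, ZMod.card, nsmul_eq_mul] at h1
  push_cast at h1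
  exact eq_inv_of_mul_eq_one_right h1

theorem measurableSet_padicBall (r : ℕ → ℕ) (n a : ℕ) : MeasurableSet (padicBall p r n a) :=
  (measurableSet_padicCoset (r n) (a : ZMod (p ^ r n))).preimage (continuous_mul_const _).measurable

theorem isBallSystem_padic {S : Set ℕ} {ψ : ℕ → ℝ} {r : ℕ → ℕ} {δ : ℝ}
    (hS : ∀ n ∈ S, n ≠ 0 ∧ ¬ p ∣ n) (hr : ∀ n ∈ S, ((p : ℝ) ^ r n)⁻¹ ≤ ψ n)
    (hr' : ∀ n ∈ S, δ * ψ n ≤ ((p : ℝ) ^ r n)⁻¹) (hψ : Tendsto ψ (atTop ⊓ 𝓟 S) (nhds 0)) :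
    IsBallSystem μ (padicCosets p) S ψ δ (padicBall p r) := by
  have hp1 : (1 : ℝ) < p := by exact_mod_cast hp.out.one_lt
  have hp0 : (0 : ℝ) < p := zero_lt_one.trans hp1
  have hμ : ∀ n ∈ S, ∀ a, μ.real (padicBall p r n a) = ((p : ℝ) ^ r n)⁻¹ := fun n hn a => by
    rw [padicBall_eq (hS n hn).2, measureReal_padicCoset]
  refine ⟨measurableSet_padicBall r, fun n hn a => ?_, fun n hn a => ?_, fun m hm n hn => ?_, ?_⟩
  · rw [hμ n hn]
    have := hr n hn
    have : 0 ≤ ((p : ℝ) ^ r n)⁻¹ := by positivity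
    linarith
  · rw [hμ n hn]
    exact hr' n hn
  · obtain ⟨hm0, hpm⟩ := hS m hm
    obtain ⟨hn0, hpn⟩ := hS n hn
    set s := min (r m) (r n) with hs
    set g := m.gcd n with hg
    have hg0 : 0 < g := Nat.gcd_pos_of_pos_left n (Nat.pos_of_ne_zero hm0)
    obtain ⟨u, hu⟩ : g ∣ m := Nat.gcd_dvd_left m n
    obtain ⟨v, hv⟩ : g ∣ n := Nat.gcd_dvd_right m n
    have hmu : m / g = u := by rw [hu, Nat.mul_div_cancel_left _ hg0]
    have hnv : n / g = v := by rw [hv, Nat.mul_div_cancel_left _ hg0]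
    have hlcm : m.lcm n = m * v := by
      rw [Nat.lcm, ← hg, Nat.mul_div_assoc _ ⟨v, hv⟩, hnv]
    have hlcm' : m.lcm n = u * n := by
      rw [hlcm, hu, hv]; ring
    have hpl : ¬ p ∣ m.lcm n := by
      rw [hlcm, hp.out.dvd_mul, not_or]
      exact ⟨hpm, fun h => hpn (hv ▸ h.mul_left g)⟩
    refine ⟨(p ^ s : ℕ), ?_, ?_⟩
    · rw [Nat.isCoprime_iff_coprime]
      exact ((Nat.Prime.coprime_iff_not_dvd hp.out).2 hpl).pow_left s
    · rintro a ha hac b hb hbc ⟨x, hxa, hxb⟩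
      rw [hmu, hnv]
      have hdvd : ((p ^ s : ℕ) : ℤ) ∣ a * v - b * u := by
        have h1 := dvd_sub_of_mem_padicBall (min_le_left _ _) (min_le_right _ _) hxa hxb
        have h2 : (a * n - b * m : ℤ) = g * (a * v - b * u) := by
          rw [hu, hv]; push_cast; ring
        rw [h2] at h1
        refine IsCoprime.dvd_of_dvd_mul_left ?_ h1
        rw [Nat.isCoprime_iff_coprime]
        exact ((Nat.Prime.coprime_iff_not_dvd hp.out).2
          fun h => hpm (hu ▸ h.mul_right u)).pow_left s
      obtain ⟨c, hc⟩ := hdvd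
      rcases eq_or_ne c 0 with rfl | hc0
      · left
        have h1 : a * n = b * m := by
          have : (a * v : ℤ) = b * u := by linarith
          rw [hu, hv]
          have h2 : a * v = b * u := by exact_mod_cast this
          calc a * (g * v) = g * (a * v) := by ring
            _ = g * (b * u) := by rw [h2]
            _ = b * (g * u) := by ring
        have h2 : m ∣ n := hac.symm.dvd_of_dvd_mul_left ⟨b, by rw [h1, mul_comm]⟩
        have h3 : n ∣ m := hbc.symm.dvd_of_dvd_mul_left ⟨a, by rw [← h1, mul_comm]⟩
        have h4 := Nat.dvd_antisymm h2 h3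
        refine ⟨h4, ?_⟩
        rw [h4] at h1
        exact Nat.eq_of_mul_eq_mul_right (Nat.pos_of_ne_zero hn0) h1
      · right
        refine ⟨c, hc0, ?_, ⟨0, by rw [hc]; ring⟩⟩
        have hps : (0 : ℝ) < (p : ℝ) ^ s := by positivity
        have h1 : |((p : ℝ) ^ s) * c| ≤ m.lcm n := by
          have h2 : ((p : ℝ) ^ s) * c = (a * v : ℕ) - (b * u : ℕ) := by
            have : (((p ^ s : ℕ) : ℤ) * c : ℤ) = ((a * v : ℕ) : ℤ) - (b * u : ℕ) := by
              rw [← hc]; push_cast; ring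
            exact_mod_cast this
          have h3 : ((a * v : ℕ) : ℝ) ≤ m.lcm n := by
            rw [hlcm]; exact_mod_cast Nat.mul_le_mul_right v ha.le
          have h4 : ((b * u : ℕ) : ℝ) ≤ m.lcm n := by
            rw [hlcm', mul_comm u]; exact_mod_cast Nat.mul_le_mul_right u hb.le
          rw [h2, abs_le]
          constructor <;> linarith [Nat.cast_nonneg (α := ℝ) (a * v), Nat.cast_nonneg (α := ℝ) (b * u)]
        have hmax : ((p : ℝ) ^ s)⁻¹ ≤ max (ψ m) (ψ n) := by
          rcases min_choice (r m) (r n) with h | h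
          · rw [hs, h]; exact (hr m hm).trans (le_max_left _ _)
          · rw [hs, h]; exact (hr n hn).trans (le_max_right _ _)
        rw [abs_mul, abs_of_pos hps] at h1
        calc |(c : ℝ)| = ((p : ℝ) ^ s * |(c : ℝ)|) * ((p : ℝ) ^ s)⁻¹ := by field_simp
          _ ≤ m.lcm n * max (ψ m) (ψ n) := by gcongr
          _ ≤ 2 * m.lcm n * max (ψ m) (ψ n) := by
            have : 0 ≤ (m.lcm n : ℝ) * max (ψ m) (ψ n) :=
              mul_nonneg (Nat.cast_nonneg _) (le_trans (by positivity) hmax)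
            linarith
  · rintro _ ⟨⟨s, z⟩, rfl⟩
    simp only
    change ZMod (p ^ s) at z
    have : NeZero (p ^ s) := ⟨pow_ne_zero _ hp.out.ne_zero⟩
    rw [measureReal_padicCoset]
    have hlim := tendsto_card_filter_natCast_eq_mul (q := p ^ s) (S := S) (fun n hn =>
      ⟨(hS n hn).1, ((Nat.Prime.coprime_iff_not_dvd hp.out).2 (hS n hn).2).symm.pow_right _⟩) z
    push_cast at hlim
    refine hlim.congr' ?_
    have hsmall : ∀ᶠ n in atTop ⊓ 𝓟 S, ψ n < ((p : ℝ) ^ s)⁻¹ :=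
      hψ.eventually_lt_const (by positivity)
    filter_upwards [hsmall, mem_inf_of_right (mem_principal_self S)] with n hn hnS
    have hsr : s ≤ r n := by
      by_contra! h
      refine absurd ((hr n hnS).trans_lt hn) (not_lt.2 ?_)
      gcongr
      exact hp1.le
    rw [setIntegral_ballSum _ (measurableSet_padicBall r),
      integral_ballSum _ (measurableSet_padicBall r)]
    have h1 : ∀ a, μ.real (padicBall p r n a ∩ padicCoset p s z) =
        ((p : ℝ) ^ r n)⁻¹ * if (a : ZMod (p ^ s)) = z * n then 1 else 0 := by
      intro a
      rw [padicBall_inter_padicCoset (hS n hnS).2 hsr]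
      split_ifs
      · rw [hμ n hnS, mul_one]
      · simp
    simp only [h1, hμ n hnS, Finset.sum_const, card_reducedResidues, ← Finset.mul_sum,
      Finset.sum_boole, nsmul_eq_mul]
    rw [mul_comm (n.totient : ℝ), mul_div_mul_left _ _ (by positivity)]

end Padic

theorem abs_card_filter_range_div_mem_Ico_sub_le {N : ℕ} {α β : ℝ} (hα : 0 ≤ α) (hβ : β ≤ 1) :
    |(((Finset.range N).filter fun b : ℕ => α ≤ (b : ℝ) / N ∧ (b : ℝ) / N < β).card : ℝ) -
      max 0 (β - α) * N| ≤ 1 := by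
  rcases N.eq_zero_or_pos with rfl | hN
  · simp
  have hN' : (0 : ℝ) < N := by exact_mod_cast hN
  have h1 : ((Finset.range N).filter fun b : ℕ => α ≤ (b : ℝ) / N ∧ (b : ℝ) / N < β) =
      Finset.Ico ⌈α * N⌉₊ ⌈β * N⌉₊ := by
    ext b
    simp only [Finset.mem_filter, Finset.mem_range, Finset.mem_Ico, Nat.ceil_le, Nat.lt_ceil,
      le_div_iff₀ hN', div_lt_iff₀ hN']
    refine ⟨And.right, fun h => ⟨?_, h⟩⟩
    have : (b : ℝ) < N := h.2.trans_le (by nlinarith)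
    exact_mod_cast this
  have hα' : 0 ≤ α * N := by positivity
  have h2 := Nat.le_ceil (α * N)
  have h3 := Nat.ceil_lt_add_one hα'
  have h4 := Nat.le_ceil (β * N)
  rw [h1, Nat.card_Ico]
  rcases le_total β α with h | h
  · have : ⌈β * N⌉₊ ≤ ⌈α * N⌉₊ := Nat.ceil_mono (by gcongr)
    rw [Nat.sub_eq_zero_of_le this, max_eq_left (sub_nonpos.2 h)]
    simp
  · have : ⌈α * N⌉₊ ≤ ⌈β * N⌉₊ := Nat.ceil_mono (by gcongr)
    have h5 := Nat.ceil_lt_add_one (show 0 ≤ β * N by nlinarith)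
    rw [Nat.cast_sub this, max_eq_right (sub_nonneg.2 h), abs_le]
    constructor <;> nlinarith

instance : IsProbabilityMeasure (volume : Measure UnitAddCircle) := ⟨UnitAddCircle.measure_univ⟩

/-- The image in `ℝ/ℤ` of the interval `[0, s)`, for `0 ≤ s ≤ 1`. -/
def circleInitial (s : ℝ) : Set UnitAddCircle := {x | (AddCircle.equivIco 1 0 x : ℝ) < s}

theorem coe_mem_circleInitial {s t : ℝ} (h0 : 0 ≤ t) (h1 : t < 1) :
    (t : UnitAddCircle) ∈ circleInitial s ↔ t < s := by
  rw [circleInitial, Set.mem_ofPred_eq, AddCircle.equivIco_coe_of_mem ⟨h0, by linarith⟩]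

theorem isPiSystem_circleInitial : IsPiSystem (Set.range circleInitial) := by
  rintro _ ⟨s, rfl⟩ _ ⟨t, rfl⟩ -
  exact ⟨min s t, Set.ext fun _ => lt_min_iff (α := ℝ)⟩

theorem circleInitial_eq_univ {s : ℝ} (hs : 1 ≤ s) : circleInitial s = Set.univ :=
  Set.eq_univ_of_forall fun x => by
    have := (AddCircle.equivIco 1 0 x).2.2
    rw [circleInitial, Set.mem_ofPred_eq]
    linarith

theorem circleInitial_eq_empty {s : ℝ} (hs : s ≤ 0) : circleInitial s = ∅ :=
  Set.eq_empty_of_forall_notMem fun x hx => by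
    have := (AddCircle.equivIco 1 0 x).2.1
    rw [circleInitial, Set.mem_ofPred_eq] at hx
    linarith

theorem univ_mem_circleInitial : Set.univ ∈ Set.range circleInitial :=
  ⟨1, circleInitial_eq_univ le_rfl⟩

theorem generateFrom_circleInitial :
    MeasurableSpace.generateFrom (Set.range circleInitial) =
      (inferInstance : MeasurableSpace UnitAddCircle) := by
  have h : MeasurableSpace.comap (AddCircle.measurableEquivIco 1 0)
      (MeasurableSpace.comap Subtype.val (borel ℝ)) =
        (inferInstance : MeasurableSpace UnitAddCircle) := by
    rw [← BorelSpace.measurable_eq (α := ℝ)]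
    exact (AddCircle.measurableEquivIco 1 0).measurableEmbedding.comap_eq
  rw [← h, MeasurableSpace.comap_comp, borel_eq_generateFrom_Iio,
    MeasurableSpace.comap_generateFrom, ← Set.range_comp]
  rfl

theorem measurableSet_circleInitial (s : ℝ) : MeasurableSet (circleInitial s) :=
  measurableSet_lt (measurable_subtype_coe.comp (AddCircle.measurableEquivIco 1 0).measurable)
    measurable_const

theorem measureReal_circleInitial {s : ℝ} (h0 : 0 ≤ s) (h1 : s ≤ 1) :
    volume.real (circleInitial s) = s := by
  have h := (UnitAddCircle.measurePreserving_mk 0).measureReal_preimage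
    (measurableSet_circleInitial s).nullMeasurableSet
  rw [← h, Measure.restrict_congr_set Ioo_ae_eq_Ioc.symm, measureReal_restrict_apply' measurableSet_Ioo]
  have : QuotientAddGroup.mk ⁻¹' circleInitial s ∩ Set.Ioo (0 : ℝ) (0 + 1) = Set.Ioo 0 s := by
    ext t
    constructor
    · rintro ⟨h1, h2, h3⟩
      exact ⟨h2, (coe_mem_circleInitial h2.le (by linarith)).1 h1⟩
    · rintro ⟨h2, h3⟩
      exact ⟨(coe_mem_circleInitial h2.le (by linarith)).2 h3, h2, by linarith⟩
  rw [this, Real.volume_real_Ioo_of_le h0, sub_zero]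

/-- The closed ball of radius `ψ n` about `a / n` in `ℝ/ℤ`. -/
def circleBall (ψ : ℕ → ℝ) (n a : ℕ) : Set UnitAddCircle :=
  Metric.closedBall (((a : ℝ) / n : ℝ) : UnitAddCircle) (ψ n)

theorem measurableSet_circleBall (ψ : ℕ → ℝ) (n a : ℕ) : MeasurableSet (circleBall ψ n a) :=
  Metric.isClosed_closedBall.measurableSet

theorem measureReal_circleBall {ψ : ℕ → ℝ} {n : ℕ} (h0 : 0 ≤ ψ n) (h1 : ψ n ≤ 1 / 2) (a : ℕ) :
    volume.real (circleBall ψ n a) = 2 * ψ n := by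
  rw [measureReal_def, circleBall, AddCircle.volume_closedBall, min_eq_right (by linarith),
    ENNReal.toReal_ofReal (by linarith)]

theorem mem_circleBall {ψ : ℕ → ℝ} {n a : ℕ} {x : UnitAddCircle} (hx : x ∈ circleBall ψ n a) :
    ∃ t : ℝ, x = t ∧ |t - a / n| ≤ ψ n := by
  induction x using QuotientAddGroup.induction_on with | H t => ?_
  rw [circleBall, mem_closedBall_iff_norm] at hx
  change ‖((t - a / n : ℝ) : UnitAddCircle)‖ ≤ _ at hx
  rw [UnitAddCircle.norm_eq] at hx
  refine ⟨t - round (t - a / n : ℝ), ?_, by rwa [sub_right_comm]⟩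
  rw [AddCircle.coe_sub, eq_comm, sub_eq_self, AddCircle.coe_eq_zero_iff]
  exact ⟨round (t - a / n : ℝ), by simp⟩

theorem two_mul_card_le_sum_measureReal_circleBall_inter {ψ : ℕ → ℝ} {n : ℕ} (h0 : 0 ≤ ψ n)
    (h1 : ψ n ≤ 1 / 2) {A : Set UnitAddCircle} {u v : ℝ}
    (hA : ∀ t : ℝ, u ≤ t → t < v → (t : UnitAddCircle) ∈ A) :
    2 * ψ n * (((reducedResidues n).filter fun a : ℕ =>
        u + ψ n ≤ (a : ℝ) / n ∧ (a : ℝ) / n < v - ψ n).card : ℝ) ≤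
      ∑ a ∈ reducedResidues n, volume.real (circleBall ψ n a ∩ A) := by
  rw [← Finset.sum_boole, Finset.mul_sum]
  refine Finset.sum_le_sum fun a _ => ?_
  split_ifs with h
  · rw [mul_one, ← measureReal_circleBall h0 h1 a, Set.inter_eq_left.2]
    intro x hx
    obtain ⟨t, rfl, ht⟩ := mem_circleBall hx
    rw [abs_le] at ht
    exact hA t (by linarith) (by linarith)
  · rw [mul_zero]
    exact measureReal_nonneg

theorem tendsto_card_filter_div_mem_Ico {S : Set ℕ} (hS : ∀ n ∈ S, n ≠ 0) {ψ : ℕ → ℝ}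
    (h0 : ∀ n ∈ S, 0 ≤ ψ n) (hψ : Tendsto ψ (atTop ⊓ 𝓟 S) (nhds 0)) {u v : ℝ} (hu : 0 ≤ u)
    (huv : u ≤ v) (hv : v ≤ 1) :
    Tendsto (fun n : ℕ => (((reducedResidues n).filter fun a : ℕ =>
        u + ψ n ≤ (a : ℝ) / n ∧ (a : ℝ) / n < v - ψ n).card : ℝ) / n.totient)
      (atTop ⊓ 𝓟 S) (nhds (v - u)) := by
  have hθ : Tendsto (fun n => max 0 (v - ψ n - (u + ψ n))) (atTop ⊓ 𝓟 S) (nhds (v - u)) := by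
    have := (tendsto_const_nhds (x := (0 : ℝ))).max
      ((hψ.const_sub v).sub (hψ.const_add u))
    rwa [sub_zero, add_zero, max_eq_right (sub_nonneg.2 huv)] at this
  refine tendsto_card_filter_div_totient inf_le_left
    (fun n a : ℕ => u + ψ n ≤ (a : ℝ) / n ∧ (a : ℝ) / n < v - ψ n) hθ (C := 1) ?_
  rw [eventually_inf_principal]
  refine Eventually.of_forall fun n hnS d hd => ?_
  rw [card_filter_range_dvd_and hd (hS n hnS)]
  obtain ⟨e, rfl⟩ := hd
  have hd0 : d ≠ 0 := left_ne_zero_of_mul (hS _ hnS)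
  rw [Nat.mul_div_cancel_left _ (Nat.pos_of_ne_zero hd0)]
  have h2 : ∀ b : ℕ, ((d * b : ℕ) : ℝ) / (d * e : ℕ) = b / e := fun b => by
    push_cast
    exact mul_div_mul_left _ _ (Nat.cast_ne_zero.2 hd0)
  simp only [h2]
  exact abs_card_filter_range_div_mem_Ico_sub_le (by linarith [h0 _ hnS]) (by linarith [h0 _ hnS])

theorem isBallSystem_circle {S : Set ℕ} {ψ : ℕ → ℝ} {δ : ℝ} (hδ : δ ≤ 2) (hS : ∀ n ∈ S, n ≠ 0)
    (h0 : ∀ n ∈ S, 0 < ψ n) (h1 : ∀ n ∈ S, ψ n ≤ 1 / 2)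
    (hψ : Tendsto ψ (atTop ⊓ 𝓟 S) (nhds 0)) :
    IsBallSystem (volume : Measure UnitAddCircle) (Set.range circleInitial) S ψ δ
      (circleBall ψ) := by
  refine ⟨measurableSet_circleBall ψ, fun n hn a => ?_, fun n hn a => ?_, fun m hm n hn => ?_, ?_⟩
  · exact (measureReal_circleBall (h0 n hn).le (h1 n hn) a).le
  · rw [measureReal_circleBall (h0 n hn).le (h1 n hn) a]
    exact mul_le_mul_of_nonneg_right hδ (h0 n hn).le
  · have hm0 := hS m hm
    have hn0 := hS n hn
    set g := m.gcd n with hg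
    have hg0 : 0 < g := Nat.gcd_pos_of_pos_left n (Nat.pos_of_ne_zero hm0)
    obtain ⟨u, hu⟩ : g ∣ m := Nat.gcd_dvd_left m n
    obtain ⟨v, hv⟩ : g ∣ n := Nat.gcd_dvd_right m n
    have hmu : m / g = u := by rw [hu, Nat.mul_div_cancel_left _ hg0]
    have hnv : n / g = v := by rw [hv, Nat.mul_div_cancel_left _ hg0]
    have hlcm : m.lcm n = m * v := by
      rw [Nat.lcm, ← hg, Nat.mul_div_assoc _ ⟨v, hv⟩, hnv]
    have hlcm' : m.lcm n = u * n := by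
      rw [hlcm, hu, hv]; ring
    have hm0' : (0 : ℝ) < m := by exact_mod_cast Nat.pos_of_ne_zero hm0
    have hn0' : (0 : ℝ) < n := by exact_mod_cast Nat.pos_of_ne_zero hn0
    refine ⟨1, isCoprime_one_left, ?_⟩
    rintro a ha hac b hb hbc ⟨x, hxa, hxb⟩
    rw [hmu, hnv]
    obtain ⟨s, rfl, hs⟩ := mem_circleBall hxa
    obtain ⟨t, hst, ht⟩ := mem_circleBall hxb
    obtain ⟨z, hz⟩ : ∃ z : ℤ, (z : ℝ) = s - t := by
      have : ((s - t : ℝ) : UnitAddCircle) = 0 := by rw [AddCircle.coe_sub, hst, sub_self]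
      obtain ⟨z, hz⟩ := (AddCircle.coe_eq_zero_iff 1).1 this
      exact ⟨z, by simpa using hz⟩
    have hc : ((a * v - b * u - z * m.lcm n : ℤ) : ℝ) = m.lcm n * (a / m - b / n - z) := by
      have h2 : (m.lcm n : ℝ) = m * v := by exact_mod_cast hlcm
      have h3 : (m.lcm n : ℝ) = u * n := by exact_mod_cast hlcm'
      have h4 : (m.lcm n : ℝ) * (a / m) = a * v := by rw [h2]; field_simp
      have h5 : (m.lcm n : ℝ) * (b / n) = b * u := by rw [h3]; field_simp
      push_cast
      rw [mul_sub, mul_sub, h4, h5]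
      ring
    have hL : (0 : ℝ) < m.lcm n := by
      exact_mod_cast Nat.lcm_pos (Nat.pos_of_ne_zero hm0) (Nat.pos_of_ne_zero hn0)
    rcases eq_or_ne (a * v - b * u - z * m.lcm n : ℤ) 0 with h | h
    · left
      rw [h, Int.cast_zero, eq_comm, mul_eq_zero, or_iff_right hL.ne'] at hc
      have ha1 : (a : ℝ) / m < 1 := (div_lt_one hm0').2 (by exact_mod_cast ha)
      have hb1 : (b : ℝ) / n < 1 := (div_lt_one hn0').2 (by exact_mod_cast hb)
      have ha2 : 0 ≤ (a : ℝ) / m := by positivity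
      have hb2 : 0 ≤ (b : ℝ) / n := by positivity
      have hz0 : z = 0 := by
        have h2 : (z : ℝ) < 1 := by linarith
        have h3 : (-1 : ℝ) < z := by linarith
        have h4 : z < 1 := by exact_mod_cast h2
        have h5 : -1 < z := by exact_mod_cast h3
        omega
      rw [hz0, Int.cast_zero, sub_zero, sub_eq_zero, div_eq_div_iff hm0'.ne' hn0'.ne'] at hc
      have h1 : a * n = b * m := by exact_mod_cast hc
      have h2 : m ∣ n := hac.symm.dvd_of_dvd_mul_left ⟨b, by rw [h1, mul_comm]⟩
      have h3 : n ∣ m := hbc.symm.dvd_of_dvd_mul_left ⟨a, by rw [← h1, mul_comm]⟩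
      have h4 := Nat.dvd_antisymm h2 h3
      refine ⟨h4, ?_⟩
      rw [h4] at h1
      exact Nat.eq_of_mul_eq_mul_right (Nat.pos_of_ne_zero hn0) h1
    · right
      refine ⟨_, h, ?_, ⟨z, by ring⟩⟩
      rw [hc, abs_mul, abs_of_pos hL, mul_comm 2, mul_assoc]
      refine mul_le_mul_of_nonneg_left ?_ hL.le
      have h2 := le_max_left (ψ m) (ψ n)
      have h3 := le_max_right (ψ m) (ψ n)
      rw [abs_le] at hs ht ⊢
      constructor <;> linarith
  · rintro _ ⟨s', rfl⟩
    obtain ⟨s, hs0, hs1, hs⟩ : ∃ s, 0 ≤ s ∧ s ≤ 1 ∧ circleInitial s' = circleInitial s := by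
      rcases le_total s' 0 with h | h
      · exact ⟨0, le_rfl, zero_le_one, by
          rw [circleInitial_eq_empty h, circleInitial_eq_empty le_rfl]⟩
      · rcases le_total s' 1 with h' | h'
        · exact ⟨s', h, h', rfl⟩
        · exact ⟨1, zero_le_one, le_rfl, by
            rw [circleInitial_eq_univ h', circleInitial_eq_univ le_rfl]⟩
    simp only [hs, measureReal_circleInitial hs0 hs1]
    have hS0 : ∀ n ∈ S, 0 ≤ ψ n := fun n hn => (h0 n hn).le
    have hlow := tendsto_card_filter_div_mem_Ico hS hS0 hψ le_rfl hs0 hs1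
    have hhigh := (tendsto_card_filter_div_mem_Ico hS hS0 hψ hs0 hs1 le_rfl).const_sub 1
    rw [sub_zero] at hlow
    rw [sub_sub_cancel] at hhigh
    have hA : ∀ t : ℝ, 0 ≤ t → t < s → (t : UnitAddCircle) ∈ circleInitial s :=
      fun t h h' => (coe_mem_circleInitial h (h'.trans_le hs1)).2 h'
    have hA' : ∀ t : ℝ, s ≤ t → t < 1 → (t : UnitAddCircle) ∈ (circleInitial s)ᶜ :=
      fun t h h' => mt (coe_mem_circleInitial (hs0.trans h) h').1 h.not_gt
    have hsum : ∀ n ∈ S, ∑ a ∈ reducedResidues n, volume.real (circleBall ψ n a ∩ circleInitial s) +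
        ∑ a ∈ reducedResidues n, volume.real (circleBall ψ n a ∩ (circleInitial s)ᶜ) =
          n.totient * (2 * ψ n) := by
      intro n hn
      rw [← Finset.sum_add_distrib, ← card_reducedResidues, ← nsmul_eq_mul, ← Finset.sum_const]
      refine Finset.sum_congr rfl fun a _ => ?_
      rw [← measureReal_circleBall (h0 n hn).le (h1 n hn) a, ← Set.sdiff_eq,
        measureReal_inter_add_sdiff (measurableSet_circleInitial s)]
    have hprodInt : ∀ n ∈ S, ∫ x, ballSum (circleBall ψ) n x ∂volume = n.totient * (2 * ψ n) := by
      intro n hn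
      rw [integral_ballSum _ (measurableSet_circleBall ψ), ← card_reducedResidues,
        ← nsmul_eq_mul, ← Finset.sum_const]
      exact Finset.sum_congr rfl fun a _ => measureReal_circleBall (h0 n hn).le (h1 n hn) a
    have hpos : ∀ᶠ n in atTop ⊓ 𝓟 S, n ∈ S ∧ (0 : ℝ) < n.totient * (2 * ψ n) := by
      filter_upwards [mem_inf_of_right (mem_principal_self S)] with n hn
      have := Nat.totient_pos.2 (Nat.pos_of_ne_zero (hS n hn))
      have := h0 n hn
      exact ⟨hn, by positivity⟩
    refine tendsto_of_tendsto_of_tendsto_of_le_of_le' hlow hhigh ?_ ?_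
    · filter_upwards [hpos] with n ⟨hn, hn'⟩
      have h2 := two_mul_card_le_sum_measureReal_circleBall_inter (hS0 n hn) (h1 n hn) hA
      rw [hprodInt n hn, setIntegral_ballSum _ (measurableSet_circleBall ψ), le_div_iff₀ hn']
      refine le_trans (le_of_eq ?_) h2
      have := (pos_of_mul_pos_left hn' (by linarith [h0 n hn])).ne'
      field_simp
    · filter_upwards [hpos] with n ⟨hn, hn'⟩
      have h2 := two_mul_card_le_sum_measureReal_circleBall_inter (hS0 n hn) (h1 n hn) hA'
      rw [hprodInt n hn, setIntegral_ballSum _ (measurableSet_circleBall ψ), div_le_iff₀ hn']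
      have h3 := (pos_of_mul_pos_left hn' (by linarith [h0 n hn])).ne'
      rw [sub_mul, one_mul, ← mul_assoc (_ / _), div_mul_cancel₀ _ h3]
      linarith [hsum n hn]

theorem ae_infinite_prod_of_isBallSystem {ι κ : Type} [Fintype ι] [Fintype κ]
    (hικ : 2 ≤ Fintype.card ι + Fintype.card κ) {X : ι → Type} {Y : κ → Type}
    [mX : ∀ i, MeasurableSpace (X i)] [mY : ∀ j, MeasurableSpace (Y j)]
    (μ : ∀ i, Measure (X i)) (ν : ∀ j, Measure (Y j))
    [∀ i, IsProbabilityMeasure (μ i)] [∀ j, IsProbabilityMeasure (ν j)]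
    {C : ∀ i, Set (Set (X i))} {D : ∀ j, Set (Set (Y j))}
    (hC : ∀ i, IsPiSystem (C i)) (hD : ∀ j, IsPiSystem (D j))
    (hgenC : ∀ i, MeasurableSpace.generateFrom (C i) = mX i)
    (hgenD : ∀ j, MeasurableSpace.generateFrom (D j) = mY j)
    (hunivC : ∀ i, Set.univ ∈ C i) (hunivD : ∀ j, Set.univ ∈ D j)
    {S : Set ℕ} {ψ : ℕ → ℝ} (hS : ∀ n ∈ S, n ≠ 0 ∧ 0 < ψ n ∧ n.totient * ψ n ≤ 1)
    {δ : ℝ} (hδ : 0 < δ) {A : ∀ i, ℕ → ℕ → Set (X i)} {B : ∀ j, ℕ → ℕ → Set (Y j)}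
    (hA : ∀ i, IsBallSystem (μ i) (C i) S ψ δ (A i))
    (hB : ∀ j, IsBallSystem (ν j) (D j) S ψ δ (B j))
    (hdiv : ¬ Summable (S.indicator fun n =>
      (n.totient * ψ n) ^ (Fintype.card ι + Fintype.card κ))) :
    ∀ᵐ x ∂(Measure.pi μ).prod (Measure.pi ν),
      {n | n ∈ S ∧ (∀ i, ∃ a < n, a.Coprime n ∧ x.1 i ∈ A i n a) ∧
        ∀ j, ∃ a < n, a.Coprime n ∧ x.2 j ∈ B j n a}.Infinite := by
  let Z : ι ⊕ κ → Type := Sum.elim X Y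
  let mZ : ∀ i, MeasurableSpace (Z i) := fun i =>
    match i with
    | .inl i => mX i
    | .inr j => mY j
  let M : ∀ i, Measure (Z i) := fun i =>
    match i with
    | .inl i => μ i
    | .inr j => ν j
  have : ∀ i, IsProbabilityMeasure (M i) := fun i =>
    match i with
    | .inl i => inferInstanceAs (IsProbabilityMeasure (μ i))
    | .inr j => inferInstanceAs (IsProbabilityMeasure (ν j))
  let E : ∀ i, Set (Set (Z i)) := fun i =>
    match i with
    | .inl i => C i
    | .inr j => D j
  let F : ∀ i, ℕ → ℕ → Set (Z i) := fun i =>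
    match i with
    | .inl i => A i
    | .inr j => B j
  have h := ae_infinite_of_isBallSystem (ι := ι ⊕ κ) (X := Z) (by rwa [Fintype.card_sum]) M
    (C := E) (by rintro (i | j); exacts [hC i, hD j])
    (by rintro (i | j); exacts [hgenC i, hgenD j])
    (by rintro (i | j); exacts [hunivC i, hunivD j]) hS hδ
    (B := F) (by rintro (i | j); exacts [hA i, hB j])
    (by rwa [Fintype.card_sum])
  have h' := (measurePreserving_sumPiEquivProdPi M).symm.quasiMeasurePreserving.ae h
  filter_upwards [h'] with x hx
  exact hx.mono fun n hn => ⟨hn.1, fun i => hn.2 (.inl i), fun j => hn.2 (.inr j)⟩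

theorem card_filter_Icc_gcd_eq_one_le {n : ℕ} (hn : n ≠ 0) :
    ((Finset.Icc (-n : ℤ) n).filter fun a => Int.gcd a n = 1).card ≤ 3 * n.totient := by
  have h : ((Finset.Icc (-n : ℤ) n).filter fun a => Int.gcd a n = 1) ⊆
      (reducedResidues n ×ˢ ({-1, 0, 1} : Finset ℤ)).image fun x => (x.1 : ℤ) + n * x.2 := by
    intro a ha
    rw [Finset.mem_filter, Finset.mem_Icc] at ha
    obtain ⟨⟨h1, h2⟩, h3⟩ := ha
    have hn' : (0 : ℤ) < n := by exact_mod_cast Nat.pos_of_ne_zero hn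
    have h4 := Int.emod_nonneg a hn'.ne'
    have h5 := Int.emod_lt_of_pos a hn'
    have h6 := Int.emod_add_mul_ediv a n
    refine Finset.mem_image.2 ⟨((a % n).toNat, a / n), Finset.mem_product.2 ⟨?_, ?_⟩, ?_⟩
    · refine mem_reducedResidues.2 ⟨by omega, ?_⟩
      rw [← Nat.isCoprime_iff_coprime, Int.toNat_of_nonneg h4, ← IsCoprime.add_mul_left_left_iff,
        h6]
      exact Int.isCoprime_iff_gcd_eq_one.2 h3
    · have h7 : -2 < a / n := by nlinarith
      have h8 : a / n < 2 := by nlinarith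
      simp only [Finset.mem_insert, Finset.mem_singleton]
      omega
    · simp only [Int.toNat_of_nonneg h4, h6]
  refine (Finset.card_le_card h).trans (Finset.card_image_le.trans ?_)
  rw [Finset.card_product, card_reducedResidues, mul_comm]
  exact Nat.mul_le_mul_right _ Finset.card_le_three

theorem measure_exists_gcd_eq_one_mem_le {X : Type*} [MeasurableSpace X] (μ : Measure X) {n : ℕ}
    (hn : n ≠ 0) {B : ℤ → Set X} {ε : ℝ} (hB : ∀ a, μ (B a) ≤ ENNReal.ofReal ε) :
    μ {x | ∃ a : ℤ, |a| ≤ (n : ℤ) ∧ Int.gcd a n = 1 ∧ x ∈ B a} ≤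
      ENNReal.ofReal (3 * n.totient * ε) := by
  have h : {x | ∃ a : ℤ, |a| ≤ (n : ℤ) ∧ Int.gcd a n = 1 ∧ x ∈ B a} ⊆
      ⋃ a ∈ (Finset.Icc (-n : ℤ) n).filter fun a => Int.gcd a n = 1, B a := by
    rintro x ⟨a, h1, h2, h3⟩
    exact Set.mem_biUnion (Finset.mem_coe.2 (Finset.mem_filter.2
      ⟨Finset.mem_Icc.2 (abs_le.1 h1), h2⟩)) h3
  calc _ ≤ ∑ a ∈ (Finset.Icc (-n : ℤ) n).filter fun a => Int.gcd a n = 1, μ (B a) :=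
        (measure_mono h).trans (measure_biUnion_finset_le _ _)
    _ ≤ ∑ a ∈ (Finset.Icc (-n : ℤ) n).filter fun a => Int.gcd a n = 1, ENNReal.ofReal ε :=
        Finset.sum_le_sum fun a _ => hB a
    _ ≤ (3 * n.totient : ℕ) * ENNReal.ofReal ε := by
        rw [Finset.sum_const, nsmul_eq_mul]
        gcongr
        exact card_filter_Icc_gcd_eq_one_le hn
    _ = ENNReal.ofReal (3 * n.totient * ε) := by
        rw [ENNReal.ofReal_mul (by positivity)]
        congr 1
        rw [← ENNReal.ofReal_natCast]
        push_cast
        rfl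

theorem measureReal_le_of_norm_sub_le {p : ℕ} [hp : Fact p.Prime] [MeasurableSpace ℤ_[p]]
    [BorelSpace ℤ_[p]] (μ : Measure ℤ_[p]) [μ.IsAddHaarMeasure] [IsProbabilityMeasure μ]
    {A : Set ℤ_[p]} {ε : ℝ} (hε : 0 ≤ ε) (hA : ∀ x ∈ A, ∀ y ∈ A, ‖x - y‖ ≤ ε) : μ.real A ≤ ε := by
  have hp1 : (1 : ℝ) < p := by exact_mod_cast hp.out.one_lt
  have hp0 : (0 : ℝ) < p := zero_lt_one.trans hp1
  refine le_of_forall_pos_le_add fun η hη => ?_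
  rcases A.eq_empty_or_nonempty with rfl | ⟨x, hx⟩
  · rw [measureReal_empty]
    positivity
  rcases le_or_gt 1 (ε + η) with h1 | h1
  · exact measureReal_le_one.trans h1
  obtain ⟨s, hs, hs'⟩ := exists_nat_pow_near_of_lt_one (show 0 < ε + η by positivity) h1.le
    (inv_pos.2 hp0) (inv_lt_one_of_one_lt₀ hp1)
  refine le_trans ?_ hs.le
  rw [inv_pow, ← measureReal_padicCoset μ (s + 1) (PadicInt.toZModPow (s + 1) x)]
  refine measureReal_mono fun y hy => ?_
  rw [mem_padicCoset, toZModPow_eq_iff_norm_sub_le, PadicInt.norm_le_pow_iff_norm_lt_pow_add_one]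
  refine ((hA y hy x hx).trans_lt (lt_add_of_pos_right ε hη)).trans_le ?_
  rw [← zpow_natCast, inv_zpow'] at hs'
  push_cast
  rw [neg_add_rev, add_comm (-1 : ℤ), add_assoc, neg_add_cancel, add_zero]
  exact hs'

/-- A choice of exponent `r` for which `p ^ (-r)` is comparable to `ε`. -/
theorem exists_inv_pow_le_and_le {p : ℕ} (hp : 1 < p) {ε : ℝ} (h0 : 0 < ε) (h1 : ε ≤ 1) :
    ∃ r : ℕ, ((p : ℝ) ^ r)⁻¹ ≤ ε ∧ (p : ℝ)⁻¹ * ε ≤ ((p : ℝ) ^ r)⁻¹ := by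
  have hp1 : (1 : ℝ) < p := by exact_mod_cast hp
  have hp0 : (0 : ℝ) < p := zero_lt_one.trans hp1
  obtain ⟨s, hs, hs'⟩ := exists_nat_pow_near_of_lt_one h0 h1
    (inv_pos.2 hp0) (inv_lt_one_of_one_lt₀ hp1)
  refine ⟨s + 1, by rw [← inv_pow]; exact hs.le, ?_⟩
  rw [← inv_pow, pow_succ']
  gcongr


section ProductSpace

variable {ℓ k : ℕ} {P : Fin k → ℕ} [hP : ∀ i, Fact (P i).Prime] {ψ : ℕ → ℝ} {n : ℕ}

theorem prodE_eq_univ_of_one_le (h1 : 1 ≤ ψ n) (hne : (prodE ℓ k P ψ n).Nonempty) :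
    prodE ℓ k P ψ n = Set.univ := by
  obtain ⟨y, hy1, hy2⟩ := hne
  refine Set.eq_univ_of_forall fun x => ⟨fun i => ?_, fun j => ?_⟩
  · obtain ⟨a, ha, han, -⟩ := hy1 i
    refine ⟨a, ha, han, ?_⟩
    have := AddCircle.norm_le_half_period 1 one_ne_zero
      (x := x.1 i - (((a : ℝ) / (n : ℝ) : ℝ) : UnitAddCircle))
    rw [abs_one] at this
    linarith
  · obtain ⟨a, ha, han, h⟩ := hy2 j
    refine ⟨a, ha, han, ?_⟩
    rw [← sub_add_sub_cancel _ ((y.2 j : ℤ_[P j]) : ℚ_[P j])]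
    refine (Padic.nonarchimedean _ _).trans (max_le ?_ h)
    rw [← PadicInt.coe_sub]
    exact (PadicInt.norm_le_one (x.2 j - y.2 j)).trans h1

theorem prodE_eq_empty_of_dvd (hn : n ≠ 0) (h1 : ψ n < 1) {j : Fin k} (hj : P j ∣ n) :
    prodE ℓ k P ψ n = ∅ := by
  refine Set.eq_empty_of_forall_notMem fun x hx => ?_
  obtain ⟨a, -, han, h⟩ := hx.2 j
  have ha : ‖(a : ℚ_[P j])‖ = 1 := by
    refine le_antisymm (Padic.norm_int_le_one a) (not_lt.1 fun h => ?_)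
    rw [Padic.norm_intCast_lt_one_iff] at h
    have h2 := Int.dvd_coe_gcd h (Int.natCast_dvd_natCast.2 hj)
    rw [han] at h2
    exact (hP j).out.one_lt.ne' (Nat.dvd_one.1 (by exact_mod_cast h2))
  have hn1 : ‖(n : ℚ_[P j])‖ < 1 := Padic.norm_natCast_lt_one_iff.2 hj
  have hn0 : 0 < ‖(n : ℚ_[P j])‖ := norm_pos_iff.2 (Nat.cast_ne_zero.2 hn)
  have h3 : 1 < ‖(a : ℚ_[P j]) / n‖ := by
    rw [norm_div, ha]
    exact (one_lt_div hn0).2 hn1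
  have h4 : ‖(a : ℚ_[P j]) / n‖ ≤ 1 := by
    rw [← sub_sub_cancel ((x.2 j : ℤ_[P j]) : ℚ_[P j]) (a / n), sub_eq_add_neg]
    refine (Padic.nonarchimedean _ _).trans (max_le (x.2 j).2 ?_)
    rw [norm_neg]
    exact h.trans h1.le
  exact h3.not_ge h4

variable [∀ i, MeasurableSpace ℤ_[P i]] [∀ i, BorelSpace ℤ_[P i]]
  (μs : (i : Fin k) → Measure ℤ_[P i]) [∀ i, IsProbabilityMeasure (μs i)]

instance : IsProbabilityMeasure (prodMeasure ℓ k P μs) := by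
  unfold prodMeasure
  infer_instance

variable [∀ i, (μs i).IsAddHaarMeasure]

theorem prodMeasure_prodE_le (hn : n ≠ 0) (h0 : 0 ≤ ψ n) :
    prodMeasure ℓ k P μs (prodE ℓ k P ψ n) ≤
      ENNReal.ofReal ((6 * (n.totient * ψ n)) ^ (ℓ + k)) := by
  have h : prodE ℓ k P ψ n =
      (Set.univ.pi fun _ : Fin ℓ => {x | ∃ a : ℤ, |a| ≤ (n : ℤ) ∧ Int.gcd a n = 1 ∧
        x ∈ Metric.closedBall (((a : ℝ) / (n : ℝ) : ℝ) : UnitAddCircle) (ψ n)}) ×ˢ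
      (Set.univ.pi fun j : Fin k => {x | ∃ a : ℤ, |a| ≤ (n : ℤ) ∧ Int.gcd a n = 1 ∧
        x ∈ {x : ℤ_[P j] | ‖(x : ℚ_[P j]) - (a : ℚ_[P j]) / (n : ℚ_[P j])‖ ≤ ψ n}}) := by
    ext x
    simp [prodE, dist_eq_norm]
  have h1 : 3 * n.totient * (2 * ψ n) = 6 * (n.totient * ψ n) := by ring
  rw [h, prodMeasure, Measure.prod_prod, Measure.pi_pi, Measure.pi_pi,
    ENNReal.ofReal_pow (by positivity), pow_add]
  refine mul_le_mul' ?_ ?_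
  · rw [← Finset.card_fin ℓ, ← Finset.prod_const, Finset.card_fin]
    refine Finset.prod_le_prod' fun i _ => ?_
    rw [← h1]
    refine measure_exists_gcd_eq_one_mem_le _ hn fun a => ?_
    rw [AddCircle.volume_closedBall]
    exact ENNReal.ofReal_le_ofReal (min_le_right _ _)
  · rw [← Fin.prod_const]
    refine Finset.prod_le_prod' fun j _ => ?_
    rw [← h1]
    refine measure_exists_gcd_eq_one_mem_le _ hn fun a => ?_
    rw [← ofReal_measureReal]
    refine ENNReal.ofReal_le_ofReal ((measureReal_le_of_norm_sub_le (μs j) h0 ?_).trans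
      (by linarith))
    intro x hx y hy
    rw [PadicInt.norm_def, PadicInt.coe_sub,
      ← sub_sub_sub_cancel_right _ _ ((a : ℚ_[P j]) / (n : ℚ_[P j])), sub_eq_add_neg]
    refine (Padic.nonarchimedean _ _).trans (max_le hx ?_)
    rw [norm_neg]
    exact hy

end ProductSpace

theorem norm_sub_div_le_of_mem_padicBall {p : ℕ} [hp : Fact p.Prime] {r : ℕ → ℕ} {n a : ℕ}
    (hn : ¬ p ∣ n) {x : ℤ_[p]} (hx : x ∈ padicBall p r n a) :
    ‖(x : ℚ_[p]) - (a : ℚ_[p]) / (n : ℚ_[p])‖ ≤ ((p : ℝ) ^ r n)⁻¹ := by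
  have hn1 : ‖(n : ℚ_[p])‖ = 1 := by
    refine le_antisymm (by simpa using Padic.norm_int_le_one (p := p) (n : ℤ))
      (not_lt.1 fun h => hn (Padic.norm_natCast_lt_one_iff.1 h))
  have hn0 : (n : ℚ_[p]) ≠ 0 := norm_pos_iff.1 (hn1 ▸ one_pos)
  have h1 : PadicInt.toZModPow (r n) (x * (n : ℤ_[p])) = PadicInt.toZModPow (r n) (a : ℤ_[p]) := by
    rw [map_natCast]
    exact hx
  rw [toZModPow_eq_iff_norm_sub_le, PadicInt.norm_def, zpow_neg, zpow_natCast] at h1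
  push_cast at h1
  calc _ = ‖(x : ℚ_[p]) - (a : ℚ_[p]) / (n : ℚ_[p])‖ * ‖(n : ℚ_[p])‖ := by rw [hn1, mul_one]
    _ = ‖(x : ℚ_[p]) * n - a‖ := by rw [← norm_mul, sub_mul, div_mul_cancel₀ _ hn0]
    _ ≤ _ := h1

theorem tendsto_inv_totient : Tendsto (fun n : ℕ => ((n.totient : ℝ))⁻¹) atTop (nhds 0) := by
  refine squeeze_zero (fun n => by positivity) (fun n => ?_) tendsto_card_divisors_div_totient
  rcases n.eq_zero_or_pos with rfl | hn
  · simp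
  · rw [inv_eq_one_div]
    gcongr
    exact_mod_cast Finset.card_pos.2 (Nat.nonempty_divisors.2 hn.ne')

section Divergence

variable {ℓ k : ℕ} {P : Fin k → ℕ} [hP : ∀ i, Fact (P i).Prime] [∀ i, MeasurableSpace ℤ_[P i]]
  [∀ i, BorelSpace ℤ_[P i]] (μs : (i : Fin k) → Measure ℤ_[P i]) [∀ i, (μs i).IsAddHaarMeasure]
  [∀ i, IsProbabilityMeasure (μs i)] {ψ : ℕ → ℝ}

theorem prodMeasure_prodW_eq_one_of_not_summable (hlk : 2 ≤ ℓ + k) {S : Set ℕ}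
    (hS : ∀ n ∈ S, 2 < n ∧ 0 < ψ n ∧ ∀ j, ¬ P j ∣ n)
    (hdiv : ¬ Summable (S.indicator fun n : ℕ =>
      (n.totient * min (ψ n) (n.totient : ℝ)⁻¹) ^ (ℓ + k))) :
    prodMeasure ℓ k P μs (prodW ℓ k P ψ) = 1 := by
  set φ : ℕ → ℝ := fun n => min (ψ n) (n.totient : ℝ)⁻¹ with hφ
  have htot : ∀ n ∈ S, (2 : ℝ) ≤ n.totient := by
    intro n hn
    obtain ⟨t, ht⟩ := Nat.totient_even (hS n hn).1
    have h1 : 0 < n.totient := Nat.totient_pos.2 (by have := (hS n hn).1; omega)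
    have : 2 ≤ n.totient := by omega
    exact_mod_cast this
  have hφ0 : ∀ n ∈ S, 0 < φ n := fun n hn =>
    lt_min (hS n hn).2.1 (inv_pos.2 (by linarith [htot n hn]))
  have hφ2 : ∀ n ∈ S, φ n ≤ 1 / 2 := fun n hn => (min_le_right _ _).trans <| by
    rw [inv_eq_one_div]
    exact one_div_le_one_div_of_le two_pos (htot n hn)
  have hφlim : Tendsto φ (atTop ⊓ 𝓟 S) (nhds 0) := by
    refine squeeze_zero' ?_ (Eventually.of_forall fun n => min_le_right _ _)
      (tendsto_inv_totient.mono_left inf_le_left)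
    filter_upwards [mem_inf_of_right (mem_principal_self S)] with n hn using (hφ0 n hn).le
  have hr : ∀ j, ∃ r : ℕ → ℕ, ∀ n ∈ S,
      ((P j : ℝ) ^ r n)⁻¹ ≤ φ n ∧ (P j : ℝ)⁻¹ * φ n ≤ ((P j : ℝ) ^ r n)⁻¹ := by
    intro j
    have : ∀ n, ∃ r : ℕ, n ∈ S →
        ((P j : ℝ) ^ r)⁻¹ ≤ φ n ∧ (P j : ℝ)⁻¹ * φ n ≤ ((P j : ℝ) ^ r)⁻¹ := by
      intro n
      by_cases hn : n ∈ S
      · obtain ⟨r, hr⟩ := exists_inv_pow_le_and_le (hP j).out.one_lt (hφ0 n hn)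
          ((hφ2 n hn).trans (by norm_num))
        exact ⟨r, fun _ => hr⟩
      · exact ⟨0, fun h => absurd h hn⟩
    choose r hr using this
    exact ⟨r, hr⟩
  choose r hr using hr
  set N : ℕ := ∏ j, P j with hN
  have hN0 : 0 < N := Finset.prod_pos fun j _ => (hP j).out.pos
  have hN0' : (0 : ℝ) < N := by exact_mod_cast hN0
  have hNP : ∀ j, (N : ℝ)⁻¹ ≤ (P j : ℝ)⁻¹ := fun j =>
    inv_anti₀ (by exact_mod_cast (hP j).out.pos)
      (by exact_mod_cast Nat.le_of_dvd hN0 (Finset.dvd_prod_of_mem P (Finset.mem_univ j)))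
  have hN2 : (N : ℝ)⁻¹ ≤ 2 :=
    (inv_le_one_of_one_le₀ (by exact_mod_cast hN0)).trans one_le_two
  have key := ae_infinite_prod_of_isBallSystem (ι := Fin ℓ) (κ := Fin k)
    (by simpa using hlk) (fun _ => (volume : Measure UnitAddCircle)) μs
    (C := fun _ => Set.range circleInitial) (D := fun j => padicCosets (P j))
    (fun _ => isPiSystem_circleInitial) (fun _ => isPiSystem_padicCosets)
    (fun _ => generateFrom_circleInitial) (fun _ => generateFrom_padicCosets)
    (fun _ => univ_mem_circleInitial) (fun _ => univ_mem_padicCosets) (S := S) (ψ := φ)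
    (fun n hn => ⟨by have := (hS n hn).1; omega, hφ0 n hn, by
      have h2 := htot n hn
      calc (n.totient : ℝ) * φ n ≤ n.totient * (n.totient : ℝ)⁻¹ := by
            gcongr
            exact min_le_right _ _
        _ = 1 := mul_inv_cancel₀ (by linarith)⟩)
    (inv_pos.2 hN0') (A := fun _ => circleBall φ) (B := fun j => padicBall (P j) (r j))
    (fun _ => isBallSystem_circle hN2 (fun n hn => by have := (hS n hn).1; omega) hφ0 hφ2 hφlim)
    (fun j => isBallSystem_padic (μs j)
      (fun n hn => ⟨by have := (hS n hn).1; omega, (hS n hn).2.2 j⟩)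
      (fun n hn => (hr j n hn).1)
      (fun n hn => (mul_le_mul_of_nonneg_right (hNP j) (hφ0 n hn).le).trans (hr j n hn).2) hφlim)
    (by simpa using hdiv)
  have hae : prodW ℓ k P ψ =ᵐ[prodMeasure ℓ k P μs] Set.univ := by
    refine eventuallyEq_univ.2 ?_
    filter_upwards [key] with x hx
    refine hx.mono ?_
    rintro n ⟨hn, h1, h2⟩
    refine ⟨fun i => ?_, fun j => ?_⟩
    · obtain ⟨a, ha, han, h⟩ := h1 i
      refine ⟨a, ?_, han, ?_⟩
      · rw [Nat.abs_cast]
        exact_mod_cast ha.le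
      · rw [Int.cast_natCast]
        exact (mem_closedBall_iff_norm.1 h).trans (min_le_left _ _)
    · obtain ⟨a, ha, han, h⟩ := h2 j
      refine ⟨a, ?_, han, ?_⟩
      · rw [Nat.abs_cast]
        exact_mod_cast ha.le
      · rw [Int.cast_natCast]
        exact (norm_sub_div_le_of_mem_padicBall ((hS n hn).2.2 j) h).trans
          ((hr j n hn).1.trans (min_le_left _ _))
  rw [measure_congr hae, measure_univ]

theorem prodMeasure_prodE_le_mul_min_pow {n : ℕ} (hn : n ≠ 0) (h0 : 0 ≤ ψ n) :
    prodMeasure ℓ k P μs (prodE ℓ k P ψ n) ≤ ENNReal.ofReal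
      (6 ^ (ℓ + k) * (n.totient * min (ψ n) (n.totient : ℝ)⁻¹) ^ (ℓ + k)) := by
  have hφ : (0 : ℝ) < n.totient := by exact_mod_cast Nat.totient_pos.2 (Nat.pos_of_ne_zero hn)
  rcases le_total (ψ n) (n.totient : ℝ)⁻¹ with h | h
  · rw [min_eq_left h, ← mul_pow]
    exact prodMeasure_prodE_le μs hn h0
  · rw [min_eq_right h, mul_inv_cancel₀ hφ.ne', one_pow, mul_one]
    refine prob_le_one.trans ?_
    rw [ENNReal.one_le_ofReal]
    exact one_le_pow₀ (by norm_num)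

end Divergence

/-- **Theorem 5 (Haynes).** Let `ℓ ≥ 0`, `k ≥ 1` with `ℓ + k > 1`, and let
`p_1, …, p_k` be (not necessarily distinct) primes.  For every non-negative `ψ`, the
set `W_{ℓ,p_1,…,p_k}(ψ)` has full measure if and only if
`Σ_n μ(E_n^{ℓ,p_1,…,p_k}(ψ)) = ∞`. -/
theorem stmt8 (ℓ k : ℕ) (hk : 1 ≤ k) (hlk : 1 < ℓ + k)
    (P : Fin k → ℕ) [∀ i, Fact (P i).Prime]
    [∀ i, MeasurableSpace ℤ_[P i]] [∀ i, BorelSpace ℤ_[P i]]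
    (μs : (i : Fin k) → Measure ℤ_[P i])
    [∀ i, (μs i).IsAddHaarMeasure] [∀ i, IsProbabilityMeasure (μs i)]
    (ψ : ℕ → ℝ) (hψ : ∀ n, 0 ≤ ψ n) :
    prodMeasure ℓ k P μs (prodW ℓ k P ψ) = 1 ↔
      ∑' n : ℕ, prodMeasure ℓ k P μs (prodE ℓ k P ψ n) = ⊤ := by
  have hlim : prodW ℓ k P ψ = {x | ∃ᶠ n in atTop, x ∈ prodE ℓ k P ψ n} :=
    Set.ext fun x => Nat.frequently_atTop_iff_infinite.symm
  constructor
  · intro h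
    by_contra hne
    rw [hlim, measure_setOfPred_frequently_eq_zero (p := fun n x => x ∈ prodE ℓ k P ψ n) hne] at h
    exact zero_ne_one h
  intro hsum
  by_cases hbig : {n | 1 ≤ ψ n ∧ (prodE ℓ k P ψ n).Nonempty}.Infinite
  · have : prodW ℓ k P ψ = Set.univ := Set.eq_univ_of_forall fun x =>
      hbig.mono fun n hn => by
        rw [Set.mem_ofPred_eq, prodE_eq_univ_of_one_le hn.1 hn.2]
        trivial
    rw [this, measure_univ]
  refine prodMeasure_prodW_eq_one_of_not_summable μs hlk
    (S := {n | 2 < n ∧ 0 < ψ n ∧ ∀ j, ¬ P j ∣ n}) (fun n hn => hn) fun hS => ?_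
  set T := {n | 1 ≤ ψ n ∧ (prodE ℓ k P ψ n).Nonempty} ∪ Set.Iic 2 with hT
  have hTfin : T.Finite := (Set.not_infinite.1 hbig).union (Set.finite_Iic 2)
  have hsumT : Summable (T.indicator fun _ => (1 : ℝ)) :=
    summable_of_hasFiniteSupport (hTfin.subset Set.support_indicator_subset)
  refine (hsumT.add (hS.mul_left (6 ^ (ℓ + k)))).tsum_ofReal_ne_top (top_le_iff.1 ?_)
  rw [← hsum]
  refine ENNReal.tsum_le_tsum fun n => ?_
  by_cases hnT : n ∈ T
  · refine prob_le_one.trans ?_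
    rw [ENNReal.one_le_ofReal, Set.indicator_of_mem hnT]
    refine le_add_of_nonneg_right (mul_nonneg (by positivity) (Set.indicator_nonneg ?_ _))
    intro m _
    have := hψ m
    positivity
  rw [Set.indicator_of_notMem hnT, zero_add]
  rw [hT, Set.mem_union, not_or, Set.mem_ofPred_eq, not_and, Set.mem_Iic, not_le] at hnT
  obtain ⟨hn1, hn2⟩ := hnT
  have hn0 : n ≠ 0 := by omega
  have hle := prodMeasure_prodE_le_mul_min_pow (ℓ := ℓ) μs hn0 (hψ n)
  by_cases hnS : n ∈ {n | 2 < n ∧ 0 < ψ n ∧ ∀ j, ¬ P j ∣ n}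
  · rwa [Set.indicator_of_mem hnS]
  suffices h : prodMeasure ℓ k P μs (prodE ℓ k P ψ n) = 0 by rw [h]; exact zero_le
  rcases (hψ n).eq_or_lt with h | h
  · have h0 : (0 : ℝ) ≤ (n.totient : ℝ)⁻¹ := by positivity
    rw [← h, min_eq_left h0, mul_zero, zero_pow (by omega), mul_zero, ENNReal.ofReal_zero] at hle
    exact le_zero_iff.1 hle
  · obtain ⟨j, hj⟩ : ∃ j, P j ∣ n := by
      by_contra! h'
      exact hnS ⟨hn2, h, h'⟩
    have : prodE ℓ k P ψ n = ∅ := by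
      rcases lt_or_ge (ψ n) 1 with h1 | h1
      · exact prodE_eq_empty_of_dvd hn0 h1 hj
      · exact Set.not_nonempty_iff_eq_empty.1 (hn1 h1)
    rw [this, measure_empty]
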